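/- Let G_0 = G_0(n) be any sequence of graphs on the vertex set {1,…,n} and let G_rand ∼ G(n,p) for some p = p_n ∈ [0,1/2] satisfying p ≥ (1+(log n)^{-40})/n, and set G = G_0 △ G_rand. Then with high probability G has the property that u and v receive distinct colours in the stable colouring R*_G σ for every pair of distinct vertices u, v satisfying at least one of the following: (A1) u ∈ V_{2,3}^{safe}(G_rand); or (A2) u, v ∈ V_{2,3}(G_rand) and G_0 is the empty graph. -/

import Mathlib

open MeasureTheory Filter

/-- Product of (independent) Bernoulli distributions on `ι → Bool`, with
success probability `q i` in coordinate `i`. -/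
noncomputable def bernoulliProduct (ι : Type*) [Fintype ι] [DecidableEq ι] (q : ι → ℝ) :
    Measure (ι → Bool) :=
  ∑ f : ι → Bool,
    (∏ i : ι, if f i then ENNReal.ofReal (q i) else ENNReal.ofReal (1 - q i)) •
      Measure.dirac f

/-- The Erdős–Rényi measure: each (potential) edge of the complete graph on `Fin n`
is present independently with probability `p`; encoded as a random `Sym2 (Fin n) → Bool`. -/
noncomputable def erdosRenyiMeasure (n : ℕ) (p : ℝ) : Measure (Sym2 (Fin n) → Bool) :=
  bernoulliProduct (Sym2 (Fin n)) fun _ => p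

/-- The graph on `Fin n` determined by an edge-indicator function. -/
def graphOfFlip {n : ℕ} (f : Sym2 (Fin n) → Bool) : SimpleGraph (Fin n) :=
  SimpleGraph.fromRel fun u v => f s(u, v) = true

/-- Symmetric difference of two graphs on the same vertex set. -/
def symmDiffG {V : Type*} (G₁ G₂ : SimpleGraph V) : SimpleGraph V :=
  SimpleGraph.fromRel fun u v => Xor' (G₁.Adj u v) (G₂.Adj u v)

/-- `crEquiv G c t u v` : vertices `u` and `v` get the same colour after `t` rounds of
colour refinement on `G`, starting from the colouring `c`. -/
def crEquiv {V : Type*} {Ω : Type*} (G : SimpleGraph V) (c : V → Ω) : ℕ → V → V → Prop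
  | 0, u, v => c u = c v
  | (t + 1), u, v => crEquiv G c t u v ∧ ∀ w : V,
      Nat.card {x : V // G.Adj u x ∧ crEquiv G c t x w} =
      Nat.card {x : V // G.Adj v x ∧ crEquiv G c t x w}

/-- `u` and `v` get the same colour in the stable colouring `R* c`. -/
def crStable {V : Type*} {Ω : Type*} (G : SimpleGraph V) (c : V → Ω) (u v : V) : Prop :=
  ∀ t, crEquiv G c t u v

/-- `u` and `v` get the same colour in the stable colouring `R* σ`
(colour refinement started from the trivial colouring). -/
def crStableTrivial {V : Type*} (G : SimpleGraph V) (u v : V) : Prop :=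
  crStable G (fun _ => (0 : ℕ)) u v

/-- Equality of the initial pair-colourings `φ_{G,c}` on two ordered pairs of vertices. -/
def wl2Init {V : Type*} {Ω : Type*} (G : SimpleGraph V) (c : V → Ω) (p q : V × V) : Prop :=
  (G.Adj p.1 p.2 ↔ G.Adj q.1 q.2) ∧ (p.1 = p.2 ↔ q.1 = q.2) ∧
    (p.1 = p.2 → q.1 = q.2 → c p.2 = c q.2)

/-- `wl2Equiv G c t p q` : the ordered pairs `p` and `q` get the same colour after `t` rounds of
the 2-dimensional Weisfeiler–Leman refinement on `G`, started from `φ_{G,c}`. -/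
def wl2Equiv {V : Type*} {Ω : Type*} (G : SimpleGraph V) (c : V → Ω) :
    ℕ → V × V → V × V → Prop
  | 0, p, q => wl2Init G c p q
  | (t + 1), p, q => wl2Equiv G c t p q ∧ ∀ r s : V × V,
      Nat.card {w : V // wl2Equiv G c t (p.1, w) r ∧ wl2Equiv G c t (w, p.2) s} =
      Nat.card {w : V // wl2Equiv G c t (q.1, w) r ∧ wl2Equiv G c t (w, q.2) s}

/-- `u` and `v` get the same colour in the vertex colouring `V* c` obtained from the stable
pair colouring of the 2-dimensional Weisfeiler–Leman algorithm started from `φ_{G,c}`. -/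
def wl2VertexEquiv {V : Type*} {Ω : Type*} (G : SimpleGraph V) (c : V → Ω) (u v : V) : Prop :=
  ∀ t, wl2Equiv G c t (u, u) (v, v)

/-- Given a colouring of `V(H)` encoded as the equivalence relation `r` ("has the same colour"),
`majority H r u v` says that at least half of the possible edges between the colour class of `u`
and the colour class of `v` are present in `H` (counting ordered pairs). -/
def majority {V : Type*} (H : SimpleGraph V) (r : V → V → Prop) (u v : V) : Prop :=
  Nat.card {p : V × V // p.1 ≠ p.2 ∧ r p.1 u ∧ r p.2 v} ≤
    2 * Nat.card {p : V × V // p.1 ≠ p.2 ∧ r p.1 u ∧ r p.2 v ∧ H.Adj p.1 p.2}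

/-- The disparity graph `D(H,c)`, for the colouring encoded by the relation `r`. -/
def disparity {V : Type*} (H : SimpleGraph V) (r : V → V → Prop) : SimpleGraph V :=
  SimpleGraph.fromRel fun u v => Xor' (H.Adj u v) (majority H r u v)

/-- The generalised disparity graph `D_L(H,c)` for a 0-1 matrix `L` on colours. -/
def gDisparity {V : Type*} {Ω : Type*} (H : SimpleGraph V) (c : V → Ω) (L : Ω → Ω → Bool) :
    SimpleGraph V :=
  SimpleGraph.fromRel fun u v => Xor' (H.Adj u v) (L (c u) (c v) = true)

/-- The vertex set of the connected component of `v` in `G`. -/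
def compSet {V : Type*} (G : SimpleGraph V) (v : V) : Set V := {u | G.Reachable v u}

/-- A colouring is equitable if any two vertices with the same colour have the same number of
neighbours in every colour class. -/
def IsEquitable {V : Type*} {Ω : Type*} (H : SimpleGraph V) (c : V → Ω) : Prop :=
  ∀ u v, c u = c v → ∀ a : Ω,
    Nat.card {x : V // H.Adj u x ∧ c x = a} = Nat.card {x : V // H.Adj v x ∧ c x = a}

/-- Vertex set of the `k`-core of `G`: the union of all vertex sets inducing minimum
degree at least `k`. -/
def kCore {V : Type*} (G : SimpleGraph V) (k : ℕ) : Set V :=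
  ⋃₀ {S : Set V | ∀ v ∈ S, k ≤ Nat.card {u : V // u ∈ S ∧ G.Adj v u}}

/-- `V_{2,3}(G)`: vertices of the 2-core of `G` having degree at least 3 in the 2-core. -/
def V23 {V : Type*} (G : SimpleGraph V) : Set V :=
  {v | v ∈ kCore G 2 ∧ 3 ≤ Nat.card {u : V // u ∈ kCore G 2 ∧ G.Adj v u}}

/-- The graph obtained from `G` by deleting all edges meeting `T`
(so that reachability in `avoidG G T` from `v ∉ T` is reachability in `G - T`). -/
def avoidG {V : Type*} (G : SimpleGraph V) (T : Set V) : SimpleGraph V :=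
  SimpleGraph.fromRel fun u v => G.Adj u v ∧ u ∉ T ∧ v ∉ T

/-- `V_{2,3}^{safe}(G)`: vertices `v ∈ V_{2,3}(G)` such that after deleting any set of at most
two other vertices, the component of `v` still contains at least 3 vertices of `V_{2,3}(G)`. -/
def V23safe {V : Type*} (G : SimpleGraph V) : Set V :=
  {v | v ∈ V23 G ∧ ∀ T : Finset V, T.card ≤ 2 → v ∉ T →
    3 ≤ Nat.card {w : V // w ∈ V23 G ∧ (avoidG G (T : Set V)).Reachable v w}}

open Classical in
/-- `Lmul G i u v w` is the multiplicity of the vertex `w` in the multiset `L^i_G(u,v)`. -/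
noncomputable def Lmul {V : Type*} [Fintype V] (G : SimpleGraph V) : ℕ → V → V → V → ℕ
  | 0, u, _, w => if w = u then 1 else 0
  | (i + 1), u, v, w =>
      (∑ x : V, if G.Adj w x then Lmul G i u v x else 0) -
        (∑ x : V, if G.Adj w x then Lmul G i v u x else 0)

/-- Union over `j < i` of the supports of `L^j_G(u,v)` and `L^j_G(v,u)`. -/
noncomputable def Sbelow {V : Type*} [Fintype V] (G : SimpleGraph V) (u v : V) (i : ℕ) :
    Set V :=
  {w | ∃ j < i, 0 < Lmul G j u v w ∨ 0 < Lmul G j v u w}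

/-- `S^{≤ i}_G({u,v})`. -/
noncomputable def Sle {V : Type*} [Fintype V] (G : SimpleGraph V) (u v : V) (i : ℕ) : Set V :=
  Sbelow G u v (i + 1)

/-- `S^{i}_G({u,v}) = S^{≤ i}_G({u,v}) \ S^{≤ i-1}_G({u,v})`. -/
noncomputable def Sat {V : Type*} [Fintype V] (G : SimpleGraph V) (u v : V) (i : ℕ) : Set V :=
  Sbelow G u v (i + 1) \ Sbelow G u v i

/-- Degree of a vertex (as `Nat.card` of the neighbour set, avoiding decidability issues). -/
noncomputable def ncDegree {V : Type*} (G : SimpleGraph V) (v : V) : ℕ :=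
  Nat.card {u : V // G.Adj v u}

/-- The random refinement of a colouring `c`: each vertex `v` with `f v = true` receives
a brand-new colour unique to itself. -/
def refineColor {V : Type*} {Ω : Type*} (c : V → Ω) (f : V → Bool) : V → Ω ⊕ V :=
  fun v => if f v then Sum.inr v else Sum.inl (c v)

/-- `D(H,c)` (for the colouring encoded by the relation `r`) is `s`-bounded: every
intersection of a colour class with a connected component of `D(H,c)` has at most
`s` elements. -/
def sBounded {V : Type*} (H : SimpleGraph V) (r : V → V → Prop) (s : ℕ) : Prop :=
  ∀ u v : V, Nat.card {w : V // r w u ∧ w ∈ compSet (disparity H r) v} ≤ s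

/-- The type of canonical colours after `t` rounds of colour refinement. -/
def CCol : ℕ → Type
  | 0 => Unit
  | (t + 1) => CCol t × Multiset (CCol t)

open Classical in
/-- The canonical colour of a vertex after `t` rounds of colour refinement. -/
noncomputable def canonColor {V : Type*} [Fintype V] (G : SimpleGraph V) :
    (t : ℕ) → V → CCol t
  | 0, _ => ()
  | (t + 1), v =>
      (canonColor G t v, (Finset.univ.filter fun w => G.Adj v w).val.map (canonColor G t))

/-- The modal probability `M(m,p)` of a `Binomial(m,p)` random variable. -/
noncomputable def modalProb (m : ℕ) (p : ℝ) : ℝ :=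
  (m.choose ⌊(m + 1 : ℝ) * p⌋₊ : ℝ) * p ^ ⌊(m + 1 : ℝ) * p⌋₊ *
    (1 - p) ^ (m - ⌊(m + 1 : ℝ) * p⌋₊)


namespace ColRef
open Finset

/-! ### Finite product Bernoulli expectations -/

section Bernoulli

variable {ι : Type*} [Fintype ι] [DecidableEq ι]

/-- Weight of a single Bernoulli bit. -/
def bitW (q : ℝ) (b : Bool) : ℝ := if b then q else 1 - q

/-- Weight of a configuration of independent Bernoulli bits. -/
def confW (q : ℝ) (f : ι → Bool) : ℝ := ∏ i, bitW q (f i)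

/-- Expectation of `F` over independent Bernoulli bits. -/
noncomputable def expect (q : ℝ) (F : (ι → Bool) → ℝ) : ℝ := ∑ f, confW q f * F f

/-- Replace the bits of `f` in `D` by those of `g`. -/
def mix (D : Finset ι) (f g : ι → Bool) : ι → Bool := fun i => if i ∈ D then g i else f i

omit [Fintype ι] in
@[simp] lemma mix_mem {D : Finset ι} {f g : ι → Bool} {i : ι} (h : i ∈ D) : mix D f g i = g i := by
  simp [mix, h]

omit [Fintype ι] in
@[simp] lemma mix_not_mem {D : Finset ι} {f g : ι → Bool} {i : ι} (h : i ∉ D) :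
    mix D f g i = f i := by
  simp [mix, h]

lemma bitW_nonneg {q : ℝ} (h0 : 0 ≤ q) (h1 : q ≤ 1) (b : Bool) : 0 ≤ bitW q b := by
  unfold bitW; split_ifs <;> linarith

omit [DecidableEq ι] in
lemma confW_nonneg {q : ℝ} (h0 : 0 ≤ q) (h1 : q ≤ 1) (f : ι → Bool) : 0 ≤ confW q f :=
  prod_nonneg fun _ _ => bitW_nonneg h0 h1 _

/-- Expectation of a product of functions of the individual bits. -/
lemma expect_prod (q : ℝ) (h : ι → Bool → ℝ) :
    expect q (fun f => ∏ i, h i (f i)) = ∏ i, (q * h i true + (1 - q) * h i false) := by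
  have := (Finset.prod_univ_sum (fun _ : ι => (univ : Finset Bool))
    (fun i b => bitW q b * h i b)).symm
  rw [Fintype.piFinset_univ] at this
  unfold expect confW
  simp_rw [← prod_mul_distrib]
  rw [this]
  refine prod_congr rfl fun i _ => ?_
  simp [bitW]

lemma sum_confW (q : ℝ) : ∑ f : ι → Bool, confW q f = 1 := by
  have := expect_prod (ι := ι) q (fun _ _ => 1)
  simpa [expect] using this

lemma expect_const (q c : ℝ) : expect q (fun _ : ι → Bool => c) = c := by
  unfold expect
  rw [← sum_mul, sum_confW, one_mul]

lemma expect_mono {q : ℝ} (h0 : 0 ≤ q) (h1 : q ≤ 1) {F G : (ι → Bool) → ℝ} (h : ∀ f, F f ≤ G f) :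
    expect q F ≤ expect q G :=
  sum_le_sum fun f _ => mul_le_mul_of_nonneg_left (h f) (confW_nonneg h0 h1 f)

lemma expect_nonneg {q : ℝ} (h0 : 0 ≤ q) (h1 : q ≤ 1) {F : (ι → Bool) → ℝ} (h : ∀ f, 0 ≤ F f) :
    0 ≤ expect q F :=
  sum_nonneg fun f _ => mul_nonneg (confW_nonneg h0 h1 f) (h f)

lemma expect_mul_left (q c : ℝ) (F : (ι → Bool) → ℝ) :
    expect q (fun f => c * F f) = c * expect q F := by
  unfold expect
  rw [mul_sum]
  exact sum_congr rfl fun _ _ => by ring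

lemma expect_add (q : ℝ) (F G : (ι → Bool) → ℝ) :
    expect q (fun f => F f + G f) = expect q F + expect q G := by
  unfold expect
  rw [← sum_add_distrib]
  exact sum_congr rfl fun _ _ => by ring

lemma expect_eq_zero (q : ℝ) {F : (ι → Bool) → ℝ} (h : ∀ f, F f = 0) : expect q F = 0 :=
  sum_eq_zero fun f _ => by rw [h f, mul_zero]

lemma expect_sum {κ : Type*} (q : ℝ) (s : Finset κ) (F : κ → (ι → Bool) → ℝ) :
    expect q (fun f => ∑ k ∈ s, F k f) = ∑ k ∈ s, expect q (F k) := by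
  unfold expect
  rw [sum_comm]
  exact sum_congr rfl fun _ _ => by rw [mul_sum]

lemma confW_mul_mix (q : ℝ) (D : Finset ι) (f g : ι → Bool) :
    confW q (mix D f g) * confW q (mix D g f) = confW q f * confW q g := by
  unfold confW
  rw [← prod_mul_distrib, ← prod_mul_distrib]
  refine prod_congr rfl fun i _ => ?_
  by_cases h : i ∈ D <;> simp [h, mul_comm]

/-- If the set `D f` does not depend on the bits in `D f`, these bits may be resampled. -/
lemma expect_resample (q : ℝ) (D : (ι → Bool) → Finset ι)
    (hD : ∀ f g, D (mix (D f) f g) = D f) (F : (ι → Bool) → ℝ) :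
    expect q F = expect q (fun f => expect q (fun g => F (mix (D f) f g))) := by
  let φ : (ι → Bool) × (ι → Bool) → (ι → Bool) × (ι → Bool) :=
    fun x => (mix (D x.1) x.1 x.2, mix (D x.1) x.2 x.1)
  have hφ : Function.Involutive φ := by
    rintro ⟨f, g⟩
    simp only [φ, hD]
    ext i
    · by_cases h : i ∈ D f <;> simp [h]
    · by_cases h : i ∈ D f <;> simp [h]
  have e1 : expect q F = ∑ x : (ι → Bool) × (ι → Bool), confW q x.1 * confW q x.2 * F x.1 := by
    rw [Fintype.sum_prod_type]
    unfold expect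
    refine sum_congr rfl fun f _ => ?_
    simp only
    rw [← sum_mul, ← mul_sum, sum_confW, mul_one]
  rw [e1, ← Equiv.sum_comp (hφ.toPerm φ), Fintype.sum_prod_type]
  unfold expect
  refine sum_congr rfl fun f _ => ?_
  rw [mul_sum]
  refine sum_congr rfl fun g _ => ?_
  simp only [Function.Involutive.coe_toPerm, φ]
  rw [confW_mul_mix]; ring

lemma expect_le_of_resample {q : ℝ} (h0 : 0 ≤ q) (h1 : q ≤ 1) (D : (ι → Bool) → Finset ι)
    (hD : ∀ f g, D (mix (D f) f g) = D f) (F G : (ι → Bool) → ℝ)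
    (h : ∀ f, expect q (fun g => F (mix (D f) f g)) ≤ G f) : expect q F ≤ expect q G := by
  rw [expect_resample q D hD F]
  exact expect_mono h0 h1 h

lemma expect_prod_mem (q c : ℝ) (D : Finset ι) :
    expect q (fun f => ∏ i ∈ D, if f i then c else 1) = (1 + (c - 1) * q) ^ #D := by
  have := expect_prod q (fun i b => if i ∈ D then (if b then c else 1) else 1)
  simp only [prod_ite_mem, univ_inter] at this
  rw [this]
  rw [← prod_const, ← prod_subset (subset_univ D)]
  · refine prod_congr rfl fun i hi => ?_
    simp [hi]; ring
  · intro i _ hi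
    simp [hi]

/-- Expectation of a function of the bits at the image of an injective map. -/
lemma expect_comp_injective {κ : Type*} [Fintype κ] [DecidableEq κ] (q : ℝ) (e : κ → ι)
    (he : Function.Injective e) (F : (κ → Bool) → ℝ) :
    expect q (fun f : ι → Bool => F (f ∘ e)) = expect q F := by
  have key : ∀ g : κ → Bool,
      expect q (fun f : ι → Bool => if f ∘ e = g then (1 : ℝ) else 0) = confW q g := by
    intro g
    obtain ⟨h, hh⟩ : ∃ h : ι → Bool → ℝ, ∀ i b, h i b = if ∀ k, e k = i → b = g k then 1 else 0 :=
      ⟨_, fun _ _ => rfl⟩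
    have h1 : ∀ f : ι → Bool, (if f ∘ e = g then (1 : ℝ) else 0) = ∏ i, h i (f i) := by
      intro f
      by_cases hf : f ∘ e = g
      · rw [if_pos hf, prod_eq_one]
        intro i _
        rw [hh]
        refine if_pos ?_
        rintro k rfl
        exact congrFun hf k
      · rw [if_neg hf]
        obtain ⟨k, hk⟩ := Function.ne_iff.1 hf
        refine (prod_eq_zero (mem_univ (e k)) ?_).symm
        rw [hh]
        exact if_neg fun h' => hk (h' k rfl)
    rw [funext h1, expect_prod]
    have h2 : ∏ i : ι, (q * h i true + (1 - q) * h i false)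
        = ∏ i ∈ univ.image e, (q * h i true + (1 - q) * h i false) := by
      refine (prod_subset (subset_univ _) ?_).symm
      intro i _ hi
      have : ∀ k, e k ≠ i := by simpa using hi
      simp [hh, this]
    rw [h2, prod_image he.injOn]
    unfold confW
    refine prod_congr rfl fun k _ => ?_
    have h3 : ∀ b : Bool, (∀ k', e k' = e k → b = g k') ↔ b = g k :=
      fun b => ⟨fun h => h k rfl, fun h k' hk' => he hk' ▸ h⟩
    simp only [hh, h3, bitW]
    cases g k <;> simp
  have : ∀ f : ι → Bool, F (f ∘ e) = ∑ g : κ → Bool, F g * (if f ∘ e = g then (1 : ℝ) else 0) := by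
    intro f; simp
  simp_rw [this]
  rw [expect_sum]
  simp_rw [expect_mul_left, key]
  unfold expect
  exact sum_congr rfl fun _ _ => mul_comm _ _

/-- Expectation of a product of functions of disjoint blocks of bits. -/
lemma expect_prod_blocks {κ : Type*} [Fintype κ] [DecidableEq κ] (q : ℝ)
    (H : ι → (κ → Bool) → ℝ) :
    expect q (fun g : ι × κ → Bool => ∏ i, H i (fun k => g (i, k))) = ∏ i, expect q (H i) := by
  have h := (Finset.prod_univ_sum (fun _ : ι => (univ : Finset (κ → Bool)))
    (fun i g => confW q g * H i g))
  rw [Fintype.piFinset_univ] at h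
  unfold expect
  rw [h, ← Equiv.sum_comp (Equiv.curry ι κ Bool).symm]
  refine sum_congr rfl fun g _ => ?_
  rw [prod_mul_distrib]
  congr 1
  unfold confW
  rw [Fintype.prod_prod_type]
  rfl

/-- Invariance under permutations of the bits. -/
lemma expect_comp_perm (q : ℝ) (σ : Equiv.Perm ι) (F : (ι → Bool) → ℝ) :
    expect q (fun f => F (f ∘ σ)) = expect q F :=
  expect_comp_injective q σ σ.injective F

lemma expect_binomial {r : ℕ} (q : ℝ) (k : ℕ) :
    expect q (fun g : Fin r → Bool => if #{i | g i = true} = k then (1 : ℝ) else 0)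
      = r.choose k * q ^ k * (1 - q) ^ (r - k) := by
  unfold expect
  simp only [mul_ite, mul_one, mul_zero]
  rw [← sum_filter]
  have hw : ∀ g ∈ (univ.filter fun g : Fin r → Bool => #{i | g i = true} = k),
      confW q g = q ^ k * (1 - q) ^ (r - k) := by
    intro g hg
    have hg' : #{i | g i = true} = k := by simpa using hg
    unfold confW bitW
    rw [prod_ite, prod_const, prod_const, hg']
    congr 2
    have := card_filter_add_card_filter_not (s := (univ : Finset (Fin r))) (fun i => g i = true)
    rw [hg', card_univ, Fintype.card_fin] at this
    omega
  rw [sum_congr rfl hw, sum_const, nsmul_eq_mul, ← mul_assoc]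
  congr 2
  norm_cast
  have : (univ.filter fun g : Fin r → Bool => #{i | g i = true} = k).card
      = #(powersetCard k (univ : Finset (Fin r))) := by
    refine card_bij' (fun g _ => univ.filter fun i => g i = true)
      (fun s _ => fun i => decide (i ∈ s)) ?_ ?_ ?_ ?_
    · intro g hg; simpa [mem_powersetCard] using hg
    · intro s hs; simpa [mem_powersetCard] using hs
    · intro g _; ext i; simp
    · intro s _; ext i; simp
  rw [this, card_powersetCard, card_univ, Fintype.card_fin]

end Bernoulli

open scoped Classical

/-! ### Stable colourings and iterated neighbourhood differences -/

section Stable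

variable {V : Type*}

lemma crEquiv_refl {Ω : Type*} (G : SimpleGraph V) (c : V → Ω) (t : ℕ) (x : V) :
    crEquiv G c t x x := by
  induction t with
  | zero => rfl
  | succ t ih => exact ⟨ih, fun _ => rfl⟩

lemma crEquiv_symm {Ω : Type*} (G : SimpleGraph V) (c : V → Ω) (t : ℕ) {x y : V}
    (h : crEquiv G c t x y) : crEquiv G c t y x := by
  induction t with
  | zero => exact Eq.symm h
  | succ t ih => exact ⟨ih h.1, fun w => (h.2 w).symm⟩

lemma crEquiv_trans {Ω : Type*} (G : SimpleGraph V) (c : V → Ω) (t : ℕ) {x y z : V}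
    (h : crEquiv G c t x y) (h' : crEquiv G c t y z) : crEquiv G c t x z := by
  induction t with
  | zero => exact Eq.trans h h'
  | succ t ih => exact ⟨ih h.1 h'.1, fun w => (h.2 w).trans (h'.2 w)⟩

lemma crEquiv_anti {Ω : Type*} (G : SimpleGraph V) (c : V → Ω) {s t : ℕ} (hst : s ≤ t) {x y : V}
    (h : crEquiv G c t x y) : crEquiv G c s x y := by
  induction t, hst using Nat.le_induction with
  | base => exact h
  | succ t _ ih => exact ih h.1

/-- Having the same stable colour, as a setoid. -/
def stableSetoid {Ω : Type*} (G : SimpleGraph V) (c : V → Ω) : Setoid V where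
  r := crStable G c
  iseqv := ⟨fun x t => crEquiv_refl G c t x, fun h t => crEquiv_symm G c t (h t),
    fun h h' t => crEquiv_trans G c t (h t) (h' t)⟩

lemma exists_crEquiv_iff_crStable [Finite V] {Ω : Type*} (G : SimpleGraph V) (c : V → Ω) :
    ∃ t, ∀ x y, crEquiv G c t x y ↔ crStable G c x y := by
  have : ∀ p : V × V, ∃ t, crEquiv G c t p.1 p.2 → crStable G c p.1 p.2 := by
    intro p
    by_cases h : crStable G c p.1 p.2
    · exact ⟨0, fun _ => h⟩
    · obtain ⟨t, ht⟩ := not_forall.1 h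
      exact ⟨t, fun h' => absurd h' ht⟩
  choose τ hτ using this
  obtain ⟨B, hB⟩ := (Set.finite_range τ).bddAbove
  exact ⟨B, fun x y => ⟨fun h => hτ (x, y) (crEquiv_anti G c (hB ⟨_, rfl⟩) h), fun h => h B⟩⟩

lemma crStable_card_eq [Finite V] {Ω : Type*} (G : SimpleGraph V) (c : V → Ω) {u v : V}
    (h : crStable G c u v) (w : V) :
    Nat.card {x : V // G.Adj u x ∧ crStable G c x w} =
      Nat.card {x : V // G.Adj v x ∧ crStable G c x w} := by
  obtain ⟨t, ht⟩ := exists_crEquiv_iff_crStable G c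
  have := (h (t + 1)).2 w
  simpa only [ht] using this

variable [Fintype V]

/-- The number of neighbours of a vertex. -/
noncomputable def dg (G : SimpleGraph V) (w : V) : ℕ := ∑ y, if G.Adj w y then 1 else 0

lemma sum_adj_eq_of_crStable {Ω : Type*} (G : SimpleGraph V) (c : V → Ω) (g : V → ℤ)
    (hg : ∀ x y, crStable G c x y → g x = g y) {u v : V} (h : crStable G c u v) :
    (∑ y, if G.Adj u y then g y else 0) = ∑ y, if G.Adj v y then g y else 0 := by
  have key : ∀ u, (∑ y, if G.Adj u y then g y else 0) = ∑ q : Quotient (stableSetoid G c),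
      ((Nat.card {x : V // G.Adj u x ∧ crStable G c x q.out} : ℕ) : ℤ) * g q.out := by
    intro u
    rw [← Finset.sum_fiberwise (s := univ) (g := fun y => (Quotient.mk (stableSetoid G c) y))]
    refine sum_congr rfl fun q _ => ?_
    have h1 : ∀ y, Quotient.mk (stableSetoid G c) y = q ↔ crStable G c y q.out := by
      intro y
      conv_lhs => rw [← q.out_eq]
      exact Quotient.eq (r := stableSetoid G c)
    rw [Nat.card_eq_fintype_card, Fintype.card_subtype, ← sum_filter, filter_filter]
    rw [sum_congr rfl (g := fun _ => g q.out), sum_const, nsmul_eq_mul]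
    · congr 3
      ext y
      simp only [mem_filter, mem_univ, true_and, h1, and_comm]
    · intro y hy
      simp only [mem_filter, h1] at hy
      exact hg _ _ hy.2.1
  rw [key u, key v]
  refine sum_congr rfl fun q _ => ?_
  rw [crStable_card_eq G c h]

lemma dg_eq_of_crStable {Ω : Type*} (G : SimpleGraph V) (c : V → Ω) {u v : V}
    (h : crStable G c u v) : dg G u = dg G v := by
  have := sum_adj_eq_of_crStable G c (fun _ => 1) (fun _ _ _ => rfl) h
  unfold dg
  exact_mod_cast this

/-- The vector `A^j (e_u - e_v)`, for `A` the adjacency matrix of `G`. -/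
noncomputable def kry (G : SimpleGraph V) (u v : V) : ℕ → V → ℤ
  | 0 => fun w => (if w = u then 1 else 0) - (if w = v then 1 else 0)
  | j + 1 => fun w => ∑ y, if G.Adj w y then kry G u v j y else 0

lemma sum_kry_mul_eq_zero {Ω : Type*} (G : SimpleGraph V) (c : V → Ω) {u v : V}
    (h : crStable G c u v) (j : ℕ) (g : V → ℤ) (hg : ∀ x y, crStable G c x y → g x = g y) :
    ∑ w, kry G u v j w * g w = 0 := by
  induction j generalizing g with
  | zero =>
    simp only [kry, sub_mul, ite_mul, one_mul, zero_mul, sum_sub_distrib, sum_ite_eq', mem_univ,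
      if_true]
    rw [hg u v h, sub_self]
  | succ j ih =>
    have := ih (fun x => ∑ y, if G.Adj x y then g y else 0)
      (fun x y hxy => sum_adj_eq_of_crStable G c g hg hxy)
    rw [← this]
    simp only [kry, sum_mul, mul_sum]
    rw [sum_comm]
    refine sum_congr rfl fun y _ => sum_congr rfl fun w _ => ?_
    simp only [G.adj_comm w y]
    split_ifs <;> simp

lemma sum_kry_mul_dg {G : SimpleGraph V} {u v : V} (h : crStableTrivial G u v) (j : ℕ)
    (φ : ℕ → ℤ) : ∑ w, kry G u v j w * φ (dg G w) = 0 :=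
  sum_kry_mul_eq_zero G _ h j _ fun _ _ hxy => by rw [dg_eq_of_crStable G _ hxy]

end Stable

/-! ### Exploration from a pair of vertices -/

section Explore

variable {n : ℕ} (G₀ : SimpleGraph (Fin n)) (u v : Fin n)

lemma symmDiffG_adj {V : Type*} (G₁ G₂ : SimpleGraph V) (a b : V) :
    (symmDiffG G₁ G₂).Adj a b ↔ Xor (G₁.Adj a b) (G₂.Adj a b) := by
  unfold symmDiffG
  rw [SimpleGraph.fromRel_adj, G₁.adj_comm b a, G₂.adj_comm b a, or_self]
  refine ⟨fun h => h.2, fun h => ⟨?_, h⟩⟩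
  rintro rfl
  rcases h with h | h <;> exact h.1.ne rfl

lemma graphOfFlip_adj (f : Sym2 (Fin n) → Bool) (a b : Fin n) :
    (graphOfFlip f).Adj a b ↔ a ≠ b ∧ f s(a, b) = true := by
  unfold graphOfFlip
  rw [SimpleGraph.fromRel_adj, Sym2.eq_swap (a := b), or_self]

/-- The perturbed graph. -/
abbrev pert (f : Sym2 (Fin n) → Bool) : SimpleGraph (Fin n) := symmDiffG G₀ (graphOfFlip f)

lemma pert_adj (f : Sym2 (Fin n) → Bool) (a b : Fin n) : (pert G₀ f).Adj a b ↔
    (G₀.Adj a b ∧ ¬ (a ≠ b ∧ f s(a, b) = true)) ∨ ((a ≠ b ∧ f s(a, b) = true) ∧ ¬ G₀.Adj a b) := by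
  rw [symmDiffG_adj, graphOfFlip_adj]
  rfl

lemma pert_adj_congr {f f' : Sym2 (Fin n) → Bool} {a b : Fin n} (h : f s(a, b) = f' s(a, b)) :
    (pert G₀ f).Adj a b ↔ (pert G₀ f').Adj a b := by
  rw [symmDiffG_adj, symmDiffG_adj, graphOfFlip_adj, graphOfFlip_adj, h]

/-- The `j`-th exploration vector of the perturbed graph. -/
noncomputable abbrev vec (f : Sym2 (Fin n) → Bool) (j : ℕ) : Fin n → ℤ := kry (pert G₀ f) u v j

/-- Vertices reached by the exploration before step `j`. -/
noncomputable def seen (f : Sym2 (Fin n) → Bool) (j : ℕ) : Finset (Fin n) :=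
  {w | ∃ i < j, vec G₀ u v f i w ≠ 0}

/-- Vertices reached for the first time in step `j`. -/
noncomputable def front (f : Sym2 (Fin n) → Bool) (j : ℕ) : Finset (Fin n) :=
  {w | vec G₀ u v f j w ≠ 0 ∧ w ∉ seen G₀ u v f j}

variable {G₀ u v}

lemma mem_seen {f : Sym2 (Fin n) → Bool} {j : ℕ} {w : Fin n} :
    w ∈ seen G₀ u v f j ↔ ∃ i < j, vec G₀ u v f i w ≠ 0 := by simp [seen]

lemma mem_front {f : Sym2 (Fin n) → Bool} {j : ℕ} {w : Fin n} :
    w ∈ front G₀ u v f j ↔ vec G₀ u v f j w ≠ 0 ∧ w ∉ seen G₀ u v f j := by simp [front]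

lemma seen_succ (f : Sym2 (Fin n) → Bool) (j : ℕ) :
    seen G₀ u v f (j + 1) = seen G₀ u v f j ∪ front G₀ u v f j := by
  ext w
  simp only [mem_union, mem_front, mem_seen]
  constructor
  · rintro ⟨i, hi, hw⟩
    by_cases h : ∃ i < j, vec G₀ u v f i w ≠ 0
    · exact Or.inl h
    · rcases Nat.lt_succ_iff_lt_or_eq.1 hi with h' | rfl
      · exact absurd ⟨i, h', hw⟩ h
      · exact Or.inr ⟨hw, h⟩
  · rintro (⟨i, hi, hw⟩ | ⟨hw, -⟩)
    · exact ⟨i, by omega, hw⟩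
    · exact ⟨j, by omega, hw⟩

lemma seen_zero (f : Sym2 (Fin n) → Bool) : seen G₀ u v f 0 = ∅ := by
  ext w; simp [mem_seen]

lemma seen_mono (f : Sym2 (Fin n) → Bool) {i j : ℕ} (h : i ≤ j) :
    seen G₀ u v f i ⊆ seen G₀ u v f j := by
  intro w hw
  obtain ⟨k, hk, hw⟩ := mem_seen.1 hw
  exact mem_seen.2 ⟨k, by omega, hw⟩

lemma vec_eq_zero_of_not_mem_seen {f : Sym2 (Fin n) → Bool} {i j : ℕ} (h : i < j) {w : Fin n}
    (hw : w ∉ seen G₀ u v f j) : vec G₀ u v f i w = 0 := by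
  by_contra h'
  exact hw (mem_seen.2 ⟨i, h, h'⟩)

/-- The exploration up to step `j` only depends on the pairs touching `seen j`. -/
lemma vec_congr {f f' : Sym2 (Fin n) → Bool} {j : ℕ}
    (h : ∀ a ∈ seen G₀ u v f j, ∀ b, f s(a, b) = f' s(a, b)) {i : ℕ} (hi : i ≤ j) :
    vec G₀ u v f' i = vec G₀ u v f i := by
  induction i with
  | zero => rfl
  | succ i ih =>
    have ih := ih (by omega)
    ext w
    simp only [vec, kry] at ih ⊢
    rw [ih]
    refine sum_congr rfl fun y _ => ?_
    by_cases hy : y ∈ seen G₀ u v f j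
    · have := pert_adj_congr G₀ (h y hy w)
      rw [(pert G₀ f).adj_comm, (pert G₀ f').adj_comm] at this
      simp only [this]
    · have := vec_eq_zero_of_not_mem_seen (show i < j by omega) hy
      simp only [vec] at this
      simp [this]

lemma seen_congr {f f' : Sym2 (Fin n) → Bool} {j : ℕ}
    (h : ∀ a ∈ seen G₀ u v f j, ∀ b, f s(a, b) = f' s(a, b)) {i : ℕ} (hi : i ≤ j + 1) :
    seen G₀ u v f' i = seen G₀ u v f i := by
  ext w
  simp only [mem_seen]
  refine exists_congr fun k => and_congr_right fun hk => ?_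
  rw [vec_congr h (show k ≤ j by omega)]

lemma front_congr {f f' : Sym2 (Fin n) → Bool} {j : ℕ}
    (h : ∀ a ∈ seen G₀ u v f j, ∀ b, f s(a, b) = f' s(a, b)) {i : ℕ} (hi : i ≤ j) :
    front G₀ u v f' i = front G₀ u v f i := by
  ext w
  simp only [mem_front]
  rw [vec_congr h hi, seen_congr h (show i ≤ j + 1 by omega)]

end Explore


/-! ### Parity tests along nonempty small fronts -/

section Parity

variable {n : ℕ} {G₀ : SimpleGraph (Fin n)} {u v : Fin n}

lemma neg_one_pow_dg {V : Type*} [Fintype V] (G : SimpleGraph V) (w : V) :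
    (-1 : ℤ) ^ dg G w = ∏ y, if G.Adj w y then -1 else 1 := by
  unfold dg
  rw [← prod_pow_eq_pow_sum]
  refine prod_congr rfl fun y _ => ?_
  split_ifs <;> simp

lemma dg_congr {f f' : Sym2 (Fin n) → Bool} {w : Fin n} (h : ∀ b, f s(w, b) = f' s(w, b)) :
    dg (pert G₀ f) w = dg (pert G₀ f') w := by
  unfold dg
  exact sum_congr rfl fun y _ => by simp only [pert_adj_congr G₀ (h y)]

variable (G₀ u v) in
/-- The front in step `s` is nonempty, the explored set is small, and the parity test holds. -/
def parityStep (f : Sym2 (Fin n) → Bool) (s : ℕ) : Prop :=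
  (front G₀ u v f s).Nonempty ∧ 2 * #(seen G₀ u v f (s + 1)) ≤ n ∧
    ∑ w, vec G₀ u v f s w * (-1) ^ dg (pert G₀ f) w = 0

lemma parityStep_congr {f f' : Sym2 (Fin n) → Bool} {j : ℕ}
    (h : ∀ a ∈ seen G₀ u v f j, ∀ b, f s(a, b) = f' s(a, b)) {i : ℕ} (hi : i < j) :
    parityStep G₀ u v f' i ↔ parityStep G₀ u v f i := by
  unfold parityStep
  rw [front_congr h hi.le, seen_congr h (show i + 1 ≤ j + 1 by omega)]
  refine and_congr_right fun _ => and_congr_right fun _ => ?_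
  rw [vec_congr h hi.le]
  refine Eq.congr_left (sum_congr rfl fun w _ => ?_)
  by_cases hw : w ∈ seen G₀ u v f j
  · rw [dg_congr (h w hw)]
  · rw [vec_eq_zero_of_not_mem_seen hi hw]; simp

lemma sign_indicator_le {a c τ Y : ℤ} (ha : a ≠ 0) (hτ : τ = 1 ∨ τ = -1) (hY : Y = 1 ∨ Y = -1) :
    (if c + a * (τ * Y) = 0 then (1 : ℝ) else 0) ≤
      (1 + (if c + a * τ = 0 then 1 else -1) * (Y : ℝ)) / 2 := by
  rcases hτ with rfl | rfl <;> rcases hY with rfl | rfl <;> split_ifs <;>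
    first
      | (exfalso; omega)
      | norm_num

lemma prod_sign_eq (κ : Type*) (s : Finset κ) (P : κ → Prop) [DecidablePred P] :
    (∏ y ∈ s, if P y then (-1 : ℤ) else 1) = 1 ∨ (∏ y ∈ s, if P y then (-1 : ℤ) else 1) = -1 := by
  induction s using Finset.induction_on with
  | empty => simp
  | insert a s ha ih =>
    rw [prod_insert ha]
    split_ifs <;> rcases ih with h | h <;> simp [h]

lemma expect_parity {q : ℝ} (h0 : 0 ≤ q) (h1 : q ≤ 1 / 2) (hn : 1 ≤ q * n)
    (f : Sym2 (Fin n) → Bool) {w : Fin n} (S : Finset (Fin n)) (hw : w ∈ S) (hS : 2 * #S ≤ n)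
    (X : Fin n → ℤ) (hX : ∀ y, y ∉ S → X y = 0) (hXw : X w ≠ 0) :
    expect q (fun g => if ∑ y, X y * (-1) ^ dg (pert G₀ (mix ((univ \ S).image fun x => s(w, x))
      f g)) y = 0 then (1 : ℝ) else 0) ≤ (1 + Real.exp (-1)) / 2 := by
  set D := (univ \ S).image fun x => s(w, x) with hD
  have hinj : Function.Injective fun x : Fin n => s(w, x) := fun x y h => Sym2.congr_right.1 h
  have hcard : (#D : ℝ) = n - #S := by
    rw [hD, card_image_of_injective _ hinj, card_sdiff_of_subset (subset_univ _), card_univ,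
      Fintype.card_fin, Nat.cast_sub]
    omega
  set c : ℤ := ∑ y ∈ univ.erase w, X y * (-1) ^ dg (pert G₀ f) y with hc
  set τ : ℤ := (∏ y ∈ S, if (pert G₀ f).Adj w y then -1 else 1) *
    ∏ y ∈ univ \ S, if G₀.Adj w y then -1 else 1 with hτ
  have hτ1 : τ = 1 ∨ τ = -1 := by
    rcases prod_sign_eq _ S (fun y => (pert G₀ f).Adj w y) with h | h <;>
    rcases prod_sign_eq _ (univ \ S) (fun y => G₀.Adj w y) with h' | h' <;> rw [hτ, h, h'] <;> simp
  have key : ∀ g, ∑ y, X y * (-1) ^ dg (pert G₀ (mix D f g)) y =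
      c + X w * (τ * ∏ i ∈ D, if g i then -1 else 1) := by
    intro g
    rw [← add_sum_erase univ _ (mem_univ w), add_comm, hc]
    congr 1
    · refine sum_congr rfl fun y hy => ?_
      by_cases hyS : y ∈ S
      · rw [dg_congr (f' := f)]
        intro b
        refine mix_not_mem fun h => ?_
        simp only [hD, mem_image, Finset.mem_sdiff, mem_univ, true_and, Sym2.eq_iff] at h
        obtain ⟨x, hx, h | h⟩ := h
        · exact (mem_erase.1 hy).1 h.1.symm
        · exact hx (h.2 ▸ hyS)
      · rw [hX y hyS]; simp
    · congr 1
      rw [neg_one_pow_dg, hτ, hD, prod_image hinj.injOn, mul_assoc, ← prod_mul_distrib,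
        ← prod_sdiff (subset_univ S), mul_comm]
      congr 1
      · refine prod_congr rfl fun y hy => ?_
        have : mix D f g s(w, y) = f s(w, y) := by
          refine mix_not_mem fun h => ?_
          simp only [hD, mem_image, Finset.mem_sdiff, mem_univ, true_and] at h
          obtain ⟨x, hx, h⟩ := h
          rw [hinj h] at hx
          exact hx hy
        rw [← hD]
        simp only [pert_adj_congr G₀ this]
      · refine prod_congr rfl fun y hy => ?_
        have hyS : y ∉ S := by simpa using hy
        have hm : mix D f g s(w, y) = g s(w, y) :=
          mix_mem (mem_image.2 ⟨y, hy, rfl⟩)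
        have hwy : w ≠ y := fun h => hyS (h ▸ hw)
        rw [← hD]
        simp only [pert_adj, hm]
        by_cases h : G₀.Adj w y <;> by_cases h' : g s(w, y) = true <;> simp [h, h', hwy]
  simp_rw [key]
  set s : ℝ := if c + X w * τ = 0 then 1 else -1 with hs
  have hs1 : s ≤ 1 ∧ -1 ≤ s := by rw [hs]; split_ifs <;> norm_num
  calc _ ≤ expect q (fun g => 1 / 2 + (s / 2) * ∏ i ∈ D, if g i then (-1 : ℝ) else 1) := by
        refine expect_mono h0 (by linarith) fun g => ?_
        refine (sign_indicator_le hXw hτ1 (prod_sign_eq _ D (fun i => g i = true))).trans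
          (le_of_eq ?_)
        push_cast
        simp only [hs]
        ring
    _ = 1 / 2 + s / 2 * (1 - 2 * q) ^ #D := by
        rw [expect_add, expect_const, expect_mul_left, expect_prod_mem]
        ring
    _ ≤ 1 / 2 + 1 / 2 * Real.exp (-1) := by
        have h2 : (1 - 2 * q) ^ #D ≤ Real.exp (-1) := by
          calc (1 - 2 * q) ^ #D ≤ (Real.exp (-(2 * q))) ^ #D := by
                refine pow_le_pow_left₀ (by linarith) ?_ _
                have := Real.add_one_le_exp (-(2 * q))
                linarith
            _ = Real.exp (-(2 * q * #D)) := by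
                rw [← Real.exp_nat_mul]; congr 1; ring
            _ ≤ Real.exp (-1) := by
                refine Real.exp_le_exp.2 ?_
                have : (2 * #S : ℝ) ≤ n := by exact_mod_cast hS
                rw [hcard]
                nlinarith
        have h3 : 0 ≤ (1 - 2 * q) ^ #D := pow_nonneg (by linarith) _
        have : s / 2 * (1 - 2 * q) ^ #D ≤ 1 / 2 * (1 - 2 * q) ^ #D :=
          mul_le_mul_of_nonneg_right (by linarith [hs1.1]) h3
        linarith
    _ = _ := by ring

/-- An element of `S` if there is one, and otherwise `d`. -/
noncomputable def pick {κ : Type*} (S : Finset κ) (d : κ) : κ :=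
  if h : S.Nonempty then h.choose else d

lemma pick_mem {κ : Type*} {S : Finset κ} (d : κ) (h : S.Nonempty) : pick S d ∈ S := by
  rw [pick, dif_pos h]
  exact h.choose_spec

variable (G₀ u v) in
theorem expect_parityStep_le {q : ℝ} (h0 : 0 ≤ q) (h1 : q ≤ 1 / 2) (hn : 1 ≤ q * n) (t : ℕ) :
    expect q (fun f => if ∀ s < t, parityStep G₀ u v f s then (1 : ℝ) else 0) ≤
      ((1 + Real.exp (-1)) / 2) ^ t := by
  induction t with
  | zero => simp [expect_const]
  | succ t ih =>
    rw [pow_succ, mul_comm]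
    refine le_trans ?_ (mul_le_mul_of_nonneg_left ih (by positivity))
    rw [← expect_mul_left]
    let C : (Sym2 (Fin n) → Bool) → Prop := fun f => (∀ s < t, parityStep G₀ u v f s) ∧
      (front G₀ u v f t).Nonempty ∧ 2 * #(seen G₀ u v f (t + 1)) ≤ n
    let D : (Sym2 (Fin n) → Bool) → Finset (Sym2 (Fin n)) := fun f =>
      if C f then (univ \ seen G₀ u v f (t + 1)).image
        fun x => s(pick (front G₀ u v f t) u, x) else ∅
    have hagree : ∀ f g, ∀ a ∈ seen G₀ u v f t, ∀ b, f s(a, b) = mix (D f) f g s(a, b) := by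
      intro f g a ha b
      refine (mix_not_mem fun h => ?_).symm
      by_cases hC : C f
      · simp only [D, if_pos hC, mem_image, Finset.mem_sdiff, mem_univ, true_and, Sym2.eq_iff] at h
        obtain ⟨x, hx, h | h⟩ := h
        · have := pick_mem u hC.2.1
          rw [h.1] at this
          exact (mem_front.1 this).2 ha
        · exact hx (h.2 ▸ seen_mono f (Nat.le_succ t) ha)
      · simp [D, if_neg hC] at h
    have hpar : ∀ f g, (∀ s < t, parityStep G₀ u v (mix (D f) f g) s) ↔
        ∀ s < t, parityStep G₀ u v f s := fun f g =>
      forall_congr' fun s => forall_congr' fun hs => parityStep_congr (hagree f g) hs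
    have hfront : ∀ f g, front G₀ u v (mix (D f) f g) t = front G₀ u v f t := fun f g =>
      front_congr (hagree f g) le_rfl
    have hseen : ∀ f g, seen G₀ u v (mix (D f) f g) (t + 1) = seen G₀ u v f (t + 1) := fun f g =>
      seen_congr (hagree f g) le_rfl
    have hC : ∀ f g, C (mix (D f) f g) ↔ C f := fun f g => by
      simp only [C, hpar, hfront, hseen]
    refine expect_le_of_resample h0 (by linarith) D ?_ _ _ fun f => ?_
    · intro f g
      by_cases h : C f
      · have h' := (hC f g).2 h
        have e1 : D (mix (D f) f g) = (univ \ seen G₀ u v (mix (D f) f g) (t + 1)).image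
          fun x => s(pick (front G₀ u v (mix (D f) f g) t) u, x) := if_pos h'
        have e2 : D f = (univ \ seen G₀ u v f (t + 1)).image
          fun x => s(pick (front G₀ u v f t) u, x) := if_pos h
        rw [e1, hseen, hfront, e2]
      · have e1 : D (mix (D f) f g) = ∅ := if_neg (mt (hC f g).1 h)
        have e2 : D f = ∅ := if_neg h
        rw [e1, e2]
    · by_cases h : C f
      · have e2 : D f = (univ \ seen G₀ u v f (t + 1)).image
          fun x => s(pick (front G₀ u v f t) u, x) := if_pos h
        rw [if_pos h.1, mul_one]
        have hw := pick_mem u h.2.1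
        refine le_trans (expect_mono h0 (by linarith) fun g => ?_)
          (expect_parity (G₀ := G₀) h0 h1 hn f (w := pick (front G₀ u v f t) u)
            (seen G₀ u v f (t + 1))
            (by rw [seen_succ]; exact mem_union_right _ hw) h.2.2 (vec G₀ u v f t)
            (fun y hy => vec_eq_zero_of_not_mem_seen (Nat.lt_succ_self t) hy) (mem_front.1 hw).1)
        rw [← e2]
        by_cases hp : ∀ s < t + 1, parityStep G₀ u v (mix (D f) f g) s
        · rw [if_pos hp, if_pos]
          rw [← vec_congr (hagree f g) le_rfl]
          exact (hp t (Nat.lt_succ_self t)).2.2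
        · rw [if_neg hp]
          split_ifs <;> norm_num
      · refine le_trans (le_of_eq ?_) (mul_nonneg (by positivity) (by split_ifs <;> norm_num))
        refine expect_eq_zero _ fun g => ?_
        rw [if_neg]
        intro hp
        refine h ((hC f g).1 ⟨fun s hs => hp s (by omega), (hp t (Nat.lt_succ_self t)).1,
          (hp t (Nat.lt_succ_self t)).2.1⟩)

end Parity


/-! ### Surprising edges in the row-by-row exploration -/

section Surprise

variable {n : ℕ} (G₀ : SimpleGraph (Fin n)) (u v : Fin n)

/-- Vertices whose rows were revealed before row `i` of step `j`. -/
noncomputable def proc (f : Sym2 (Fin n) → Bool) (j i : ℕ) : Finset (Fin n) :=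
  seen G₀ u v f j ∪ {z ∈ front G₀ u v f j | z.val < i}

/-- Vertices at which an edge from the row of `y` in step `j` would be a surprise. -/
noncomputable def danger (f : Sym2 (Fin n) → Bool) (j : ℕ) (y : Fin n) : Finset (Fin n) :=
  {w | w ∉ proc G₀ u v f j y ∧ w ≠ y ∧ (w ∈ seen G₀ u v f (j + 1) ∨
    (∑ z, if G₀.Adj w z then vec G₀ u v f j z else 0) ≠ 0 ∨
    ∃ z ∈ proc G₀ u v f j y, f s(z, w) = true)}

/-- The surprising edges found before row `i` of step `j`. -/
noncomputable def surp (f : Sym2 (Fin n) → Bool) (j i : ℕ) : Finset (Fin n × Fin n) :=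
  {x | ∃ k, x.1 ∈ front G₀ u v f k ∧ (k < j ∨ (k = j ∧ x.1.val < i)) ∧
    x.2 ∈ danger G₀ u v f k x.1 ∧ f s(x.1, x.2) = true}

/-- All sets of dangerous vertices before row `i` of step `j` have size at most `L`. -/
def dangerLE (L : ℕ) (f : Sym2 (Fin n) → Bool) (j i : ℕ) : Prop :=
  ∀ k, ∀ y ∈ front G₀ u v f k, (k < j ∨ (k = j ∧ y.val < i)) → #(danger G₀ u v f k y) ≤ L

variable {G₀ u v}

lemma proc_zero (f : Sym2 (Fin n) → Bool) (j : ℕ) : proc G₀ u v f j 0 = seen G₀ u v f j := by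
  simp [proc]

lemma proc_last (f : Sym2 (Fin n) → Bool) (j : ℕ) :
    proc G₀ u v f j n = seen G₀ u v f (j + 1) := by
  rw [proc, seen_succ, filter_true_of_mem fun z _ => z.2]

lemma seen_subset_proc (f : Sym2 (Fin n) → Bool) (j i : ℕ) :
    seen G₀ u v f j ⊆ proc G₀ u v f j i := subset_union_left

lemma proc_subset_seen (f : Sym2 (Fin n) → Bool) (j i : ℕ) :
    proc G₀ u v f j i ⊆ seen G₀ u v f (j + 1) := by
  rw [proc, seen_succ]
  exact union_subset_union_right (filter_subset _ _)

lemma proc_mono (f : Sym2 (Fin n) → Bool) {k j : ℕ} {y : Fin n} {i : ℕ}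
    (h : k < j ∨ (k = j ∧ y.val < i)) : proc G₀ u v f k y ⊆ proc G₀ u v f j i := by
  rcases h with h | ⟨rfl, h⟩
  · exact (proc_subset_seen f k y).trans ((seen_mono f h).trans (seen_subset_proc f j i))
  · refine union_subset_union_right fun z hz => ?_
    simp only [mem_filter] at hz ⊢
    exact ⟨hz.1, by omega⟩

lemma mem_proc_of_front {f : Sym2 (Fin n) → Bool} {k j i : ℕ} {y : Fin n}
    (hy : y ∈ front G₀ u v f k) (h : k < j ∨ (k = j ∧ y.val < i)) : y ∈ proc G₀ u v f j i := by
  rcases h with h | ⟨rfl, h⟩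
  · refine seen_subset_proc f j i (seen_mono f h ?_)
    rw [seen_succ]
    exact mem_union_right _ hy
  · exact mem_union_right _ (mem_filter.2 ⟨hy, h⟩)

lemma exists_front_of_mem_seen {f : Sym2 (Fin n) → Bool} {j : ℕ} {y : Fin n}
    (h : y ∈ seen G₀ u v f j) : ∃ k < j, y ∈ front G₀ u v f k := by
  induction j with
  | zero => simp [seen_zero] at h
  | succ j ih =>
    rw [seen_succ, mem_union] at h
    rcases h with h | h
    · obtain ⟨k, hk, h⟩ := ih h
      exact ⟨k, by omega, h⟩
    · exact ⟨j, by omega, h⟩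

lemma not_mem_proc_self {f : Sym2 (Fin n) → Bool} {k i : ℕ} {y : Fin n}
    (hy : y ∈ front G₀ u v f k) (hi : i ≤ y.val) : y ∉ proc G₀ u v f k i := by
  simp only [proc, mem_union, mem_filter, not_or, not_and, not_lt]
  exact ⟨(mem_front.1 hy).2, fun _ => hi⟩

lemma proc_congr {f f' : Sym2 (Fin n) → Bool} {j : ℕ}
    (h : ∀ a ∈ seen G₀ u v f j, ∀ b, f s(a, b) = f' s(a, b)) {k : ℕ} (hk : k ≤ j) (i : ℕ) :
    proc G₀ u v f' k i = proc G₀ u v f k i := by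
  rw [proc, proc, front_congr h hk, seen_congr h (show k ≤ j + 1 by omega)]

lemma danger_congr {f f' : Sym2 (Fin n) → Bool} {j i : ℕ}
    (h : ∀ a ∈ proc G₀ u v f j i, ∀ b, f s(a, b) = f' s(a, b)) {k : ℕ} {y : Fin n}
    (hk : k < j ∨ (k = j ∧ y.val ≤ i)) : danger G₀ u v f' k y = danger G₀ u v f k y := by
  have h1 : ∀ a ∈ seen G₀ u v f j, ∀ b, f s(a, b) = f' s(a, b) := fun a ha =>
    h a (seen_subset_proc f j i ha)
  have h2 : proc G₀ u v f k y ⊆ proc G₀ u v f j i := by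
    rcases hk with hk | ⟨rfl, hk⟩
    · exact proc_mono f (Or.inl hk)
    · refine union_subset_union_right fun z hz => ?_
      simp only [mem_filter] at hz ⊢
      exact ⟨hz.1, by omega⟩
  have hkj : k ≤ j := by omega
  ext w
  simp only [danger, mem_filter, mem_univ, true_and]
  rw [proc_congr h1 hkj, seen_congr h1 (show k + 1 ≤ j + 1 by omega), vec_congr h1 hkj]
  refine and_congr_right fun _ => and_congr_right fun _ => or_congr_right (or_congr_right ?_)
  refine exists_congr fun z => and_congr_right fun hz => ?_
  rw [h z (h2 hz)]

lemma front_congr' {f f' : Sym2 (Fin n) → Bool} {j i : ℕ}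
    (h : ∀ a ∈ proc G₀ u v f j i, ∀ b, f s(a, b) = f' s(a, b)) {k : ℕ} (hk : k ≤ j) :
    front G₀ u v f' k = front G₀ u v f k :=
  front_congr (fun a ha => h a (seen_subset_proc f j i ha)) hk

lemma surp_congr {f f' : Sym2 (Fin n) → Bool} {j i : ℕ}
    (h : ∀ a ∈ proc G₀ u v f j i, ∀ b, f s(a, b) = f' s(a, b)) :
    surp G₀ u v f' j i = surp G₀ u v f j i := by
  ext x
  simp only [surp, mem_filter, mem_univ, true_and]
  refine exists_congr fun k => ?_
  by_cases hk : k < j ∨ (k = j ∧ x.1.val < i)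
  · rw [front_congr' h (by omega), danger_congr h (by omega)]
    refine and_congr_right fun hx => ?_
    rw [h _ (mem_proc_of_front hx hk)]
  · tauto

lemma dangerLE_congr {L : ℕ} {f f' : Sym2 (Fin n) → Bool} {j i : ℕ}
    (h : ∀ a ∈ proc G₀ u v f j i, ∀ b, f s(a, b) = f' s(a, b)) :
    dangerLE G₀ u v L f' j i ↔ dangerLE G₀ u v L f j i := by
  refine forall_congr' fun k => ?_
  by_cases hkj : k ≤ j
  · rw [front_congr' h hkj]
    refine forall_congr' fun y => forall_congr' fun hy => forall_congr' fun hk => ?_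
    rw [danger_congr h (by omega)]
  · constructor <;> intro _ y _ hk <;> omega

variable (G₀ u v) in
/-- An exponential supermartingale for the number of surprises. -/
noncomputable def surpPot (l a : ℝ) (L : ℕ) (f : Sym2 (Fin n) → Bool) (j i : ℕ) : ℝ :=
  if dangerLE G₀ u v L f j i then l ^ #(surp G₀ u v f j i) * a ^ #(proc G₀ u v f j i) else 0

lemma surpPot_nonneg {l a : ℝ} (hl : 0 ≤ l) (ha : 0 ≤ a) (L : ℕ) (f : Sym2 (Fin n) → Bool)
    (j i : ℕ) : 0 ≤ surpPot G₀ u v l a L f j i := by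
  unfold surpPot
  split_ifs
  · positivity
  · exact le_rfl

variable (G₀ u v) in
lemma expect_surpPot_succ {q l a : ℝ} (h0 : 0 ≤ q) (h1 : q ≤ 1) (hl : 1 ≤ l) (ha : 0 ≤ a) {L : ℕ}
    (haL : (1 + (l - 1) * q) ^ L * a ≤ 1) (j : ℕ) {i : ℕ} (hi : i < n) :
    expect q (fun f => surpPot G₀ u v l a L f j (i + 1)) ≤
      expect q (fun f => surpPot G₀ u v l a L f j i) := by
  set y : Fin n := ⟨i, hi⟩ with hy
  let D : (Sym2 (Fin n) → Bool) → Finset (Sym2 (Fin n)) := fun f =>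
    if y ∈ front G₀ u v f j then (danger G₀ u v f j y).image fun w => s(y, w) else ∅
  have hagree : ∀ f g, ∀ b ∈ proc G₀ u v f j i, ∀ c, f s(b, c) = mix (D f) f g s(b, c) := by
    intro f g b hb c
    refine (mix_not_mem fun h => ?_).symm
    by_cases hC : y ∈ front G₀ u v f j
    · simp only [D, if_pos hC, mem_image, Sym2.eq_iff] at h
      obtain ⟨x, hx, h | h⟩ := h
      · rw [← h.1] at hb
        exact not_mem_proc_self hC le_rfl hb
      · rw [← h.2] at hb
        exact (mem_filter.1 hx).2.1 hb
    · simp [D, if_neg hC] at h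
  have hfront : ∀ f g, front G₀ u v (mix (D f) f g) j = front G₀ u v f j := fun f g =>
    front_congr' (hagree f g) le_rfl
  have hdan : ∀ f g, danger G₀ u v (mix (D f) f g) j y = danger G₀ u v f j y := fun f g =>
    danger_congr (hagree f g) (Or.inr ⟨rfl, le_rfl⟩)
  have hproc : ∀ f g i', proc G₀ u v (mix (D f) f g) j i' = proc G₀ u v f j i' := fun f g i' =>
    proc_congr (fun a ha => hagree f g a (seen_subset_proc f j i ha)) le_rfl i'
  have hlt : ∀ (k : ℕ) (z : Fin n), (k < j ∨ k = j ∧ z.val < i + 1) ↔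
      (k < j ∨ k = j ∧ z.val < i) ∨ (k = j ∧ z = y) := by
    intro k z
    rw [Fin.ext_iff, hy]
    simp only
    omega
  refine expect_le_of_resample h0 h1 D ?_ _ _ fun f => ?_
  · intro f g
    have e1 : D (mix (D f) f g) = if y ∈ front G₀ u v (mix (D f) f g) j then
      (danger G₀ u v (mix (D f) f g) j y).image fun w => s(y, w) else ∅ := rfl
    rw [e1, hfront, hdan]
  · by_cases hC : y ∈ front G₀ u v f j
    · by_cases hL : dangerLE G₀ u v L f j i ∧ #(danger G₀ u v f j y) ≤ L
      · rw [surpPot, if_pos hL.1]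
        have hDf : D f = (danger G₀ u v f j y).image fun w => s(y, w) := if_pos hC
        have hinj : Function.Injective fun x : Fin n => s(y, x) :=
          fun x y h => Sym2.congr_right.1 h
        have hcard : #(D f) = #(danger G₀ u v f j y) := by
          rw [hDf, card_image_of_injective _ hinj]
        have hp : #(proc G₀ u v f j (i + 1)) = #(proc G₀ u v f j i) + 1 := by
          have : proc G₀ u v f j (i + 1) = insert y (proc G₀ u v f j i) := by
            ext z
            have : z.val < i + 1 ↔ z.val < i ∨ z = y := by
              rw [Fin.ext_iff, hy]
              simp only
              omega
            simp only [proc, mem_union, mem_filter, mem_insert, this]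
            constructor
            · tauto
            · rintro (rfl | h | h)
              · exact Or.inr ⟨hC, Or.inr rfl⟩
              · exact Or.inl h
              · exact Or.inr ⟨h.1, Or.inl h.2⟩
          rw [this, card_insert_of_notMem (not_mem_proc_self hC le_rfl)]
        calc _ ≤ expect q (fun g => (l ^ #(surp G₀ u v f j i) * a ^ (#(proc G₀ u v f j i) + 1)) *
              ∏ e ∈ D f, if g e then l else 1) := by
              refine expect_mono h0 h1 fun g => ?_
              have hpr : (∏ e ∈ D f, if g e then l else 1) = l ^ #{e ∈ D f | g e = true} := by
                rw [prod_ite]; simp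
              rw [surpPot]
              split_ifs with hd
              · have hs : #(surp G₀ u v (mix (D f) f g) j (i + 1)) ≤
                    #(surp G₀ u v f j i) + #{e ∈ D f | g e = true} := by
                  have : surp G₀ u v (mix (D f) f g) j (i + 1) ⊆ surp G₀ u v f j i ∪
                      ({w ∈ danger G₀ u v f j y | g s(y, w) = true}.image fun w => (y, w)) := by
                    intro x hx
                    simp only [surp, mem_filter, mem_univ, true_and, hlt] at hx
                    obtain ⟨k, hk1, hk2 | ⟨rfl, hk2⟩, hk3⟩ := hx
                    · refine mem_union_left _ ?_
                      rw [← surp_congr (hagree f g)]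
                      simp only [surp, mem_filter, mem_univ, true_and]
                      exact ⟨k, hk1, hk2, hk3⟩
                    · rw [hk2, hdan] at hk3
                      refine mem_union_right _ (mem_image.2 ⟨x.2, mem_filter.2 ⟨hk3.1, ?_⟩, ?_⟩)
                      · rw [← hk3.2, mix_mem]
                        rw [hDf]
                        exact mem_image.2 ⟨x.2, hk3.1, rfl⟩
                      · rw [← hk2]
                  refine (card_le_card this).trans ((card_union_le _ _).trans ?_)
                  refine Nat.add_le_add_left (card_image_le.trans ?_) _
                  rw [hDf, filter_image, card_image_of_injective _ hinj]
                rw [hproc, hp, hpr]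
                calc _ ≤ l ^ (#(surp G₀ u v f j i) + #{e ∈ D f | g e = true}) *
                      a ^ (#(proc G₀ u v f j i) + 1) :=
                      mul_le_mul_of_nonneg_right (pow_le_pow_right₀ hl hs) (by positivity)
                  _ = _ := by rw [pow_add]; ring
              · rw [hpr]; positivity
          _ = (l ^ #(surp G₀ u v f j i) * a ^ #(proc G₀ u v f j i)) *
                ((1 + (l - 1) * q) ^ #(danger G₀ u v f j y) * a) := by
              rw [expect_mul_left, expect_prod_mem, hcard]
              ring
          _ ≤ (l ^ #(surp G₀ u v f j i) * a ^ #(proc G₀ u v f j i)) * 1 := by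
              refine mul_le_mul_of_nonneg_left (le_trans ?_ haL) (by positivity)
              refine mul_le_mul_of_nonneg_right (pow_le_pow_right₀ ?_ hL.2) ha
              nlinarith
          _ = _ := mul_one _
      · rw [expect_eq_zero]
        · exact surpPot_nonneg (by linarith) ha _ _ _ _
        · intro g
          rw [surpPot, if_neg]
          intro hd
          refine hL ⟨(dangerLE_congr (hagree f g)).1 fun k z hz hk =>
            hd k z hz ((hlt k z).2 (Or.inl hk)), ?_⟩
          rw [← hdan f g]
          exact hd j y (by rwa [hfront]) ((hlt j y).2 (Or.inr ⟨rfl, rfl⟩))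
    · have hDf : D f = ∅ := if_neg hC
      have hm : ∀ g, mix (D f) f g = f := fun g => by ext e; simp [mix, hDf]
      simp only [hm, expect_const]
      have hlt' : ∀ (k : ℕ) (z : Fin n), z ∈ front G₀ u v f k → ((k < j ∨ k = j ∧ z.val < i + 1) ↔
          (k < j ∨ k = j ∧ z.val < i)) := by
        intro k z hz
        rw [hlt]
        refine or_iff_left ?_
        rintro ⟨rfl, rfl⟩
        exact hC hz
      have e1 : surp G₀ u v f j (i + 1) = surp G₀ u v f j i := by
        ext x
        simp only [surp, mem_filter, mem_univ, true_and]
        exact exists_congr fun k => and_congr_right fun hk => by rw [hlt' k _ hk]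
      have e2 : proc G₀ u v f j (i + 1) = proc G₀ u v f j i := by
        unfold proc
        congr 1
        refine filter_congr fun z hz => ?_
        have := hlt' j z hz
        simpa using this
      have e3 : dangerLE G₀ u v L f j (i + 1) ↔ dangerLE G₀ u v L f j i :=
        forall_congr' fun k => forall_congr' fun z => forall_congr' fun hz => by rw [hlt' k z hz]
      simp only [surpPot, e1, e2, e3, le_refl]

variable (G₀ u v) in
lemma expect_surpPot_le {q l a : ℝ} (h0 : 0 ≤ q) (h1 : q ≤ 1) (hl : 1 ≤ l) (ha : 0 ≤ a) {L : ℕ}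
    (haL : (1 + (l - 1) * q) ^ L * a ≤ 1) (j : ℕ) :
    expect q (fun f => surpPot G₀ u v l a L f j 0) ≤ 1 := by
  induction j with
  | zero =>
    refine (expect_mono h0 h1 (G := fun _ => 1) fun f => ?_).trans (expect_const _ _).le
    have e1 : surp G₀ u v f 0 0 = ∅ := by
      ext x; simp [surp]
    rw [surpPot, e1, proc_zero, seen_zero]
    split_ifs <;> simp
  | succ j ih =>
    have key : ∀ i ≤ n, expect q (fun f => surpPot G₀ u v l a L f j i) ≤ 1 := by
      intro i hi
      induction i with
      | zero => exact ih
      | succ i ih' =>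
        exact (expect_surpPot_succ G₀ u v h0 h1 hl ha haL j hi).trans (ih' (by omega))
    refine le_trans (le_of_eq ?_) (key n le_rfl)
    congr 1
    ext f
    have hlt : ∀ (k : ℕ) (z : Fin n), (k < j + 1 ∨ k = j + 1 ∧ z.val < 0) ↔
        (k < j ∨ k = j ∧ z.val < n) := by
      intro k z
      have := z.2
      omega
    have e1 : surp G₀ u v f (j + 1) 0 = surp G₀ u v f j n := by
      unfold surp
      simp only [hlt]
    have e3 : dangerLE G₀ u v L f (j + 1) 0 ↔ dangerLE G₀ u v L f j n := by
      unfold dangerLE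
      simp only [hlt]
    rw [surpPot, surpPot, e1, proc_zero, proc_last]
    simp only [e3]

variable (G₀ u v) in
/-- Three surprises are unlikely while everything stays small. -/
theorem expect_three_surprises {q l : ℝ} (h0 : 0 ≤ q) (h1 : q ≤ 1) (hl : 1 ≤ l) (L K j : ℕ) :
    expect q (fun f => if dangerLE G₀ u v L f j 0 ∧ #(seen G₀ u v f j) ≤ K ∧
      3 ≤ #(surp G₀ u v f j 0) then (1 : ℝ) else 0) ≤ Real.exp (l * q * L * K) / l ^ 3 := by
  set a : ℝ := Real.exp (-(l * q * L)) with ha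
  have ha0 : 0 < a := Real.exp_pos _
  have ha1 : a ≤ 1 := Real.exp_le_one_iff.2 (by
    have : 0 ≤ l * q * L := by positivity
    linarith)
  have haL : (1 + (l - 1) * q) ^ L * a ≤ 1 := by
    have : (1 + (l - 1) * q) ^ L ≤ Real.exp (l * q * L) := by
      calc (1 + (l - 1) * q) ^ L ≤ Real.exp (l * q) ^ L := by
            refine pow_le_pow_left₀ (by nlinarith) ?_ _
            have := Real.add_one_le_exp (l * q)
            linarith
        _ = _ := by rw [← Real.exp_nat_mul]; congr 1; ring
    calc _ ≤ Real.exp (l * q * L) * a := mul_le_mul_of_nonneg_right this ha0.le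
      _ = 1 := by rw [ha, ← Real.exp_add]; simp
  have h := expect_surpPot_le G₀ u v h0 h1 hl ha0.le haL j
  have hl0 : 0 < l := by linarith
  have : expect q (fun f => l ^ 3 * a ^ K * (if dangerLE G₀ u v L f j 0 ∧
      #(seen G₀ u v f j) ≤ K ∧ 3 ≤ #(surp G₀ u v f j 0) then (1 : ℝ) else 0)) ≤ 1 := by
    refine (expect_mono h0 h1 fun f => ?_).trans h
    split_ifs with hc
    · rw [surpPot, if_pos hc.1, mul_one, proc_zero]
      exact mul_le_mul (pow_le_pow_right₀ hl hc.2.2) (pow_le_pow_of_le_one ha0.le ha1 hc.2.1)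
        (by positivity) (by positivity)
    · rw [mul_zero]
      exact surpPot_nonneg hl0.le ha0.le _ _ _ _
  rw [expect_mul_left] at this
  have e : Real.exp (l * q * L * K) = (a ^ K)⁻¹ := by
    rw [ha, ← Real.exp_nat_mul, ← Real.exp_neg]
    congr 1; ring
  rw [e, div_eq_mul_inv, ← mul_inv, inv_eq_one_div, le_div_iff₀ (by positivity)]
  linarith

end Surprise


/-! ### Explorations that get stuck with few surprises -/

section Core

variable {V : Type*} [Fintype V]

/-- A closed exploration from `u` and `v` with vertex set `T`, surprising edges `S` and
tree edges `par`. -/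
structure ClosedExploration (H : SimpleGraph V) (T : Finset V) (S : Finset (V × V))
    (par : V → V → Prop) (u v : V) : Prop where
  left_mem : u ∈ T
  right_mem : v ∈ T
  cover : ∀ a ∈ T, ∀ b, H.Adj a b → par a b ∨ par b a ∨ (a, b) ∈ S ∨ (b, a) ∈ S
  unique : ∀ y y' w, par y w → par y' w → y = y'
  left_root : ∀ y, ¬ par y u
  right_root : ∀ y, ¬ par y v
  boundary : ∀ w, w ∉ T → ∀ a ∈ T, H.Adj a w → ∃ y, (y, w) ∈ S
  surp_mem : ∀ x ∈ S, x.1 ∈ T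
  surp_ne : ∀ x ∈ S, x.1 ≠ x.2

/-- The neighbours of `a` in the 2-core. -/
noncomputable def coreNbrs (H : SimpleGraph V) (a : V) : Finset V :=
  {b | b ∈ kCore H 2 ∧ H.Adj a b}

lemma card_coreNbrs (H : SimpleGraph V) (a : V) :
    Nat.card {b : V // b ∈ kCore H 2 ∧ H.Adj a b} = #(coreNbrs H a) := by
  rw [Nat.card_eq_fintype_card, Fintype.card_subtype, coreNbrs]

lemma two_le_card_coreNbrs {H : SimpleGraph V} {a : V} (ha : a ∈ kCore H 2) :
    2 ≤ #(coreNbrs H a) := by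
  obtain ⟨S, hS, haS⟩ := ha
  refine (hS a haS).trans ?_
  rw [Nat.card_eq_fintype_card, Fintype.card_subtype, coreNbrs]
  refine card_le_card fun b hb => ?_
  simp only [mem_filter, mem_univ, true_and] at hb ⊢
  exact ⟨⟨S, hS, hb.1⟩, hb.2⟩

lemma two_mul_card_add_le (H : SimpleGraph V) (C : Finset V) (hC : ∀ a ∈ C, a ∈ kCore H 2)
    (X : Finset V) (hX : ∀ a ∈ X, a ∈ C ∧ a ∈ V23 H) :
    2 * #C + #X ≤ ∑ a ∈ C, #(coreNbrs H a) := by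
  have hXC : X ⊆ C := fun a ha => (hX a ha).1
  have : 2 * #C + #X = ∑ a ∈ C, (2 + if a ∈ X then 1 else 0) := by
    rw [sum_add_distrib, sum_const, smul_eq_mul, mul_comm, sum_ite_mem, inter_eq_right.2 hXC]
    simp
  rw [this]
  refine sum_le_sum fun a ha => ?_
  split_ifs with h
  · rw [← card_coreNbrs]
    exact (hX a h).2.2
  · exact two_le_card_coreNbrs (hC a ha)

lemma ClosedExploration.sum_card_coreNbrs_le {H : SimpleGraph V} {T : Finset V}
    {S : Finset (V × V)} {par : V → V → Prop} {u v : V} (h : ClosedExploration H T S par u v)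
    (C B R : Finset V) (hCT : C ⊆ T) (hB : ∀ a ∈ C, ∀ b ∈ coreNbrs H a, b ∈ B)
    (hR : ∀ r ∈ R, ∀ y, ¬ par y r) :
    ∑ a ∈ C, #(coreNbrs H a) ≤ #(C \ R) + #(B \ R) +
      #{x : V × V | (x.1 ∈ C ∧ x.2 ∈ coreNbrs H x.1) ∧ (x ∈ S ∨ x.swap ∈ S)} := by
  have e1 : ∑ a ∈ C, #(coreNbrs H a) = #{x : V × V | x.1 ∈ C ∧ x.2 ∈ coreNbrs H x.1} := by
    rw [card_filter, Fintype.sum_prod_type, ← sum_filter_add_sum_filter_not univ (fun a => a ∈ C)]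
    rw [filter_mem_eq_inter, univ_inter, sum_eq_zero (s := filter (fun a => a ∉ C) univ), add_zero]
    · refine sum_congr rfl fun a ha => ?_
      simp [ha]
    · intro a ha
      simp only [mem_filter] at ha
      simp [ha.2]
  rw [e1]
  have hsub : ({x : V × V | x.1 ∈ C ∧ x.2 ∈ coreNbrs H x.1} : Finset (V × V)) ⊆
      (univ.filter (fun x : V × V => x.1 ∈ C ∧ par x.2 x.1) ∪
        univ.filter (fun x : V × V => x.2 ∈ B ∧ par x.1 x.2)) ∪
      univ.filter (fun x : V × V => (x.1 ∈ C ∧ x.2 ∈ coreNbrs H x.1) ∧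
        (x ∈ S ∨ x.swap ∈ S)) := by
    rintro ⟨a, b⟩ hx
    simp only [mem_filter, mem_univ, true_and, mem_union, Prod.swap] at hx ⊢
    have hadj : H.Adj a b := (mem_filter.1 hx.2).2.2
    have hb := hB a hx.1 b hx.2
    rcases h.cover a (hCT hx.1) b hadj with h | h | h | h
    · exact Or.inl (Or.inr ⟨hb, h⟩)
    · exact Or.inl (Or.inl ⟨hx.1, h⟩)
    · exact Or.inr ⟨hx, Or.inl h⟩
    · exact Or.inr ⟨hx, Or.inr h⟩
  refine (card_le_card hsub).trans ((card_union_le _ _).trans (Nat.add_le_add_right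
    ((card_union_le _ _).trans (Nat.add_le_add ?_ ?_)) _))
  · refine card_le_card_of_injOn Prod.fst ?_ ?_
    · intro x hx
      simp only [mem_univ, true_and, coe_filter, Set.mem_ofPred_eq] at hx
      simp only [coe_sdiff, Set.mem_sdiff, mem_coe]
      exact ⟨hx.1, fun hr => hR _ hr _ hx.2⟩
    · rintro ⟨a, b⟩ hx ⟨a', b'⟩ hx' heq
      simp only [coe_filter, mem_univ, true_and, Set.mem_ofPred_eq] at hx hx' heq
      subst heq
      rw [h.unique _ _ _ hx.2 hx'.2]
  · refine card_le_card_of_injOn Prod.snd ?_ ?_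
    · intro x hx
      simp only [mem_univ, true_and, coe_filter, Set.mem_ofPred_eq] at hx
      simp only [coe_sdiff, Set.mem_sdiff, mem_coe]
      exact ⟨hx.1, fun hr => hR _ hr _ hx.2⟩
    · rintro ⟨a, b⟩ hx ⟨a', b'⟩ hx' heq
      simp only [coe_filter, mem_univ, true_and, Set.mem_ofPred_eq] at hx hx' heq
      subst heq
      rw [h.unique _ _ _ hx.2 hx'.2]

/-- A closed exploration with at most two surprises does not start in `V23safe`. -/
theorem ClosedExploration.not_mem_V23safe {H : SimpleGraph V} {T : Finset V}
    {S : Finset (V × V)} {par : V → V → Prop} {u v : V} (h : ClosedExploration H T S par u v)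
    (hS : #S ≤ 2) : u ∉ V23safe H := by
  intro hu
  set T' : Finset V := S.image fun x => if x.2 = u then x.1 else x.2 with hT'
  have hT'c : #T' ≤ #S := card_image_le
  have huT' : u ∉ T' := by
    intro hmem
    obtain ⟨x, hx, hxu⟩ := mem_image.1 hmem
    split_ifs at hxu with h1
    · exact h.surp_ne x hx (hxu.trans h1.symm)
    · exact h1 hxu
  have hsafe := hu.2 T' (hT'c.trans hS) huT'
  rw [Nat.card_eq_fintype_card, Fintype.card_subtype] at hsafe
  set X : Finset V := {w | w ∈ V23 H ∧ (avoidG H (T' : Set V)).Reachable u w} with hX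
  set C : Finset V := {w | w ∈ kCore H 2 ∧ (avoidG H (T' : Set V)).Reachable u w} with hC
  have hadj : ∀ a b, (avoidG H (T' : Set V)).Adj a b ↔ H.Adj a b ∧ a ∉ T' ∧ b ∉ T' := by
    intro a b
    unfold avoidG
    simp only [SimpleGraph.fromRel_adj, mem_coe]
    constructor
    · rintro ⟨-, h | h⟩
      · exact h
      · exact ⟨h.1.symm, h.2.2, h.2.1⟩
    · intro h
      exact ⟨h.1.ne, Or.inl h⟩
  have hreach : ∀ a, (avoidG H (T' : Set V)).Reachable u a → a ∈ T ∧ a ∉ T' := by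
    rintro a ⟨w⟩
    have : ∀ x y (w : (avoidG H (T' : Set V)).Walk x y), x ∈ T ∧ x ∉ T' → y ∈ T ∧ y ∉ T' := by
      intro x y w
      induction w with
      | nil => exact id
      | cons hxy _ ih =>
        intro hx
        refine ih ?_
        have hxy := (hadj _ _).1 hxy
        refine ⟨?_, hxy.2.2⟩
        by_contra hy
        obtain ⟨z, hz⟩ := h.boundary _ hy _ hx.1 hxy.1
        refine hxy.2.2 (mem_image.2 ⟨_, hz, ?_⟩)
        rw [if_neg]
        rintro rfl
        exact hy h.left_mem
    exact this _ _ w ⟨h.left_mem, huT'⟩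
  have huC : u ∈ C := by
    simp only [hC, mem_filter, mem_univ, true_and]
    exact ⟨hu.1.1, SimpleGraph.Reachable.refl _⟩
  have hCT : C ⊆ T := fun a ha => (hreach a (mem_filter.1 ha).2.2).1
  have hCT' : Disjoint C T' := disjoint_left.2 fun a ha => (hreach a (mem_filter.1 ha).2.2).2
  have hlow := two_mul_card_add_le H C (fun a ha => (mem_filter.1 ha).2.1) X fun a ha => by
    have ha := (mem_filter.1 ha).2
    exact ⟨mem_filter.2 ⟨mem_univ _, ha.1.1, ha.2⟩, ha.1⟩
  have hup := h.sum_card_coreNbrs_le C (C ∪ T') {u} hCT (by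
    intro a ha b hb
    have ha := (mem_filter.1 ha).2
    have hb := (mem_filter.1 hb).2
    by_cases hbT : b ∈ T'
    · exact mem_union_right _ hbT
    · refine mem_union_left _ (mem_filter.2 ⟨mem_univ _, hb.1, ha.2.trans ?_⟩)
      exact SimpleGraph.Adj.reachable ((hadj a b).2 ⟨hb.2, (hreach a ha.2).2, hbT⟩)) (by
    intro r hr
    rw [mem_singleton.1 hr]
    exact h.left_root)
  have hE : #{x : V × V | (x.1 ∈ C ∧ x.2 ∈ coreNbrs H x.1) ∧ (x ∈ S ∨ x.swap ∈ S)} ≤ #S := by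
    refine card_le_card_of_injOn (fun x => if x ∈ S then x else x.swap) ?_ ?_
    · intro x hx
      simp only [coe_filter, mem_univ, true_and, Set.mem_ofPred_eq] at hx
      simp only [mem_coe]
      split_ifs with hxS
      · exact hxS
      · exact hx.2.resolve_left hxS
    · have hno : ∀ x : V × V, x ∈ S → x.1 ∈ C → x.2 ∈ C → False := by
        intro x hx h1 h2
        have : (if x.2 = u then x.1 else x.2) ∈ T' := mem_image.2 ⟨x, hx, rfl⟩
        split_ifs at this
        · exact disjoint_left.1 hCT' h1 this
        · exact disjoint_left.1 hCT' h2 this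
      intro x hx y hy hxy
      simp only [coe_filter, mem_univ, true_and, Set.mem_ofPred_eq] at hx hy
      simp only at hxy
      split_ifs at hxy with h1 h2 h2
      · exact hxy
      · exact (hno x h1 hx.1.1 (by rw [hxy]; exact hy.1.1)).elim
      · exact (hno y h2 hy.1.1 (by rw [← hxy]; exact hx.1.1)).elim
      · exact Prod.swap_injective hxy
  have e1 : #(C \ {u}) = #C - 1 := by
    rw [sdiff_singleton_eq_erase, card_erase_of_mem huC]
  have e2 : #((C ∪ T') \ {u}) = #(C ∪ T') - 1 := by
    rw [sdiff_singleton_eq_erase, card_erase_of_mem (mem_union_left _ huC)]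
  have e3 := card_union_le C T'
  have e4 : 0 < #C := card_pos.2 ⟨u, huC⟩
  omega

/-- A closed exploration with at most two surprises does not start from two vertices of
`V23`. -/
theorem ClosedExploration.not_both_mem_V23 {H : SimpleGraph V} {T : Finset V}
    {S : Finset (V × V)} {par : V → V → Prop} {u v : V} (h : ClosedExploration H T S par u v)
    (hS : #S ≤ 2) (huv : u ≠ v) : ¬ (u ∈ V23 H ∧ v ∈ V23 H) := by
  rintro ⟨hu, hv⟩
  set C : Finset V := {w | w ∈ kCore H 2 ∧ w ∈ T} with hC
  set O : Finset V := {w | w ∉ T ∧ ∃ a ∈ T, H.Adj a w} with hO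
  have huC : u ∈ C := mem_filter.2 ⟨mem_univ _, hu.1, h.left_mem⟩
  have hvC : v ∈ C := mem_filter.2 ⟨mem_univ _, hv.1, h.right_mem⟩
  have hCT : C ⊆ T := fun a ha => (mem_filter.1 ha).2.2
  have hlow := two_mul_card_add_le H C (fun a ha => (mem_filter.1 ha).2.1) {u, v} fun a ha => by
    rcases mem_insert.1 ha with rfl | ha
    · exact ⟨huC, hu⟩
    · rw [mem_singleton.1 ha]
      exact ⟨hvC, hv⟩
  have hup := h.sum_card_coreNbrs_le C (C ∪ O) {u, v} hCT (by
    intro a ha b hb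
    have hb := (mem_filter.1 hb).2
    by_cases hbT : b ∈ T
    · exact mem_union_left _ (mem_filter.2 ⟨mem_univ _, hb.1, hbT⟩)
    · exact mem_union_right _ (mem_filter.2 ⟨mem_univ _, hbT, a, hCT ha, hb.2⟩)) (by
    intro r hr
    rcases mem_insert.1 hr with rfl | hr
    · exact h.left_root
    · rw [mem_singleton.1 hr]
      exact h.right_root)
  set Sin : Finset (V × V) := S.filter fun x => x.2 ∈ T with hSin
  set Sout : Finset (V × V) := S.filter fun x => x.2 ∉ T with hSout
  have hsplit : #Sin + #Sout = #S := card_filter_add_card_filter_not _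
  have hOc : #O ≤ #Sout := by
    refine (card_le_card (t := Sout.image Prod.snd) fun w hw => ?_).trans card_image_le
    obtain ⟨hw1, a, ha, haw⟩ := (mem_filter.1 hw).2
    obtain ⟨y, hy⟩ := h.boundary w hw1 a ha haw
    exact mem_image.2 ⟨(y, w), mem_filter.2 ⟨hy, hw1⟩, rfl⟩
  have hE : #{x : V × V | (x.1 ∈ C ∧ x.2 ∈ coreNbrs H x.1) ∧ (x ∈ S ∨ x.swap ∈ S)} ≤
      #Sin + #Sin + #Sout := by
    refine (card_le_card (t := (Sin ∪ Sin.image Prod.swap) ∪ Sout) ?_).trans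
      ((card_union_le _ _).trans (Nat.add_le_add_right ((card_union_le _ _).trans
        (Nat.add_le_add_left card_image_le _)) _))
    intro x hx
    have hx := (mem_filter.1 hx).2
    simp only [mem_union, mem_image, hSin, hSout, mem_filter]
    rcases hx.2 with h1 | h1
    · by_cases h2 : x.2 ∈ T
      · exact Or.inl (Or.inl ⟨h1, h2⟩)
      · exact Or.inr ⟨h1, h2⟩
    · exact Or.inl (Or.inr ⟨x.swap, ⟨h1, hCT hx.1.1⟩, Prod.swap_swap x⟩)
  have hRC : ({u, v} : Finset V) ⊆ C := by
    intro a ha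
    rcases mem_insert.1 ha with rfl | ha
    · exact huC
    · rw [mem_singleton.1 ha]; exact hvC
  have e0 : #({u, v} : Finset V) = 2 := card_pair huv
  have e1 : #(C \ {u, v}) = #C - 2 := by
    rw [card_sdiff_of_subset hRC, e0]
  have e2 : #((C ∪ O) \ {u, v}) = #(C ∪ O) - 2 := by
    rw [card_sdiff_of_subset (hRC.trans subset_union_left), e0]
  have e3 := card_union_le C O
  have e4 := card_le_card hRC
  omega

end Core

section Stuck

variable {n : ℕ} {G₀ : SimpleGraph (Fin n)} {u v : Fin n}

lemma mem_front_zero_left (huv : u ≠ v) (f : Sym2 (Fin n) → Bool) : u ∈ front G₀ u v f 0 := by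
  simp [mem_front, seen_zero, kry, huv]

lemma mem_front_zero_right (huv : u ≠ v) (f : Sym2 (Fin n) → Bool) : v ∈ front G₀ u v f 0 := by
  simp [mem_front, seen_zero, kry, huv.symm]

variable (G₀ u v) in
/-- The tree edges of the exploration up to step `t`. -/
def treeEdge (f : Sym2 (Fin n) → Bool) (t : ℕ) (y w : Fin n) : Prop :=
  ∃ k < t, y ∈ front G₀ u v f k ∧ w ≠ y ∧ f s(y, w) = true ∧ w ∉ proc G₀ u v f k y ∧
    w ∉ danger G₀ u v f k y

/-- If some front is empty, then the exploration is closed. -/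
theorem closedExploration_of_front_eq_empty (huv : u ≠ v) {f : Sym2 (Fin n) → Bool} {t : ℕ}
    (ht : front G₀ u v f t = ∅) : ClosedExploration (graphOfFlip f) (seen G₀ u v f t)
      (surp G₀ u v f t 0) (treeEdge G₀ u v f t) u v := by
  have hu0 := mem_front_zero_left (G₀ := G₀) huv f
  have hv0 := mem_front_zero_right (G₀ := G₀) huv f
  have ht0 : 1 ≤ t := by
    by_contra h
    have : t = 0 := by omega
    subst this
    rw [ht] at hu0
    simp at hu0
  have hseen1 : seen G₀ u v f 1 = front G₀ u v f 0 := by rw [seen_succ, seen_zero, empty_union]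
  have hsub : ∀ k, 1 ≤ k → front G₀ u v f 0 ⊆ seen G₀ u v f k := fun k hk => by
    rw [← hseen1]; exact seen_mono f hk
  have hsurp : ∀ x, x ∈ surp G₀ u v f t 0 ↔ ∃ k < t, x.1 ∈ front G₀ u v f k ∧
      x.2 ∈ danger G₀ u v f k x.1 ∧ f s(x.1, x.2) = true := by
    intro x
    simp only [surp, mem_filter, mem_univ, true_and, Nat.not_lt_zero, and_false, or_false]
    exact exists_congr fun k => by tauto
  have hroot : ∀ r ∈ front G₀ u v f 0, ∀ y, ¬ treeEdge G₀ u v f t y r := by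
    rintro r hr y ⟨k, hk, hy, hne, hf, hp, hd⟩
    refine hd (mem_filter.2 ⟨mem_univ _, hp, hne, Or.inl ?_⟩)
    exact hsub _ (by omega) hr
  have hlater : ∀ a k, k < t → a ∈ front G₀ u v f k → ∀ b, (graphOfFlip f).Adj a b →
      b ∉ proc G₀ u v f k a → treeEdge G₀ u v f t a b ∨ (a, b) ∈ surp G₀ u v f t 0 := by
    intro a k hk ha b hab hb
    have hab := (graphOfFlip_adj f a b).1 hab
    by_cases hd : b ∈ danger G₀ u v f k a
    · exact Or.inr ((hsurp _).2 ⟨k, hk, ha, hd, hab.2⟩)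
    · exact Or.inl ⟨k, hk, ha, hab.1.symm, hab.2, hb, hd⟩
  have huniq : ∀ y y' w, treeEdge G₀ u v f t y w → treeEdge G₀ u v f t y' w → y = y' := by
    have aux : ∀ y y' w k k', y ∈ front G₀ u v f k → y' ∈ front G₀ u v f k' → f s(y, w) = true →
        w ≠ y' → w ∉ proc G₀ u v f k' y' → w ∉ danger G₀ u v f k' y' →
        (k < k' ∨ (k = k' ∧ y.val < y'.val)) → False := by
      intro y y' w k k' hy hy' hf hne hp hd hlt
      exact hd (mem_filter.2 ⟨mem_univ _, hp, hne, Or.inr (Or.inr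
        ⟨y, mem_proc_of_front hy hlt, hf⟩)⟩)
    rintro y y' w ⟨k, hk, hy, hne, hf, hp, hd⟩ ⟨k', hk', hy', hne', hf', hp', hd'⟩
    by_contra hyy
    have hval : y.val ≠ y'.val := fun h => hyy (Fin.ext h)
    by_cases h1 : k < k' ∨ (k = k' ∧ y.val < y'.val)
    · exact aux y y' w k k' hy hy' hf hne' hp' hd' h1
    · exact aux y' y w k' k hy' hy hf' hne hp hd (by omega)
  refine ⟨hsub t ht0 hu0, hsub t ht0 hv0, ?_, huniq, hroot u hu0, hroot v hv0, ?_, ?_, ?_⟩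
  · intro a ha b hab
    obtain ⟨k, hk, hak⟩ := exists_front_of_mem_seen ha
    by_cases hb : b ∈ proc G₀ u v f k a
    · obtain ⟨l, hl, hbl⟩ : ∃ l, (l < k ∨ (l = k ∧ b.val < a.val)) ∧ b ∈ front G₀ u v f l := by
        rcases mem_union.1 hb with hb | hb
        · obtain ⟨l, hl, hbl⟩ := exists_front_of_mem_seen hb
          exact ⟨l, Or.inl hl, hbl⟩
        · exact ⟨k, Or.inr ⟨rfl, (mem_filter.1 hb).2⟩, (mem_filter.1 hb).1⟩
      have ha' : a ∉ proc G₀ u v f l b := fun h =>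
        not_mem_proc_self hak le_rfl (proc_mono f hl h)
      rcases hlater b l (by omega) hbl a hab.symm ha' with h | h
      · exact Or.inr (Or.inl h)
      · exact Or.inr (Or.inr (Or.inr h))
    · rcases hlater a k hk hak b hab hb with h | h
      · exact Or.inl h
      · exact Or.inr (Or.inr (Or.inl h))
  · intro w hw a ha haw
    by_contra hno
    push Not at hno
    have hout : ∀ k ≤ t, w ∉ seen G₀ u v f k := fun k hk h => hw (seen_mono f hk h)
    have htree : ∀ b ∈ seen G₀ u v f t, (graphOfFlip f).Adj b w → treeEdge G₀ u v f t b w := by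
      intro b hb hbw
      obtain ⟨k, hk, hbk⟩ := exists_front_of_mem_seen hb
      refine (hlater b k hk hbk w hbw fun h => ?_).resolve_right (hno b)
      exact hout (k + 1) (by omega) (proc_subset_seen f k b h)
    have hpa := htree a ha haw
    obtain ⟨k, hk, hak, hne, hf, hp, hd⟩ := hpa
    have hzero : (∑ z, if G₀.Adj w z then vec G₀ u v f k z else 0) = 0 := by
      by_contra h0
      exact hd (mem_filter.2 ⟨mem_univ _, hp, hne, Or.inr (Or.inl h0)⟩)
    have hvk : vec G₀ u v f k a ≠ 0 := (mem_front.1 hak).1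
    have hseen : ∀ z, vec G₀ u v f k z ≠ 0 → z ∈ seen G₀ u v f t := fun z hz =>
      mem_seen.2 ⟨k, hk, hz⟩
    have hvec : vec G₀ u v f (k + 1) w ≠ 0 := by
      have hdiff : vec G₀ u v f (k + 1) w - (∑ z, if G₀.Adj w z then vec G₀ u v f k z else 0) =
          (if (pert G₀ f).Adj w a then vec G₀ u v f k a else 0) -
            (if G₀.Adj w a then vec G₀ u v f k a else 0) := by
        simp only [vec, kry]
        rw [← sum_sub_distrib]
        refine sum_eq_single_of_mem a (mem_univ _) fun z _ hza => ?_
        by_cases hz : vec G₀ u v f k z = 0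
        · simp only [vec] at hz
          simp [hz]
        · have hnadj : ¬ (graphOfFlip f).Adj w z := by
            intro hwz
            exact hza (huniq _ _ _ (htree z (hseen z hz) hwz.symm) (htree a ha haw))
          rw [graphOfFlip_adj] at hnadj
          have : (pert G₀ f).Adj w z ↔ G₀.Adj w z := by
            rw [pert_adj]; tauto
          simp only [this, sub_self]
      rw [hzero, sub_zero] at hdiff
      rw [hdiff]
      have hwa := (graphOfFlip_adj f w a).1 haw.symm
      have : (pert G₀ f).Adj w a ↔ ¬ G₀.Adj w a := by
        rw [pert_adj]; tauto
      by_cases hG : G₀.Adj w a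
      · rw [if_neg (by tauto), if_pos hG, zero_sub]
        exact neg_ne_zero.2 hvk
      · rw [if_pos (by tauto), if_neg hG, sub_zero]
        exact hvk
    have : w ∈ seen G₀ u v f (t + 1) := mem_seen.2 ⟨k + 1, by omega, hvec⟩
    rw [seen_succ, ht, union_empty] at this
    exact hw this
  · intro x hx
    obtain ⟨k, hk, hxk, -⟩ := (hsurp x).1 hx
    exact seen_mono f hk (by rw [seen_succ]; exact mem_union_right _ hxk)
  · intro x hx heq
    obtain ⟨k, hk, hxk, hd, -⟩ := (hsurp x).1 hx
    exact (mem_filter.1 hd).2.2.1 heq.symm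

/-- When some front is empty, the sets of dangerous vertices are small. -/
theorem dangerLE_of_front_eq_empty {f : Sym2 (Fin n) → Bool} {t Δ K : ℕ}
    (ht : front G₀ u v f t = ∅) (hK : #(seen G₀ u v f t) ≤ K)
    (hΔ : ∀ a, #{b | f s(a, b) = true} ≤ Δ) :
    dangerLE G₀ u v (K * (Δ + 1)) f t 0 := by
  intro k y hy hk
  have hk : k < t := by omega
  have hsub : danger G₀ u v f k y ⊆ seen G₀ u v f t ∪
      (seen G₀ u v f t).biUnion fun a => {b | f s(a, b) = true} := by
    intro w hw
    by_contra hno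
    simp only [mem_union, mem_biUnion, mem_filter, mem_univ, true_and, not_or, not_exists,
      not_and] at hno
    rcases (mem_filter.1 hw).2.2.2 with h | h | ⟨z, hz, h⟩
    · exact hno.1 (seen_mono f hk h)
    · have hvec : vec G₀ u v f (k + 1) w ≠ 0 := by
        refine ne_of_eq_of_ne (sum_congr rfl fun z _ => ?_) h
        by_cases hz : vec G₀ u v f k z = 0
        · simp only [vec] at hz
          simp [hz]
        · have := hno.2 z (mem_seen.2 ⟨k, hk, hz⟩)
          rw [Sym2.eq_swap] at this
          have : (pert G₀ f).Adj w z ↔ G₀.Adj w z := by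
            rw [pert_adj]; tauto
          simp only [this]
      have : w ∈ seen G₀ u v f (t + 1) := mem_seen.2 ⟨k + 1, by omega, hvec⟩
      rw [seen_succ, ht, union_empty] at this
      exact hno.1 this
    · exact hno.2 z (seen_mono f hk (proc_subset_seen f k y hz)) h
  refine (card_le_card hsub).trans ((card_union_le _ _).trans ?_)
  have := card_biUnion_le_card_mul (seen G₀ u v f t) (fun a => {b | f s(a, b) = true}) Δ
    fun a _ => hΔ a
  nlinarith

end Stuck


/-! ### A Littlewood–Offord bound -/

section LittlewoodOfford

/-- The largest point probability of a fair binomial distribution. -/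
noncomputable def cbRatio (N : ℕ) : ℝ := N.choose (N / 2) / 2 ^ N

lemma cbRatio_nonneg (N : ℕ) : 0 ≤ cbRatio N := by unfold cbRatio; positivity

lemma cbRatio_succ_le (N : ℕ) : cbRatio (N + 1) ≤ cbRatio N := by
  unfold cbRatio
  rw [div_le_div_iff₀ (by positivity) (by positivity)]
  have h : (N + 1).choose ((N + 1) / 2) ≤ 2 * N.choose (N / 2) := by
    rcases Nat.eq_zero_or_pos N with rfl | hN
    · simp
    · obtain ⟨k, hk⟩ : ∃ k, (N + 1) / 2 = k + 1 := ⟨(N + 1) / 2 - 1, by omega⟩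
      rw [hk, Nat.choose_succ_succ']
      have h1 := Nat.choose_le_middle k N
      have h2 := Nat.choose_le_middle (k + 1) N
      omega
  have h' : ((N + 1).choose ((N + 1) / 2) : ℝ) ≤ 2 * N.choose (N / 2) := by exact_mod_cast h
  calc _ ≤ (2 * N.choose (N / 2) : ℝ) * 2 ^ N := mul_le_mul_of_nonneg_right h' (by positivity)
    _ = _ := by ring

lemma cbRatio_antitone : Antitone cbRatio := antitone_nat_of_succ_le cbRatio_succ_le

lemma centralBinom_sq_le (k : ℕ) : k.centralBinom ^ 2 * (2 * k + 1) ≤ 16 ^ k := by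
  induction k with
  | zero => simp
  | succ k ih =>
    have h := Nat.succ_mul_centralBinom_succ k
    have h2 : (k + 1) ^ 2 * ((k + 1).centralBinom ^ 2 * (2 * (k + 1) + 1)) ≤
        (k + 1) ^ 2 * 16 ^ (k + 1) := by
      calc (k + 1) ^ 2 * ((k + 1).centralBinom ^ 2 * (2 * (k + 1) + 1))
          = ((k + 1) * (k + 1).centralBinom) ^ 2 * (2 * k + 3) := by ring
        _ = (k.centralBinom ^ 2 * (2 * k + 1)) * (4 * ((2 * k + 1) * (2 * k + 3))) := by
            rw [h]; ring
        _ ≤ 16 ^ k * (4 * (4 * (k + 1) ^ 2)) := by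
            refine Nat.mul_le_mul ih (Nat.mul_le_mul_left _ ?_)
            nlinarith
        _ = _ := by ring
    exact Nat.le_of_mul_le_mul_left h2 (by positivity)

lemma cbRatio_two_mul_sq_le (k : ℕ) : cbRatio (2 * k) ^ 2 ≤ 1 / (2 * k + 1) := by
  unfold cbRatio
  rw [Nat.mul_div_cancel_left k two_pos, div_pow, div_le_div_iff₀ (by positivity) (by positivity),
    one_mul]
  have h := centralBinom_sq_le k
  rw [Nat.centralBinom] at h
  have h' : ((2 * k).choose k : ℝ) ^ 2 * (2 * k + 1) ≤ 16 ^ k := by exact_mod_cast h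
  refine h'.trans (le_of_eq ?_)
  rw [← pow_mul, show 2 * k * 2 = 4 * k by ring, pow_mul]
  norm_num

lemma confW_half {α : Type*} [Fintype α] (B : α → Bool) :
    confW (1 / 2) B = 1 / 2 ^ Fintype.card α := by
  unfold confW bitW
  rw [prod_congr rfl (g := fun _ => (1 / 2 : ℝ)) fun a _ => by split_ifs <;> norm_num,
    prod_const, card_univ, div_pow, one_pow]

/-- A function of fair bits that is strictly monotone in each bit takes a given value with
probability at most the largest binomial probability. -/
lemma expect_half_eq_zero_le {α : Type*} [Fintype α] [DecidableEq α] (Z : (α → Bool) → ℤ)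
    (sgn : α → Bool)
    (hZ : ∀ B a, Z (Function.update B a (!sgn a)) < Z (Function.update B a (sgn a))) :
    expect (1 / 2) (fun B => if Z B = 0 then (1 : ℝ) else 0) ≤ cbRatio (Fintype.card α) := by
  let b : Finset α → α → Bool := fun S a => if a ∈ S then sgn a else !sgn a
  have hins : ∀ S a, a ∉ S → Z (b S) < Z (b (insert a S)) := by
    intro S a ha
    have e1 : b S = Function.update (b S) a (!sgn a) := by
      ext x
      by_cases hx : x = a
      · subst hx; simp [b, ha]
      · simp [hx]
    have e2 : b (insert a S) = Function.update (b S) a (sgn a) := by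
      ext x
      by_cases hx : x = a
      · subst hx; simp [b]
      · simp [b, hx]
    rw [e2]
    conv_lhs => rw [e1]
    exact hZ _ _
  have hmono : ∀ S T : Finset α, Z (b S) ≤ Z (b (S ∪ T)) := by
    intro S T
    induction T using Finset.induction_on with
    | empty => simp
    | insert a T _ ih =>
      rw [union_insert]
      by_cases h : a ∈ S ∪ T
      · rwa [insert_eq_of_mem h]
      · exact ih.trans (hins _ _ h).le
  have hb : ∀ B : α → Bool, b {a | B a = sgn a} = B := by
    intro B
    ext a
    by_cases h : B a = sgn a
    · simp [b, h]
    · simp only [b, mem_filter, mem_univ, true_and, h, if_false]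
      cases hB : B a <;> cases hs : sgn a <;> simp_all
  have hanti : IsAntichain (· ⊆ ·)
      ((univ.filter fun S : Finset α => Z (b S) = 0 : Finset (Finset α)) : Set (Finset α)) := by
    intro S hS T hT hne hST
    simp only [coe_filter, mem_univ, true_and, Set.mem_ofPred_eq] at hS hT
    obtain ⟨a, haT, haS⟩ := exists_of_ssubset (hST.ssubset_of_ne hne)
    have h1 := hins S a haS
    have h2 := hmono (insert a S) T
    rw [union_eq_right.2 (insert_subset haT hST)] at h2
    omega
  have hsp := hanti.sperner
  unfold expect
  simp only [confW_half, mul_ite, mul_one, mul_zero]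
  rw [← sum_filter, sum_const, nsmul_eq_mul, mul_one_div, cbRatio]
  refine div_le_div_of_nonneg_right ?_ (by positivity)
  refine le_trans ?_ (Nat.cast_le.2 hsp)
  refine Nat.cast_le.2 (card_le_card_of_injOn (fun B => univ.filter fun a => B a = sgn a) ?_ ?_)
  · intro B hB
    simp only [coe_filter, mem_univ, true_and, Set.mem_ofPred_eq] at hB ⊢
    rwa [hb]
  · intro B _ B' _ h
    rw [← hb B, ← hb B']
    simp only at h
    rw [h]

lemma mix_eq_extend {ι κ : Type*} [Fintype κ] [DecidableEq ι] (e : κ → ι)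
    (he : Function.Injective e) (f g : ι → Bool) :
    mix (univ.image e) f g = Function.extend e (g ∘ e) f := by
  ext i
  by_cases h : ∃ k, e k = i
  · obtain ⟨k, rfl⟩ := h
    rw [he.extend_apply, mix_mem (mem_image.2 ⟨k, mem_univ _, rfl⟩)]
    rfl
  · rw [Function.extend_apply' _ _ _ h, mix_not_mem]
    simpa using h

lemma expect_mix_image {ι κ : Type*} [Fintype ι] [DecidableEq ι] [Fintype κ] [DecidableEq κ]
    (q : ℝ) (e : κ → ι) (he : Function.Injective e) (f : ι → Bool) (F : (ι → Bool) → ℝ) :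
    expect q (fun g => F (mix (univ.image e) f g)) =
      expect q fun h : κ → Bool => F (Function.extend e h f) := by
  rw [← expect_comp_injective q e he]
  simp only [mix_eq_extend e he]

lemma extend_update {ι κ : Type*} [DecidableEq ι] [DecidableEq κ] (e : κ → ι)
    (he : Function.Injective e) (h : κ → Bool) (B : ι → Bool) (a : κ) (c : Bool) :
    Function.extend e (Function.update h a c) B =
      Function.update (Function.extend e h B) (e a) c := by
  ext x
  by_cases hx : ∃ b, e b = x
  · obtain ⟨b, rfl⟩ := hx
    rw [he.extend_apply]
    by_cases hb : b = a
    · subst hb; simp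
    · rw [Function.update_of_ne hb, Function.update_of_ne (he.ne hb), he.extend_apply]
  · rw [Function.extend_apply' _ _ _ hx, Function.update_of_ne, Function.extend_apply' _ _ _ hx]
    rintro rfl
    exact hx ⟨a, rfl⟩

lemma apply_extend_eq {ι κ γ : Type*} [Fintype κ] [DecidableEq ι] [DecidableEq κ] (e : κ → ι)
    (P : (ι → Bool) → γ) (hP : ∀ B a c, P (Function.update B (e a) c) = P B)
    (h : κ → Bool) (B : ι → Bool) : P (Function.extend e h B) = P B := by
  have key : ∀ S : Finset κ,
      P (fun x => if ∃ a ∈ S, e a = x then Function.extend e h B x else B x) = P B := by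
    intro S
    induction S using Finset.induction_on with
    | empty => simp
    | insert a S _ ih =>
      conv_rhs => rw [← ih, ← hP _ a (Function.extend e h B (e a))]
      congr 1
      ext x
      by_cases hx : x = e a
      · subst hx
        rw [Function.update_self, if_pos ⟨a, mem_insert_self a S, rfl⟩]
      · rw [Function.update_of_ne hx]
        have : (∃ b ∈ insert a S, e b = x) ↔ ∃ b ∈ S, e b = x := by
          simp only [mem_insert]
          constructor
          · rintro ⟨b, hb | hb, rfl⟩
            · exact absurd (congrArg e hb) hx
            · exact ⟨b, hb, rfl⟩
          · rintro ⟨b, hb, rfl⟩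
            exact ⟨b, Or.inr hb, rfl⟩
        simp only [this]
  rw [← key univ]
  congr 1
  ext x
  by_cases hx : ∃ a, e a = x
  · rw [if_pos]; simpa using hx
  · rw [if_neg (by simpa using hx), Function.extend_apply' _ _ _ hx]

/-- Several statistics, each strictly monotone in many fair bits not affecting the others,
vanish simultaneously with small probability. -/
theorem expect_half_forall_eq_zero_le {m N N' : ℕ} (Z : (Fin m × Fin N → Bool) → Fin m → ℤ)
    (good : Finset (Fin m × Fin N)) (sgn : Fin m × Fin N → Bool)
    (hN : ∀ j, N' ≤ #{a | (j, a) ∈ good})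
    (hZ : ∀ B, ∀ x ∈ good,
      Z (Function.update B x (!sgn x)) x.1 < Z (Function.update B x (sgn x)) x.1)
    (hZ' : ∀ B, ∀ x ∈ good, ∀ c, ∀ j ≠ x.1, Z (Function.update B x c) j = Z B j) :
    expect (1 / 2) (fun B => if ∀ j, Z B j = 0 then (1 : ℝ) else 0) ≤ cbRatio N' ^ m := by
  have key : ∀ J : Finset (Fin m),
      expect (1 / 2) (fun B => if ∀ j ∈ J, Z B j = 0 then (1 : ℝ) else 0) ≤ cbRatio N' ^ #J := by
    intro J
    induction J using Finset.induction_on with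
    | empty => simp [expect_const]
    | insert j J hj ih =>
      rw [card_insert_of_notMem hj, pow_succ, mul_comm]
      refine le_trans ?_ (mul_le_mul_of_nonneg_left ih (cbRatio_nonneg _))
      rw [← expect_mul_left]
      let e : {a : Fin N // (j, a) ∈ good} → Fin m × Fin N := fun a => (j, a.1)
      have he : Function.Injective e := fun a b h => Subtype.ext (Prod.ext_iff.1 h).2
      have hsame : ∀ (B : Fin m × Fin N → Bool) (h : {a : Fin N // (j, a) ∈ good} → Bool),
          ∀ k ≠ j, Z (Function.extend e h B) k = Z B k := fun B h k hk =>
        apply_extend_eq e (fun B => Z B k) (fun B a c => hZ' B (e a) a.2 c k hk) h B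
      refine expect_le_of_resample (by norm_num) (by norm_num) (fun _ => univ.image e)
        (fun _ _ => rfl) _ _ fun B => ?_
      rw [expect_mix_image _ e he B
        (fun f => if ∀ k ∈ insert j J, Z f k = 0 then (1 : ℝ) else 0)]
      have h1 : expect (1 / 2) (fun h : {a : Fin N // (j, a) ∈ good} → Bool =>
            if ∀ k ∈ insert j J, Z (Function.extend e h B) k = 0 then (1 : ℝ) else 0) ≤
          expect (1 / 2) (fun h => (if ∀ k ∈ J, Z B k = 0 then (1 : ℝ) else 0) *
            (if Z (Function.extend e h B) j = 0 then (1 : ℝ) else 0)) := by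
        refine expect_mono (by norm_num) (by norm_num) fun h => ?_
        by_cases hh : ∀ k ∈ insert j J, Z (Function.extend e h B) k = 0
        · have h2 : ∀ k ∈ J, Z B k = 0 := fun k hk => by
            rw [← hsame B h k (fun hkj => hj (hkj ▸ hk))]
            exact hh k (mem_insert_of_mem hk)
          rw [if_pos hh, if_pos h2, if_pos (hh j (mem_insert_self j J))]
          norm_num
        · rw [if_neg hh]
          split_ifs <;> norm_num
      refine h1.trans ?_
      rw [expect_mul_left, mul_comm]
      refine mul_le_mul_of_nonneg_right ?_ (by split_ifs <;> norm_num)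
      refine (expect_half_eq_zero_le (fun h => Z (Function.extend e h B) j)
        (fun a => sgn (e a)) fun h a => ?_).trans (cbRatio_antitone ?_)
      · simp only [extend_update e he]
        exact hZ _ (e a) a.2
      · rw [Fintype.card_subtype]
        exact hN j
  have := key univ
  simpa using this

end LittlewoodOfford


section Groups

variable {m N : ℕ}

lemma sum_update_eq {ι : Type*} [Fintype ι] [DecidableEq ι] (G : ι → Bool → ℤ) (B : ι → Bool)
    (a : ι) (c : Bool) :
    ∑ x, G x (Function.update B a c x) = G a c + ∑ x ∈ univ.erase a, G x (B x) := by
  rw [← add_sum_erase univ _ (mem_univ a), Function.update_self]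
  congr 1
  exact sum_congr rfl fun x hx => by rw [Function.update_of_ne (ne_of_mem_erase hx)]

lemma expect_half_forall_sum_eq_zero_le {N' : ℕ} (K : Fin m → ℤ)
    (G : Fin m × Fin N → Bool → Fin m → ℤ) (good : Finset (Fin m × Fin N))
    (hN : ∀ j, N' ≤ #{a | (j, a) ∈ good})
    (hG : ∀ x ∈ good, G x true x.1 ≠ G x false x.1)
    (hG' : ∀ x ∈ good, ∀ j ≠ x.1, G x true j = G x false j) :
    expect (1 / 2) (fun B => if ∀ j, K j + ∑ x, G x (B x) j = 0 then (1 : ℝ) else 0)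
      ≤ cbRatio N' ^ m := by
  refine expect_half_forall_eq_zero_le (fun B j => K j + ∑ x, G x (B x) j) good
    (fun x => decide (G x false x.1 < G x true x.1)) hN ?_ ?_
  · intro B x hx
    simp only [sum_update_eq (fun y b => G y b x.1)]
    have := hG x hx
    by_cases h : G x false x.1 < G x true x.1
    · simp [h]
    · have : G x true x.1 < G x false x.1 := by omega
      simpa [h] using this
  · intro B x hx c j hj
    have h1 := sum_update_eq (fun y b => G y b j) B x c
    have h2 := sum_update_eq (fun y b => G y b j) B x (B x)
    rw [Function.update_eq_self] at h2
    rw [h1, h2]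
    have := hG' x hx j hj
    cases c <;> cases B x <;> simp [this]

lemma expect_exists_card_lt_le {κ : Type*} [Fintype κ] [DecidableEq κ] {q : ℝ} (h0 : 0 ≤ q)
    (h1 : q ≤ 1) (P : Fin m × Fin N → (κ → Bool) → Prop) {c : ℝ}
    (hc : ∀ i, c ≤ expect q fun g => if P i g then (1 : ℝ) else 0) (N' : ℕ) :
    expect q (fun h : (Fin m × Fin N) × κ → Bool =>
        if ∃ j, #{a | P (j, a) fun k => h ((j, a), k)} < N' then (1 : ℝ) else 0)
      ≤ m * (2 ^ N' * (1 - c / 2) ^ N) := by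
  let H : Fin m → Fin m × Fin N → (κ → Bool) → ℝ := fun j i g =>
    if i.1 = j then (if P i g then 1 / 2 else 1) else 1
  have hprod : ∀ j (h : (Fin m × Fin N) × κ → Bool), ∏ i, H j i (fun k => h (i, k)) =
      (1 / 2) ^ #{a | P (j, a) fun k => h ((j, a), k)} := by
    intro j h
    rw [Fintype.prod_prod_type, Fintype.prod_eq_single j]
    · simp only [H, if_true]
      rw [prod_ite, prod_const, prod_const_one, mul_one]
    · intro j' hj'
      simp [H, hj']
  calc _ ≤ expect q (fun h : (Fin m × Fin N) × κ → Bool =>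
        ∑ j, 2 ^ N' * ∏ i, H j i (fun k => h (i, k))) := by
        refine expect_mono h0 h1 fun h => ?_
        split_ifs with hh
        · obtain ⟨j, hj⟩ := hh
          refine le_trans ?_ (single_le_sum (f := fun j => (2 : ℝ) ^ N' * ∏ i, H j i
            (fun k => h (i, k))) (fun j _ => ?_) (mem_univ j))
          · simp only [hprod]
            rw [one_div, inv_pow, ← div_eq_mul_inv, one_le_div (by positivity)]
            exact pow_le_pow_right₀ (by norm_num) hj.le
          · simp only [hprod]; positivity
        · refine sum_nonneg fun j _ => ?_
          simp only [hprod]; positivity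
    _ = ∑ j, 2 ^ N' * ∏ i, expect q (H j i) := by
        rw [expect_sum]
        refine sum_congr rfl fun j _ => ?_
        rw [expect_mul_left, expect_prod_blocks]
    _ ≤ ∑ j : Fin m, 2 ^ N' * (1 - c / 2) ^ N := by
        refine sum_le_sum fun j _ => mul_le_mul_of_nonneg_left ?_ (by positivity)
        rw [Fintype.prod_prod_type, Fintype.prod_eq_single j]
        · calc _ ≤ ∏ _a : Fin N, (1 - c / 2) := by
                refine prod_le_prod (fun a _ => ?_) fun a _ => ?_
                · refine expect_nonneg h0 h1 fun g => ?_
                  simp only [H]; split_ifs <;> norm_num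
                · have e : ∀ g, H j (j, a) g =
                      1 + (-1 / 2) * (if P (j, a) g then (1 : ℝ) else 0) := by
                    intro g
                    simp only [H, if_true]
                    split_ifs <;> norm_num
                  have e' : H j (j, a) = fun g =>
                      1 + (-1 / 2) * (if P (j, a) g then (1 : ℝ) else 0) := funext e
                  rw [e', expect_add, expect_const, expect_mul_left]
                  have := hc (j, a)
                  linarith
            _ = _ := by simp
        · intro j' hj'
          simp [H, hj', expect_const]
    _ = _ := by simp

end Groups

section Gadget

variable {n r : ℕ} {ι : Type*}

/-- Pairs of vertices `w i false`, `w i true`, together with vertices `ρ i x` to which both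
vertices of the pair are related in the same way in `G₀`. -/
structure Gadget (G₀ : SimpleGraph (Fin n)) (w : ι → Bool → Fin n)
    (ρ : ι → Bool × Fin r → Fin n) (s : ι → Bool) : Prop where
  inj_w : ∀ {i b i' b'}, w i b = w i' b' → i = i' ∧ b = b'
  inj_ρ : ∀ {i x x'}, ρ i x = ρ i x' → x = x'
  ne : ∀ {i b i' x}, w i b ≠ ρ i' x
  adj : ∀ i b x, G₀.Adj (w i b) (ρ i x) ↔ s i = true

/-- The potential edges of a gadget. -/
def gadgetEmb (w : ι → Bool → Fin n) (ρ : ι → Bool × Fin r → Fin n) :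
    ι × (Bool × Bool) × Fin r → Sym2 (Fin n) :=
  fun z => s(w z.1 z.2.1.2, ρ z.1 (z.2.1.1, z.2.2))

/-- Interchange the second halves of the rows of the pairs selected by `B`. -/
def rowSwap (B : ι → Bool) : ι × (Bool × Bool) × Fin r → ι × (Bool × Bool) × Fin r :=
  fun z => (z.1, (z.2.1.1, if z.2.1.1 then xor z.2.1.2 (B z.1) else z.2.1.2), z.2.2)

lemma rowSwap_involutive (B : ι → Bool) :
    Function.Involutive (rowSwap (r := r) B) := by
  rintro ⟨i, ⟨p, b⟩, k⟩
  cases p <;> simp [rowSwap]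

variable {G₀ : SimpleGraph (Fin n)} {w : ι → Bool → Fin n} {ρ : ι → Bool × Fin r → Fin n}
  {s : ι → Bool}

lemma Gadget.emb_injective (g : Gadget G₀ w ρ s) : Function.Injective (gadgetEmb w ρ) := by
  rintro ⟨i, ⟨p, b⟩, k⟩ ⟨i', ⟨p', b'⟩, k'⟩ h
  simp only [gadgetEmb, Sym2.eq_iff] at h
  rcases h with ⟨h1, h2⟩ | ⟨h1, -⟩
  · obtain ⟨rfl, rfl⟩ := g.inj_w h1
    have := g.inj_ρ h2
    simp only [Prod.mk.injEq] at this
    obtain ⟨rfl, rfl⟩ := this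
    rfl
  · exact absurd h1 g.ne

/-- Number of neighbours of `w i b` in the half of `ρ i` selected by `p`. -/
def rowCount (s : ι → Bool) (h : ι × (Bool × Bool) × Fin r → Bool) (i : ι) (p b : Bool) : ℕ :=
  ∑ k, if (xor (s i) (h (i, (p, b), k))) then 1 else 0

lemma rowCount_rowSwap_false (h : ι × (Bool × Bool) × Fin r → Bool) (B : ι → Bool) (i : ι)
    (b : Bool) : rowCount s (h ∘ rowSwap B) i false b = rowCount s h i false b := rfl

lemma rowCount_rowSwap_true (h : ι × (Bool × Bool) × Fin r → Bool) (B : ι → Bool) (i : ι)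
    (b : Bool) : rowCount s (h ∘ rowSwap B) i true b = rowCount s h i true (xor b (B i)) := rfl

lemma Gadget.pert_adj_iff (g : Gadget G₀ w ρ s) (f : Sym2 (Fin n) → Bool)
    (h : ι × (Bool × Bool) × Fin r → Bool) (i : ι) (b p : Bool) (k : Fin r) :
    (pert G₀ (Function.extend (gadgetEmb w ρ) h f)).Adj (w i b) (ρ i (p, k)) ↔
      xor (s i) (h (i, (p, b), k)) = true := by
  have e : Function.extend (gadgetEmb w ρ) h f s(w i b, ρ i (p, k)) = h (i, (p, b), k) :=
    g.emb_injective.extend_apply h f (i, (p, b), k)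
  rw [pert_adj, e, g.adj]
  have := g.ne (i := i) (b := b) (i' := i) (x := (p, k))
  cases s i <;> cases h (i, (p, b), k) <;> simp [this]

lemma Gadget.pert_adj_congr_left (g : Gadget G₀ w ρ s) (f : Sym2 (Fin n) → Bool)
    (h h' : ι × (Bool × Bool) × Fin r → Bool) {i : ι} {b : Bool} {y : Fin n}
    (hy : ∀ x, ρ i x ≠ y) :
    (pert G₀ (Function.extend (gadgetEmb w ρ) h f)).Adj (w i b) y ↔
      (pert G₀ (Function.extend (gadgetEmb w ρ) h' f)).Adj (w i b) y := by
  have : ¬ ∃ z, gadgetEmb w ρ z = s(w i b, y) := by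
    rintro ⟨⟨i', ⟨p', b'⟩, k'⟩, hz⟩
    simp only [gadgetEmb, Sym2.eq_iff] at hz
    rcases hz with ⟨h1, h2⟩ | ⟨-, h1⟩
    · obtain ⟨rfl, rfl⟩ := g.inj_w h1
      exact hy _ h2
    · exact g.ne h1.symm
  refine pert_adj_congr _ ?_
  rw [Function.extend_apply' _ _ _ this, Function.extend_apply' _ _ _ this]

/-- The degree of `w i b` splits into a constant part and two random parts. -/
lemma Gadget.exists_dg_eq (g : Gadget G₀ w ρ s) (f : Sym2 (Fin n) → Bool) (i : ι) (b : Bool) :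
    ∃ C : ℕ, ∀ h, dg (pert G₀ (Function.extend (gadgetEmb w ρ) h f)) (w i b) =
      C + rowCount s h i false b + rowCount s h i true b := by
  let h₀ : ι × (Bool × Bool) × Fin r → Bool := fun _ => false
  refine ⟨∑ y ∈ univ.filter (fun y => ∀ x, ρ i x ≠ y),
    if (pert G₀ (Function.extend (gadgetEmb w ρ) h₀ f)).Adj (w i b) y then 1 else 0, fun h => ?_⟩
  unfold dg
  rw [← sum_filter_add_sum_filter_not univ (fun y => ∀ x, ρ i x ≠ y), add_assoc]
  congr 1
  · refine sum_congr rfl fun y hy => ?_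
    simp only [g.pert_adj_congr_left f h h₀ (mem_filter.1 hy).2]
  · have himg : (univ.filter fun y => ¬ ∀ x, ρ i x ≠ y) = univ.image (ρ i) := by
      ext y; simp only [mem_filter, mem_image, mem_univ, true_and, not_forall, not_not]
    rw [himg, sum_image fun x _ x' _ hx => g.inj_ρ hx, Fintype.sum_prod_type]
    simp only [g.pert_adj_iff]
    rw [Fintype.sum_bool, add_comm]
    rfl

/-- Degrees outside the pairs are not affected by swapping. -/
lemma Gadget.dg_rowSwap [Fintype ι] (g : Gadget G₀ w ρ s) (f : Sym2 (Fin n) → Bool)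
    (h : ι × (Bool × Bool) × Fin r → Bool) (B : ι → Bool) {y : Fin n} (hy : ∀ i b, w i b ≠ y) :
    dg (pert G₀ (Function.extend (gadgetEmb w ρ) (h ∘ rowSwap B) f)) y =
      dg (pert G₀ (Function.extend (gadgetEmb w ρ) h f)) y := by
  unfold dg
  rw [← sum_filter_add_sum_filter_not univ (fun z => ∃ x : ι × Bool, w x.1 x.2 = z),
    ← sum_filter_add_sum_filter_not univ (fun z => ∃ x : ι × Bool, w x.1 x.2 = z)]
  congr 1
  · have himg : (univ.filter fun z => ∃ x : ι × Bool, w x.1 x.2 = z) =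
        univ.image (fun x : ι × Bool => w x.1 x.2) := by ext z; simp
    have hinj : ∀ x ∈ (univ : Finset (ι × Bool)), ∀ x' ∈ (univ : Finset (ι × Bool)),
        w x.1 x.2 = w x'.1 x'.2 → x = x' := fun x _ x' _ hx =>
      Prod.ext (g.inj_w hx).1 (g.inj_w hx).2
    rw [himg, sum_image hinj, sum_image hinj, Fintype.sum_prod_type, Fintype.sum_prod_type]
    refine sum_congr rfl fun i _ => ?_
    by_cases hi : ∃ x, ρ i x = y
    · obtain ⟨⟨p, k⟩, rfl⟩ := hi
      simp only [SimpleGraph.adj_comm _ (ρ i (p, k)), g.pert_adj_iff, Function.comp, rowSwap,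
        Fintype.sum_bool]
      cases p <;> cases B i <;> simp [add_comm]
    · push Not at hi
      refine sum_congr rfl fun b _ => ?_
      simp only [SimpleGraph.adj_comm _ y, g.pert_adj_congr_left f (h ∘ rowSwap B) h hi]
  · refine sum_congr rfl fun z hz => ?_
    have hz' := (mem_filter.1 hz).2
    push Not at hz'
    have : ¬ ∃ a, gadgetEmb w ρ a = s(y, z) := by
      rintro ⟨⟨i', ⟨p', b'⟩, k'⟩, ha⟩
      simp only [gadgetEmb, Sym2.eq_iff] at ha
      rcases ha with ⟨h1, -⟩ | ⟨h1, -⟩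
      · exact hy _ _ h1
      · exact hz' (i', b') h1
    have e := pert_adj_congr G₀ (a := y) (b := z)
      (f := Function.extend (gadgetEmb w ρ) (h ∘ rowSwap B) f)
      (f' := Function.extend (gadgetEmb w ρ) h f)
      (by rw [Function.extend_apply' _ _ _ this, Function.extend_apply' _ _ _ this])
    simp only [e]

lemma natCast_zmod_eq_iff {M a b : ℕ} (ha : a < M) (hb : b < M) :
    (a : ZMod M) = (b : ZMod M) ↔ a = b := by
  rw [ZMod.natCast_eq_natCast_iff', Nat.mod_eq_of_lt ha, Nat.mod_eq_of_lt hb]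

/-- Test whether the degree has residue `2 (j + 1)` modulo `2 m + 2`. -/
noncomputable def residueTest (m j d : ℕ) : ℤ :=
  if (d : ZMod (2 * m + 2)) = ((2 * (j + 1) : ℕ) : ZMod (2 * m + 2)) then 1 else 0

lemma residueTest_of_eq {m j d d' : ℕ} (hj : j < m) (hd' : d' < 2 * m + 2)
    (h : (d : ZMod (2 * m + 2)) = (d' : ZMod (2 * m + 2))) :
    residueTest m j d = if d' = 2 * (j + 1) then 1 else 0 := by
  unfold residueTest
  rw [h]
  simp only [natCast_zmod_eq_iff hd' (show 2 * (j + 1) < 2 * m + 2 by omega)]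

lemma rowCount_false {i : ι} (hs : s i = false) (h : ι × (Bool × Bool) × Fin r → Bool)
    (p b : Bool) : rowCount s h i p b = #{k | h (i, (p, b), k) = true} := by
  simp [rowCount, hs]

lemma rowCount_true {i : ι} (hs : s i = true) (h : ι × (Bool × Bool) × Fin r → Bool) (p b : Bool) :
    rowCount s h i p b + #{k | h (i, (p, b), k) = true} = r := by
  have : rowCount s h i p b = #{k | ¬ h (i, (p, b), k) = true} := by
    simp [rowCount, hs]
  rw [this, add_comm, card_filter_add_card_filter_not, card_univ, Fintype.card_fin]

/-- Residues of the numbers of random edges for which a swap changes the residue of `w i false`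
from `τ` to `τ + 1` and keeps that of `w i true` in `{0, 1}`. -/
lemma exists_rowCount_residues (s : ι → Bool) (i : ι) (M : ℕ) (hM : 2 ≤ M) (C : Bool → ℕ) (τ : ℕ) :
    ∃ k : Bool → Bool → ℕ, (∀ p b, k p b < M) ∧ ∀ h : ι × (Bool × Bool) × Fin r → Bool,
      (∀ p b, #{x | h (i, (p, b), x) = true} = k p b) → ∀ β,
        ((C false + rowCount s h i false false + rowCount s h i true β : ℕ) : ZMod M) =
          ((if xor β (s i) then τ else τ + 1 : ℕ) : ZMod M) ∧
        ((C true + rowCount s h i false true + rowCount s h i true (!β) : ℕ) : ZMod M) =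
          ((if xor β (s i) then 1 else 0 : ℕ) : ZMod M) := by
  have : NeZero M := ⟨by omega⟩
  cases hs : s i with
  | false =>
    refine ⟨fun p b => if p then (if b then 0 else 1) else
      (if b then (0 - C true : ZMod M).val else (τ - C false : ZMod M).val), ?_, ?_⟩
    · intro p b
      cases p <;> cases b <;> simp [ZMod.val_lt] <;> omega
    · intro h hh β
      push_cast
      simp only [rowCount_false hs, hh]
      cases β <;> simp
  | true =>
    refine ⟨fun p b => if p then (if b then 0 else 1) else
      (if b then (C true + 2 * r - 1 : ZMod M).val else
        (C false + 2 * r - 1 - τ : ZMod M).val), ?_, ?_⟩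
    · intro p b
      cases p <;> cases b <;> simp [ZMod.val_lt] <;> omega
    · intro h hh β
      have key : ∀ p b, (rowCount s h i p b : ZMod M) =
          r - (#{x | h (i, (p, b), x) = true} : ℕ) := by
        intro p b
        rw [eq_sub_iff_add_eq]
        exact_mod_cast congrArg (Nat.cast (R := ZMod M)) (rowCount_true hs h p b)
      push_cast
      simp only [key, hh]
      cases β <;> simp <;> ring_nf <;> simp

end Gadget

section GadgetBound

variable {n r m N : ℕ} {G₀ : SimpleGraph (Fin n)} {w : Fin m × Fin N → Bool → Fin n}
  {ρ : Fin m × Fin N → Bool × Fin r → Fin n} {s : Fin m × Fin N → Bool}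

lemma Gadget.sum_rowSwap (g : Gadget G₀ w ρ s) (f : Sym2 (Fin n) → Bool) (X : Fin n → ℤ)
    (C : Fin m × Fin N → Bool → ℕ)
    (hC : ∀ i b h, dg (pert G₀ (Function.extend (gadgetEmb w ρ) h f)) (w i b) =
      C i b + rowCount s h i false b + rowCount s h i true b)
    (h : (Fin m × Fin N) × (Bool × Bool) × Fin r → Bool) (B : Fin m × Fin N → Bool) (T : ℕ → ℤ) :
    ∑ y, X y * T (dg (pert G₀ (Function.extend (gadgetEmb w ρ) (h ∘ rowSwap B) f)) y) =
      (∑ y ∈ univ.filter (fun z => ¬ ∃ x : (Fin m × Fin N) × Bool, w x.1 x.2 = z),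
        X y * T (dg (pert G₀ (Function.extend (gadgetEmb w ρ) h f)) y)) +
      ∑ i, ∑ b, X (w i b) *
        T (C i b + rowCount s h i false b + rowCount s h i true (xor b (B i))) := by
  rw [← sum_filter_add_sum_filter_not univ
    (fun z => ∃ x : (Fin m × Fin N) × Bool, w x.1 x.2 = z), add_comm]
  congr 1
  · refine sum_congr rfl fun y hy => ?_
    have hy' := (mem_filter.1 hy).2
    push Not at hy'
    rw [g.dg_rowSwap f h B fun i b => hy' (i, b)]
  · have himg : (univ.filter fun z => ∃ x : (Fin m × Fin N) × Bool, w x.1 x.2 = z) =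
        univ.image (fun x : (Fin m × Fin N) × Bool => w x.1 x.2) := by ext z; simp
    rw [himg, sum_image fun x _ x' _ hx => Prod.ext (g.inj_w hx).1 (g.inj_w hx).2,
      Fintype.sum_prod_type]
    simp only [hC, rowCount_rowSwap_false, rowCount_rowSwap_true]

lemma expect_forall_card_eq_ge {q c : ℝ} (hc0 : 0 ≤ c) (k : Bool → Bool → ℕ)
    (hc : ∀ p b, c ≤ r.choose (k p b) * q ^ k p b * (1 - q) ^ (r - k p b)) :
    c ^ 4 ≤ expect q fun g : (Bool × Bool) × Fin r → Bool =>
      if ∀ p b, #{x | g ((p, b), x) = true} = k p b then (1 : ℝ) else 0 := by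
  have e : ∀ g : (Bool × Bool) × Fin r → Bool,
      (if ∀ p b, #{x | g ((p, b), x) = true} = k p b then (1 : ℝ) else 0) =
        ∏ z : Bool × Bool, if #{x | g (z, x) = true} = k z.1 z.2 then (1 : ℝ) else 0 := by
    intro g
    rw [Fintype.prod_ite_zero]
    simp only [Prod.forall, prod_const_one]
  simp only [e]
  rw [expect_prod_blocks q fun (z : Bool × Bool) (g : Fin r → Bool) =>
    if #{x | g x = true} = k z.1 z.2 then (1 : ℝ) else 0]
  simp only [expect_binomial]
  calc c ^ 4 = ∏ _z : Bool × Bool, c := by simp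
    _ ≤ _ := prod_le_prod (fun _ _ => hc0) fun z _ => hc z.1 z.2

/-- All degree tests on a gadget vanish simultaneously with small probability. -/
theorem Gadget.expect_forall_sum_eq_zero_le (g : Gadget G₀ w ρ s) (f : Sym2 (Fin n) → Bool)
    (X : Fin n → ℤ) (hX : ∀ i, X (w i false) ≠ 0) {q c : ℝ} (h0 : 0 ≤ q) (h1 : q ≤ 1)
    (hc0 : 0 ≤ c)
    (hc : ∀ k < 2 * m + 2, c ≤ r.choose k * q ^ k * (1 - q) ^ (r - k)) (N' : ℕ) :
    expect q (fun h => if ∀ j : Fin m, ∑ y, X y * residueTest m j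
        (dg (pert G₀ (Function.extend (gadgetEmb w ρ) h f)) y) = 0 then (1 : ℝ) else 0) ≤
      cbRatio N' ^ m + m * (2 ^ N' * (1 - c ^ 4 / 2) ^ N) := by
  choose C hC using fun i b => g.exists_dg_eq f i b
  choose k hkM hk using fun i : Fin m × Fin N =>
    exists_rowCount_residues (r := r) s i (2 * m + 2) (by omega) (C i) (2 * (i.1 + 1))
  set F : ((Fin m × Fin N) × (Bool × Bool) × Fin r → Bool) → ℝ := fun h =>
    if ∀ j : Fin m, ∑ y, X y * residueTest m j
        (dg (pert G₀ (Function.extend (gadgetEmb w ρ) h f)) y) = 0 then (1 : ℝ) else 0 with hF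
  let P : Fin m × Fin N → ((Bool × Bool) × Fin r → Bool) → Prop := fun i g =>
    ∀ p b, #{x | g ((p, b), x) = true} = k i p b
  let bad : ((Fin m × Fin N) × (Bool × Bool) × Fin r → Bool) → Prop := fun h =>
    ∃ j, #{a | P (j, a) fun k => h ((j, a), k)} < N'
  have hswap : expect q F = expect q fun h => expect (1 / 2) fun B => F (h ∘ rowSwap B) := by
    have h2 : ∀ B : Fin m × Fin N → Bool, expect q (fun h => F (h ∘ rowSwap B)) = expect q F :=
      fun B => expect_comp_perm q (Function.Involutive.toPerm _ (rowSwap_involutive B)) F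
    calc expect q F = expect (1 / 2) fun B : Fin m × Fin N → Bool =>
          expect q (fun h => F (h ∘ rowSwap B)) := by simp only [h2, expect_const]
      _ = _ := by
        unfold expect
        simp only [mul_sum]
        rw [sum_comm]
        exact sum_congr rfl fun _ _ => sum_congr rfl fun _ _ => by ring
  have hpt : ∀ h, expect (1 / 2) (fun B => F (h ∘ rowSwap B)) ≤
      cbRatio N' ^ m + if bad h then 1 else 0 := by
    intro h
    by_cases hb : bad h
    · rw [if_pos hb]
      have h3 : expect (1 / 2) (fun B => F (h ∘ rowSwap B)) ≤
          expect (1 / 2) fun _ : Fin m × Fin N → Bool => (1 : ℝ) := by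
        refine expect_mono (by norm_num) (by norm_num) fun B => ?_
        simp only [hF]
        split_ifs <;> norm_num
      rw [expect_const] at h3
      have := pow_nonneg (cbRatio_nonneg N') m
      linarith
    · rw [if_neg hb, add_zero]
      simp only [hF, g.sum_rowSwap f X C hC]
      refine expect_half_forall_sum_eq_zero_le _
        (fun i β j => ∑ b, X (w i b) * residueTest m j
          (C i b + rowCount s h i false b + rowCount s h i true (xor b β)))
        (univ.filter fun i => P i fun k => h (i, k)) ?_ ?_ ?_
      · intro j
        simp only [bad, not_exists, not_lt] at hb
        simpa using hb j
      all_goals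
        intro i hi
        have hi' := hk i h (mem_filter.1 hi).2
        have hlt := i.1.2
        have hF : ∀ j : Fin m, ∀ β, residueTest m j
            (C i false + rowCount s h i false false + rowCount s h i true (xor false β)) =
            if xor β (s i) = true ∧ j = i.1 then 1 else 0 := by
          intro j β
          rw [Bool.false_xor, residueTest_of_eq j.2 (by split_ifs <;> omega) (hi' β).1]
          refine if_congr ?_ rfl rfl
          rw [Fin.ext_iff]
          split_ifs with hx <;> simp [hx] <;> omega
        have hT : ∀ j : Fin m, ∀ β, residueTest m j
            (C i true + rowCount s h i false true + rowCount s h i true (xor true β)) = 0 := by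
          intro j β
          rw [Bool.true_xor, residueTest_of_eq j.2 (by split_ifs <;> omega) (hi' β).2]
          refine if_neg ?_
          intro hj
          split_ifs at hj
          all_goals omega
        simp only [Fintype.sum_bool, hF, hT]
      · cases s i <;> simp [hX i, (hX i).symm]
      · intro j hj
        simp [hj]
  rw [hswap]
  refine (expect_mono h0 h1 hpt).trans ?_
  rw [expect_add, expect_const]
  refine add_le_add le_rfl ?_
  refine le_trans (le_of_eq ?_) (expect_exists_card_lt_le h0 h1 P
    (fun i => (expect_forall_card_eq_ge hc0 (k i) fun p b => hc _ (hkM i p b)).trans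
      (le_of_eq ?_)) N')
  · refine congrArg (expect q) (funext fun h => ?_)
    simp only [bad, P]
  · refine congrArg (expect q) (funext fun h => ?_)
    simp only [P]
    congr!

end GadgetBound

section Selection

variable {n r m N : ℕ}

lemma exists_two_of_three (P : Fin 3 → Prop) : ∃ z : Fin 3 × Bool, ∀ x ≠ z.1, P x ↔ z.2 = true := by
  by_cases h0 : P 0 <;> by_cases h1 : P 1 <;> by_cases h2 : P 2
  · exact ⟨(0, true), fun x _ => by fin_cases x <;> simp_all⟩
  · exact ⟨(2, true), fun x _ => by fin_cases x <;> simp_all⟩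
  · exact ⟨(1, true), fun x _ => by fin_cases x <;> simp_all⟩
  · exact ⟨(0, false), fun x _ => by fin_cases x <;> simp_all⟩
  · exact ⟨(0, true), fun x _ => by fin_cases x <;> simp_all⟩
  · exact ⟨(1, false), fun x _ => by fin_cases x <;> simp_all⟩
  · exact ⟨(2, false), fun x _ => by fin_cases x <;> simp_all⟩
  · exact ⟨(0, false), fun x _ => by fin_cases x <;> simp_all⟩

lemma exists_injective_of_card_le {α β : Type*} [Fintype α] (S : Finset β)
    (h : Fintype.card α ≤ #S) : ∃ a : α → β, Function.Injective a ∧ ∀ x, a x ∈ S := by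
  obtain ⟨e⟩ := Function.Embedding.nonempty_of_card_le (α := α) (β := S) (by simpa using h)
  exact ⟨fun x => e x, fun x y hxy => e.injective (Subtype.ext hxy), fun x => (e x).2⟩

/-- Large sets of vertices contain the pairs of a gadget. -/
lemma exists_gadget (G₀ : SimpleGraph (Fin n)) (r m N : ℕ) (T F : Finset (Fin n))
    (hF : 3 * (m * N) ≤ #F) (hn : 12 * r + #T + 3 * (m * N) ≤ n) :
    ∃ (w : Fin m × Fin N → Bool → Fin n) (ρ : Fin m × Fin N → Bool × Fin r → Fin n)
      (s : Fin m × Fin N → Bool), Gadget G₀ w ρ s ∧ (∀ i b, w i b ∈ F) ∧ ∀ i x, ρ i x ∉ T := by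
  obtain ⟨a, ha, haF⟩ := exists_injective_of_card_le (α := (Fin m × Fin N) × Fin 3) F
    (by simp only [Fintype.card_prod, Fintype.card_fin]; omega)
  set R : Finset (Fin n) := univ \ (T ∪ univ.image a) with hR
  have hRc : 12 * r ≤ #R := by
    rw [hR, card_sdiff_of_subset (subset_univ _), card_univ, Fintype.card_fin]
    have h1 := card_union_le T (univ.image a)
    have h2 : #(univ.image a) ≤ m * N * 3 := by
      refine card_image_le.trans (le_of_eq ?_)
      simp only [card_univ, Fintype.card_prod, Fintype.card_fin]
    omega
  choose z hz using fun (i : Fin m × Fin N) (y : Fin n) =>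
    exists_two_of_three fun x => G₀.Adj (a (i, x)) y
  have hfib : ∀ i, ∃ o : Fin 3 × Bool, 2 * r ≤ #{y ∈ R | z i y = o} := by
    intro i
    obtain ⟨o, -, ho⟩ := exists_le_card_fiber_of_mul_le_card_of_maps_to
      (s := R) (t := (univ : Finset (Fin 3 × Bool))) (f := z i) (n := 2 * r)
      (fun _ _ => mem_univ _) ⟨(0, true), mem_univ _⟩ (by
        simp only [card_univ, Fintype.card_prod, Fintype.card_fin, Fintype.card_bool]; omega)
    exact ⟨o, ho⟩
  choose o ho using hfib
  choose ρ hρ hρ' using fun i => exists_injective_of_card_le (α := Bool × Fin r)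
    {y ∈ R | z i y = o i} (by simpa using ho i)
  have hsel : ∀ (o : Fin 3) (b : Bool), (if b then o + 1 else o + 2) ≠ o := by decide
  have hsel' : ∀ (o : Fin 3) (b b' : Bool),
      (if b then o + 1 else o + 2) = (if b' then o + 1 else o + 2) → b = b' := by decide
  refine ⟨fun i b => a (i, if b then (o i).1 + 1 else (o i).1 + 2), ρ, fun i => (o i).2,
    ⟨?_, ?_, ?_, ?_⟩, ?_, ?_⟩
  · intro i b i' b' h
    have := ha h
    simp only [Prod.mk.injEq] at this
    obtain ⟨rfl, h2⟩ := this
    exact ⟨rfl, hsel' _ _ _ h2⟩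
  · intro i x x' h
    exact hρ i h
  · intro i b i' x h
    have := (mem_filter.1 (hρ' i' x)).1
    rw [hR, Finset.mem_sdiff, mem_union, ← h] at this
    exact this.2 (Or.inr (mem_image_of_mem _ (mem_univ _)))
  · intro i b x
    have h1 := (mem_filter.1 (hρ' i x)).2
    rw [← h1]
    exact hz i _ _ (by rw [h1]; exact hsel _ _)
  · exact fun i b => haF _
  · intro i x h
    have := (mem_filter.1 (hρ' i x)).1
    rw [hR, Finset.mem_sdiff, mem_union] at this
    exact this.2 (Or.inl h)

/-- It is unlikely that all degree tests vanish on the first large front. -/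
theorem expect_large_front_le (G₀ : SimpleGraph (Fin n)) (u v : Fin n) {q c : ℝ} (h0 : 0 ≤ q)
    (h1 : q ≤ 1) (hc0 : 0 ≤ c)
    (hc : ∀ k < 2 * m + 2, c ≤ r.choose k * q ^ k * (1 - q) ^ (r - k)) (N' K t : ℕ)
    (hn : 12 * r + K + 3 * (m * N) ≤ n) :
    expect q (fun f => if #(seen G₀ u v f t) ≤ K ∧ 3 * (m * N) ≤ #(front G₀ u v f t) ∧
        ∀ j : Fin m, ∑ y, vec G₀ u v f t y * residueTest m j (dg (pert G₀ f) y) = 0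
        then (1 : ℝ) else 0) ≤
      cbRatio N' ^ m + m * (2 ^ N' * (1 - c ^ 4 / 2) ^ N) := by
  have hsel : ∀ T F : Finset (Fin n), ∃ (w : Fin m × Fin N → Bool → Fin n)
      (ρ : Fin m × Fin N → Bool × Fin r → Fin n) (s : Fin m × Fin N → Bool),
      #T ≤ K ∧ 3 * (m * N) ≤ #F →
        Gadget G₀ w ρ s ∧ (∀ i b, w i b ∈ F) ∧ ∀ i x, ρ i x ∉ T := by
    intro T F
    by_cases h : #T ≤ K ∧ 3 * (m * N) ≤ #F
    · obtain ⟨w, ρ, s, h⟩ := exists_gadget G₀ r m N T F h.2 (by omega)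
      exact ⟨w, ρ, s, fun _ => h⟩
    · rcases Nat.eq_zero_or_pos n with rfl | hn0
      · exact (h ⟨by rw [card_eq_zero.2 (eq_empty_of_isEmpty T)]; omega,
          by rw [card_eq_zero.2 (eq_empty_of_isEmpty F)]; omega⟩).elim
      · exact ⟨fun _ _ => ⟨0, hn0⟩, fun _ _ => ⟨0, hn0⟩, fun _ => false, fun h' => absurd h' h⟩
  choose W ρ s hW using hsel
  let D' : Finset (Fin n) → Finset (Fin n) → Finset (Sym2 (Fin n)) := fun T F =>
    if #T ≤ K ∧ 3 * (m * N) ≤ #F then univ.image (gadgetEmb (W T F) (ρ T F)) else ∅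
  have hout : ∀ f, ∀ a ∈ seen G₀ u v f t, ∀ b,
      s(a, b) ∉ D' (seen G₀ u v f t) (front G₀ u v f t) := by
    intro f a ha b hmem
    simp only [D'] at hmem
    split_ifs at hmem with hh
    · obtain ⟨-, hWF, hρT⟩ := hW _ _ hh
      obtain ⟨z, -, hz⟩ := mem_image.1 hmem
      simp only [gadgetEmb, Sym2.eq_iff] at hz
      rcases hz with ⟨h1, -⟩ | ⟨-, h1⟩
      · exact (mem_front.1 (hWF z.1 z.2.1.2)).2 (h1 ▸ ha)
      · exact hρT _ _ (h1 ▸ ha)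
    · simp at hmem
  have hag : ∀ f g, ∀ a ∈ seen G₀ u v f t, ∀ b, f s(a, b) =
      mix (D' (seen G₀ u v f t) (front G₀ u v f t)) f g s(a, b) := fun f g a ha b =>
    (mix_not_mem (hout f a ha b)).symm
  rw [← expect_const (ι := Sym2 (Fin n)) q (cbRatio N' ^ m + _)]
  refine expect_le_of_resample h0 h1 (fun f => D' (seen G₀ u v f t) (front G₀ u v f t)) ?_ _ _ ?_
  · intro f g
    rw [seen_congr (hag f g) (Nat.le_succ t), front_congr (hag f g) le_rfl]
  · intro f
    have hs : ∀ g, seen G₀ u v (mix (D' (seen G₀ u v f t) (front G₀ u v f t)) f g) t =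
      seen G₀ u v f t := fun g => seen_congr (hag f g) (Nat.le_succ t)
    have hf : ∀ g, front G₀ u v (mix (D' (seen G₀ u v f t) (front G₀ u v f t)) f g) t =
      front G₀ u v f t := fun g => front_congr (hag f g) le_rfl
    have hv : ∀ g, vec G₀ u v (mix (D' (seen G₀ u v f t) (front G₀ u v f t)) f g) t =
      vec G₀ u v f t := fun g => vec_congr (hag f g) le_rfl
    simp only [hs, hf, hv]
    by_cases hh : #(seen G₀ u v f t) ≤ K ∧ 3 * (m * N) ≤ #(front G₀ u v f t)
    · obtain ⟨hg, hWF, -⟩ := hW _ _ hh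
      have hD : D' (seen G₀ u v f t) (front G₀ u v f t) = univ.image (gadgetEmb
          (W (seen G₀ u v f t) (front G₀ u v f t)) (ρ (seen G₀ u v f t) (front G₀ u v f t))) :=
        if_pos hh
      simp only [hD, hh, true_and]
      rw [expect_mix_image q _ hg.emb_injective f fun f' => if ∀ j : Fin m,
        ∑ y, vec G₀ u v f t y * residueTest m j (dg (pert G₀ f') y) = 0 then (1 : ℝ) else 0]
      exact hg.expect_forall_sum_eq_zero_le f _ (fun i => (mem_front.1 (hWF i false)).1)
        h0 h1 hc0 hc N'
    · refine le_trans (le_of_eq (expect_eq_zero q fun g => if_neg fun h => hh ⟨h.1, h.2.1⟩)) ?_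
      have hc1 : c ≤ 1 := by
        refine (hc 0 (by omega)).trans ?_
        simpa using pow_le_one₀ (by linarith) (by linarith)
      have h2 : 0 ≤ 1 - c ^ 4 / 2 := by
        have := pow_le_one₀ (n := 4) hc0 hc1
        linarith
      have := cbRatio_nonneg N'
      positivity

end Selection

section Union

variable {n : ℕ} (G₀ : SimpleGraph (Fin n))

/-- Colour refinement fails to distinguish a pair of vertices it should distinguish. -/
def Confused (f : Sym2 (Fin n) → Bool) : Prop :=
  ∃ u v, u ≠ v ∧ (u ∈ V23safe (graphOfFlip f) ∨
    (u ∈ V23 (graphOfFlip f) ∧ v ∈ V23 (graphOfFlip f))) ∧ crStableTrivial (pert G₀ f) u v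

lemma ite_le_add_ite {P Q R : Prop} [Decidable P] [Decidable Q] [Decidable R] (h : P → Q ∨ R) :
    (if P then (1 : ℝ) else 0) ≤ (if Q then 1 else 0) + if R then 1 else 0 := by
  by_cases hP : P
  · rcases h hP with h | h <;> rw [if_pos hP, if_pos h] <;> split_ifs <;> norm_num
  · rw [if_neg hP]
    split_ifs <;> norm_num

lemma ite_exists_le_sum {α : Type*} [Fintype α] (P : α → Prop) [Decidable (∃ a, P a)]
    [∀ a, Decidable (P a)] : (if ∃ a, P a then (1 : ℝ) else 0) ≤ ∑ a, if P a then 1 else 0 := by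
  split_ifs with h
  · obtain ⟨a, ha⟩ := h
    refine le_trans (le_of_eq (if_pos ha).symm)
      (single_le_sum (f := fun a => if P a then (1 : ℝ) else 0) (fun a _ => ?_) (mem_univ a))
    split_ifs <;> norm_num
  · exact sum_nonneg fun a _ => by split_ifs <;> norm_num

/-- Degrees in a random graph are rarely large. -/
lemma expect_exists_degree_gt_le {q : ℝ} (h0 : 0 ≤ q) (h1 : q ≤ 1) (Δ : ℕ) :
    expect q (fun f : Sym2 (Fin n) → Bool =>
      if ∃ a, Δ < #{b | f s(a, b) = true} then (1 : ℝ) else 0) ≤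
      n * (Real.exp (n * q) / 2 ^ Δ) := by
  refine (expect_mono h0 h1 fun f =>
    ite_exists_le_sum fun a : Fin n => Δ < #{b | f s(a, b) = true}).trans ?_
  rw [expect_sum]
  refine (sum_le_sum fun a _ => (?_ : _ ≤ Real.exp (n * q) / 2 ^ Δ)).trans (by simp)
  set D : Finset (Sym2 (Fin n)) := univ.image fun b => s(a, b) with hD
  have hinj : Function.Injective fun b : Fin n => s(a, b) := fun b b' h => Sym2.congr_right.1 h
  have hDc : #D = n := by rw [hD, card_image_of_injective _ hinj, card_univ, Fintype.card_fin]
  calc _ ≤ expect q (fun f : Sym2 (Fin n) → Bool =>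
        1 / 2 ^ Δ * ∏ i ∈ D, if f i then (2 : ℝ) else 1) := by
        refine expect_mono h0 h1 fun f => ?_
        have e : ∏ i ∈ D, (if f i then (2 : ℝ) else 1) = 2 ^ #{b | f s(a, b) = true} := by
          rw [hD, prod_image fun x _ y _ h => hinj h, prod_ite, prod_const, prod_const_one, mul_one]
        rw [e]
        split_ifs with h
        · rw [one_div, inv_mul_eq_div, one_le_div (by positivity)]
          exact pow_le_pow_right₀ (by norm_num) h.le
        · positivity
    _ = 1 / 2 ^ Δ * (1 + q) ^ n := by
        rw [expect_mul_left, expect_prod_mem, hDc]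
        norm_num
    _ ≤ 1 / 2 ^ Δ * Real.exp (n * q) := by
        refine mul_le_mul_of_nonneg_left ?_ (by positivity)
        rw [Real.exp_nat_mul]
        refine pow_le_pow_left₀ (by linarith) ?_ n
        rw [add_comm]
        exact Real.add_one_le_exp q
    _ = _ := by ring

lemma card_seen_le {u v : Fin n} {f : Sym2 (Fin n) → Bool} {K₁ K t₀ : ℕ} (hK : t₀ * K₁ ≤ K)
    (h : ∀ t < t₀, #(seen G₀ u v f t) ≤ K → #(front G₀ u v f t) ≤ K₁) :
    ∀ t ≤ t₀, #(seen G₀ u v f t) ≤ t * K₁ := by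
  intro t
  induction t with
  | zero => intro _; simp [seen_zero]
  | succ t ih =>
    intro ht
    have h1 := ih (by omega)
    have h2 := h t (by omega) (h1.trans (le_trans (Nat.mul_le_mul_right _ (by omega)) hK))
    rw [seen_succ, add_mul, one_mul]
    exact (card_union_le _ _).trans (add_le_add h1 h2)

/-- An indistinguishable pair leads to one of three unlikely events. -/
lemma confused_pair_cases {u v : Fin n} (huv : u ≠ v) {f : Sym2 (Fin n) → Bool}
    {m N K t₀ Δ : ℕ} (hK : t₀ * (3 * (m * N)) ≤ K) (hn : 2 * K ≤ n)
    (hcore : u ∈ V23safe (graphOfFlip f) ∨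
      (u ∈ V23 (graphOfFlip f) ∧ v ∈ V23 (graphOfFlip f)))
    (hst : crStableTrivial (pert G₀ f) u v) (hΔ : ∀ a, #{b | f s(a, b) = true} ≤ Δ) :
    (∃ t : Fin t₀, #(seen G₀ u v f t) ≤ K ∧ 3 * (m * N) ≤ #(front G₀ u v f t) ∧
      ∀ j : Fin m, ∑ y, vec G₀ u v f t y * residueTest m j (dg (pert G₀ f) y) = 0) ∨
    (∀ s < t₀, parityStep G₀ u v f s) ∨
    (∃ t : Fin t₀, dangerLE G₀ u v (K * (Δ + 1)) f t 0 ∧ #(seen G₀ u v f t) ≤ K ∧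
      3 ≤ #(surp G₀ u v f t 0)) := by
  by_cases hbig : ∃ t < t₀, #(seen G₀ u v f t) ≤ K ∧ 3 * (m * N) ≤ #(front G₀ u v f t)
  · obtain ⟨t, ht, h1, h2⟩ := hbig
    exact Or.inl ⟨⟨t, ht⟩, h1, h2, fun j => sum_kry_mul_dg hst t _⟩
  · right
    have hle : ∀ t ≤ t₀, #(seen G₀ u v f t) ≤ K := by
      intro t ht
      refine (card_seen_le G₀ hK (fun t ht h => ?_) t ht).trans
        ((Nat.mul_le_mul_right _ ht).trans hK)
      by_contra h'
      exact hbig ⟨t, ht, h, by omega⟩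
    by_cases hemp : ∃ t < t₀, front G₀ u v f t = ∅
    · right
      obtain ⟨t, ht, h⟩ := hemp
      refine ⟨⟨t, ht⟩, dangerLE_of_front_eq_empty h (hle t ht.le) hΔ, hle t ht.le, ?_⟩
      by_contra hs
      have hc := closedExploration_of_front_eq_empty (G₀ := G₀) huv h
      have hs' : #(surp G₀ u v f t 0) ≤ 2 := by simpa using Nat.lt_succ_iff.1 (not_le.1 hs)
      rcases hcore with hcore | hcore
      · exact hc.not_mem_V23safe hs' hcore
      · exact hc.not_both_mem_V23 hs' huv hcore
    · left
      push Not at hemp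
      exact fun s hs => ⟨hemp s hs,
        le_trans (Nat.mul_le_mul_left 2 (hle (s + 1) hs)) hn, sum_kry_mul_dg hst s _⟩

/-- The union bound over all pairs of vertices. -/
theorem expect_confused_le {m N r N' t₀ Δ : ℕ} {q c l : ℝ} (h1 : q ≤ 1 / 2) (hq : 1 ≤ q * n)
    (hc0 : 0 ≤ c) (hc : ∀ k < 2 * m + 2, c ≤ r.choose k * q ^ k * (1 - q) ^ (r - k))
    (hl : 1 ≤ l) (hn : 12 * r + t₀ * (3 * (m * N)) + 3 * (m * N) ≤ n)
    (hn' : 2 * (t₀ * (3 * (m * N))) ≤ n) :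
    expect q (fun f => if Confused G₀ f then (1 : ℝ) else 0) ≤
      n * (Real.exp (n * q) / 2 ^ Δ) + n ^ 2 *
        (t₀ * (cbRatio N' ^ m + m * (2 ^ N' * (1 - c ^ 4 / 2) ^ N)) +
          (((1 + Real.exp (-1)) / 2) ^ t₀ +
          t₀ * (Real.exp (l * q * (t₀ * (3 * (m * N)) * (Δ + 1) : ℕ) *
            (t₀ * (3 * (m * N)) : ℕ)) / l ^ 3))) := by
  have h0 : 0 ≤ q := by
    by_contra h
    have : q * n ≤ 0 := mul_nonpos_of_nonpos_of_nonneg (by linarith) (Nat.cast_nonneg n)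
    linarith
  have h1' : q ≤ 1 := by linarith
  set K := t₀ * (3 * (m * N)) with hK
  let A : Fin n × Fin n → Fin t₀ → (Sym2 (Fin n) → Bool) → Prop := fun x t f =>
    #(seen G₀ x.1 x.2 f t) ≤ K ∧ 3 * (m * N) ≤ #(front G₀ x.1 x.2 f t) ∧
      ∀ j : Fin m, ∑ y, vec G₀ x.1 x.2 f t y * residueTest m j (dg (pert G₀ f) y) = 0
  let B : Fin n × Fin n → (Sym2 (Fin n) → Bool) → Prop := fun x f =>
    ∀ s < t₀, parityStep G₀ x.1 x.2 f s
  let C : Fin n × Fin n → Fin t₀ → (Sym2 (Fin n) → Bool) → Prop := fun x t f =>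
    dangerLE G₀ x.1 x.2 (K * (Δ + 1)) f t 0 ∧ #(seen G₀ x.1 x.2 f t) ≤ K ∧
      3 ≤ #(surp G₀ x.1 x.2 f t 0)
  have hpt : ∀ f, (if Confused G₀ f then (1 : ℝ) else 0) ≤
      (if ∃ a, Δ < #{b | f s(a, b) = true} then (1 : ℝ) else 0) +
      ∑ x : Fin n × Fin n, ((∑ t, if A x t f then (1 : ℝ) else 0) +
        ((if B x f then 1 else 0) + ∑ t, if C x t f then 1 else 0)) := by
    intro f
    refine (ite_le_add_ite (Q := ∃ a, Δ < #{b | f s(a, b) = true})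
      (R := ∃ x : Fin n × Fin n, (∃ t, A x t f) ∨ (B x f ∨ ∃ t, C x t f)) ?_).trans ?_
    · rintro ⟨u, v, huv, hcore, hst⟩
      by_cases hΔ : ∃ a, Δ < #{b | f s(a, b) = true}
      · exact Or.inl hΔ
      · push Not at hΔ
        exact Or.inr ⟨(u, v), confused_pair_cases G₀ huv le_rfl hn' hcore hst hΔ⟩
    · refine add_le_add le_rfl ((ite_exists_le_sum _).trans (sum_le_sum fun x _ => ?_))
      refine (ite_le_add_ite id).trans (add_le_add (ite_exists_le_sum _) ?_)
      exact (ite_le_add_ite id).trans (add_le_add le_rfl (ite_exists_le_sum _))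
  refine (expect_mono h0 h1' hpt).trans ?_
  rw [expect_add]
  refine add_le_add (expect_exists_degree_gt_le h0 h1' Δ) ?_
  rw [expect_sum]
  refine (sum_le_sum fun x _ => (?_ : _ ≤ (t₀ * (cbRatio N' ^ m +
      m * (2 ^ N' * (1 - c ^ 4 / 2) ^ N)) + (((1 + Real.exp (-1)) / 2) ^ t₀ +
      t₀ * (Real.exp (l * q * (K * (Δ + 1) : ℕ) * K) / l ^ 3))))).trans ?_
  · rw [expect_add, expect_add, expect_sum, expect_sum]
    refine add_le_add ?_ (add_le_add ?_ ?_)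
    · have hA : ∀ t, expect q (fun f => if A x t f then (1 : ℝ) else 0) ≤
          cbRatio N' ^ m + m * (2 ^ N' * (1 - c ^ 4 / 2) ^ N) := fun t => by
        convert expect_large_front_le G₀ x.1 x.2 h0 h1' hc0 hc N' K t hn
      exact (sum_le_sum fun t _ => hA t).trans (by simp [mul_add])
    · exact expect_parityStep_le G₀ x.1 x.2 h0 h1 hq t₀
    · have hC : ∀ t, expect q (fun f => if C x t f then (1 : ℝ) else 0) ≤
          Real.exp (l * q * (K * (Δ + 1) : ℕ) * K) / l ^ 3 := fun t => by
        convert expect_three_surprises G₀ x.1 x.2 h0 h1' hl (K * (Δ + 1)) K t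
      exact (sum_le_sum fun t _ => hC t).trans (by simp)
  · rw [sum_const, card_univ, Fintype.card_prod, Fintype.card_fin, nsmul_eq_mul]
    push_cast
    rw [sq]

end Union

section Asymptotics

/-- Binomial point probabilities near a bounded mean are bounded below. -/
lemma exists_le_binomial (M : ℕ) : ∃ c : ℝ, 0 < c ∧ c ≤ 1 ∧ ∀ (q : ℝ) (r : ℕ), 0 < q → q ≤ 1 →
    2 * M ≤ r → 1 / (48 * q) ≤ r → r * q ≤ 1 / 24 →
    ∀ j < M, c ≤ r.choose j * q ^ j * (1 - q) ^ (r - j) := by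
  have hM : (0 : ℝ) < M.factorial := by exact_mod_cast M.factorial_pos
  have hM1 : (1 : ℝ) ≤ M.factorial := by exact_mod_cast M.factorial_pos
  have h96 : (1 / 96 : ℝ) ^ M ≤ 1 := pow_le_one₀ (by norm_num) (by norm_num)
  refine ⟨(1 / 96) ^ M / M.factorial / 2, by positivity, ?_, ?_⟩
  · rw [div_div, div_le_one (by positivity)]
    linarith
  · intro q r h0 h1 hr hrq hrq' j hj
    have hjr : 2 * j ≤ r := by omega
    have hA : (1 / 96 : ℝ) ^ M / M.factorial ≤ r.choose j * q ^ j := by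
      have e1 : ((r + 1 - j : ℕ) : ℝ) ^ j ≤ j.factorial * r.choose j := by
        have := Nat.pow_le_choose (α := ℝ) j r
        rw [div_le_iff₀ (by positivity), mul_comm] at this
        exact_mod_cast this
      have e2 : (r : ℝ) / 2 ≤ ((r + 1 - j : ℕ) : ℝ) := by
        have : r ≤ 2 * (r + 1 - j) := by omega
        have : (r : ℝ) ≤ 2 * ((r + 1 - j : ℕ) : ℝ) := by exact_mod_cast this
        linarith
      have e3 : 1 / 96 ≤ r / 2 * q := by
        rw [div_le_iff₀ (by positivity)] at hrq
        linarith
      have e4 : (1 / 96 : ℝ) ^ j ≤ j.factorial * r.choose j * q ^ j :=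
        calc (1 / 96 : ℝ) ^ j ≤ (r / 2 * q) ^ j := pow_le_pow_left₀ (by norm_num) e3 j
          _ = (r / 2) ^ j * q ^ j := mul_pow _ _ _
          _ ≤ _ := mul_le_mul_of_nonneg_right
            ((pow_le_pow_left₀ (by positivity) e2 j).trans e1) (by positivity)
      have e5 : (j.factorial : ℝ) ≤ M.factorial := by exact_mod_cast Nat.factorial_le hj.le
      rw [div_le_iff₀ hM]
      calc (1 / 96 : ℝ) ^ M ≤ (1 / 96) ^ j :=
            pow_le_pow_of_le_one (by norm_num) (by norm_num) hj.le
        _ ≤ j.factorial * (r.choose j * q ^ j) := by rwa [← mul_assoc]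
        _ ≤ M.factorial * (r.choose j * q ^ j) := mul_le_mul_of_nonneg_right e5 (by positivity)
        _ = _ := mul_comm _ _
    have hB : (1 / 2 : ℝ) ≤ (1 - q) ^ (r - j) := by
      have e1 : 1 + (r : ℝ) * (-q) ≤ (1 + -q) ^ r := one_add_mul_le_pow (by linarith) r
      have e2 : (1 - q) ^ r ≤ (1 - q) ^ (r - j) :=
        pow_le_pow_of_le_one (by linarith) (by linarith) (Nat.sub_le _ _)
      rw [← sub_eq_add_neg] at e1
      linarith
    calc (1 / 96 : ℝ) ^ M / M.factorial / 2 = (1 / 96) ^ M / M.factorial * (1 / 2) := by ring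
      _ ≤ _ := mul_le_mul hA hB (by norm_num) (by positivity)

/-- A number of rows that makes the Littlewood–Offord bound small while the probability of
having too few gadgets stays exponentially small. -/
lemma exists_row_bound {x : ℝ} (h0 : 0 < x) (h1 : x < 1) : ∃ D : ℕ, 0 < D ∧ ∃ ρ : ℝ, 0 ≤ ρ ∧ ρ < 1 ∧
    ∀ k : ℕ, 0 < k → ∃ N' : ℕ, 2 ^ N' * x ^ k ≤ ρ ^ k ∧
      ∀ a : ℕ, cbRatio N' ^ (2 * a) ≤ ((2 * D : ℝ) / k) ^ a := by
  set ρ := Real.sqrt x with hρ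
  have hρ0 : 0 ≤ ρ := Real.sqrt_nonneg _
  have hρ1 : ρ < 1 := by rw [hρ, Real.sqrt_lt' one_pos]; simpa using h1
  have hρ2 : ρ ^ 2 = x := Real.sq_sqrt h0.le
  obtain ⟨D, hD⟩ := exists_pow_lt_of_lt_one (show (0 : ℝ) < 1 / 2 by norm_num) hρ1
  have hD0 : 0 < D := by
    rcases Nat.eq_zero_or_pos D with h | h
    · rw [h, pow_zero] at hD
      norm_num at hD
    · exact h
  refine ⟨D, hD0, ρ, hρ0, hρ1, fun k hk => ⟨2 * (k / (2 * D)), ?_, fun a => ?_⟩⟩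
  · set h := k / (2 * D) with hh
    have hle : D * (2 * h) ≤ k := by
      have := Nat.div_mul_le_self k (2 * D)
      rw [← hh] at this
      linarith
    have e1 : (2 : ℝ) ^ (2 * h) * ρ ^ k ≤ 1 :=
      calc (2 : ℝ) ^ (2 * h) * ρ ^ k ≤ 2 ^ (2 * h) * ρ ^ (D * (2 * h)) :=
            mul_le_mul_of_nonneg_left (pow_le_pow_of_le_one hρ0 hρ1.le hle) (by positivity)
        _ = (2 * ρ ^ D) ^ (2 * h) := by rw [mul_pow, ← pow_mul]
        _ ≤ 1 := pow_le_one₀ (by positivity) (by linarith)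
    calc (2 : ℝ) ^ (2 * h) * x ^ k = 2 ^ (2 * h) * ρ ^ k * ρ ^ k := by
          rw [← hρ2, ← pow_mul, two_mul k, pow_add, mul_assoc]
      _ ≤ 1 * ρ ^ k := mul_le_mul_of_nonneg_right e1 (by positivity)
      _ = _ := one_mul _
  · rw [pow_mul]
    refine pow_le_pow_left₀ (by positivity) ((cbRatio_two_mul_sq_le _).trans ?_) a
    have hk' : (0 : ℝ) < k := by exact_mod_cast hk
    have hD' : (0 : ℝ) < D := by exact_mod_cast hD0
    rw [div_le_div_iff₀ (by positivity) hk']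
    have e : k < 2 * D * (k / (2 * D) + 1) := Nat.lt_mul_div_succ k (by omega)
    have e' : (k : ℝ) ≤ 2 * D * ((k / (2 * D) : ℕ) + 1) := by exact_mod_cast e.le
    have : (0 : ℝ) ≤ 2 * D * (k / (2 * D) : ℕ) := by positivity
    nlinarith

/-- The error terms of the union bound vanish in the limit. -/
lemma tendsto_error (x y ρ C : ℝ) (hx : |x| < 1) (hy : |y| < 1) (hρ : |ρ| < 1) :
    Tendsto (fun k : ℕ => 2 ^ 32 * ((k : ℝ) ^ 32 * x ^ k) + 2 ^ 64 * (C * (k : ℝ)⁻¹ +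
      140 * ((k : ℝ) ^ 65 * ρ ^ k) + (k : ℝ) ^ 64 * y ^ k + 3 * (k : ℝ)⁻¹)) atTop (nhds 0) := by
  have hi : Tendsto (fun k : ℕ => (k : ℝ)⁻¹) atTop (nhds 0) := tendsto_inv_atTop_nhds_zero_nat
  have h1 := tendsto_pow_const_mul_const_pow_of_abs_lt_one 32 hx
  have h2 := tendsto_pow_const_mul_const_pow_of_abs_lt_one 65 hρ
  have h3 := tendsto_pow_const_mul_const_pow_of_abs_lt_one 64 hy
  simpa using (h1.const_mul (2 ^ 32)).add
    (((((hi.const_mul C).add (h2.const_mul 140)).add h3).add (hi.const_mul 3)).const_mul (2 ^ 64))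

lemma exp_quarter_div_two : |Real.exp (1 / 4) / 2| < 1 := by
  have h : Real.exp (1 / 4) < 2 := by
    rw [← Real.lt_log_iff_exp_lt (by norm_num)]
    linarith [Real.log_two_gt_d9]
  rw [abs_of_pos (by positivity)]
  linarith

lemma one_add_exp_neg_one_div_two : |(1 + Real.exp (-1)) / 2| < 1 := by
  have h : Real.exp (-1) < 1 := by rw [Real.exp_lt_one_iff]; norm_num
  rw [abs_of_pos (by positivity)]
  linarith

/-- In the sparse regime, colour refinement distinguishes all the vertices it should. -/
theorem expect_confused_sparse {ε : ℝ} (hε : 0 < ε) : ∃ k₀ : ℕ, ∀ k ≥ k₀, ∀ n : ℕ,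
    k ^ 32 ≤ n → n ≤ (2 * k) ^ 32 → ∀ (G₀ : SimpleGraph (Fin n)) (q : ℝ), 1 ≤ q * n →
    q * n ≤ k / 4 → expect q (fun f => if Confused G₀ f then (1 : ℝ) else 0) ≤ ε := by
  obtain ⟨c, hc0, hc1, hc⟩ := exists_le_binomial (2 * 140 + 2)
  have hc4 : 0 < c ^ 4 := by positivity
  have hc4' : c ^ 4 ≤ 1 := pow_le_one₀ hc0.le hc1
  obtain ⟨D, hD, ρ, hρ0, hρ1, hρ⟩ :=
    exists_row_bound (x := 1 - c ^ 4 / 2) (by linarith) (by linarith)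
  have hlim := tendsto_error _ _ ρ ((2 * D) ^ 70) exp_quarter_div_two one_add_exp_neg_one_div_two
    (by rwa [abs_of_nonneg hρ0])
  obtain ⟨k₁, hk₁⟩ := eventually_atTop.1 (hlim.eventually_le_const hε)
  refine ⟨max k₁ 88200, fun k hk n hkn hnk G₀ q hq hqk => ?_⟩
  have hk88 : 88200 ≤ k := (le_max_right _ _).trans hk
  refine le_trans ?_ (hk₁ k ((le_max_left _ _).trans hk))
  obtain ⟨N', hN1, hN2⟩ := hρ k (by omega)
  have hkR : (88200 : ℝ) ≤ k := by exact_mod_cast hk88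
  have hk0 : (0 : ℝ) < k := by linarith
  have hknR : (k : ℝ) ^ 32 ≤ n := by exact_mod_cast hkn
  have hnkR : (n : ℝ) ≤ (2 * k) ^ 32 := by exact_mod_cast hnk
  have hn0 : (0 : ℝ) < n := lt_of_lt_of_le (by positivity) hknR
  have hq0 : 0 < q := pos_of_mul_pos_left (by linarith) hn0.le
  have hk2 : 3360 * k ^ 2 ≤ k ^ 32 :=
    calc 3360 * k ^ 2 ≤ k * k ^ 2 := Nat.mul_le_mul_right _ (by omega)
      _ = k ^ 3 := by ring
      _ ≤ k ^ 32 := Nat.pow_le_pow_right (by omega) (by norm_num)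
  have hkk : k ≤ k ^ 2 := Nat.le_self_pow (by norm_num) k
  have hqk' : q * (13440 * k) ≤ 1 := by
    have : (3360 : ℝ) * k ^ 2 ≤ k ^ 32 := by exact_mod_cast hk2
    have e : q * (3360 * k ^ 2) ≤ k / 4 :=
      (mul_le_mul_of_nonneg_left (this.trans hknR) hq0.le).trans hqk
    refine le_of_mul_le_mul_right (le_trans (le_of_eq ?_)
      ((mul_le_mul_of_nonneg_left e (by norm_num : (0 : ℝ) ≤ 4)).trans (le_of_eq ?_))) hk0 <;> ring
  have hqs : q * 13440 ≤ 1 := by nlinarith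
  set r := ⌊1 / (24 * q)⌋₊ with hr
  have hr1 : (r : ℝ) ≤ 1 / (24 * q) := Nat.floor_le (by positivity)
  have hr2 : 1 / (24 * q) < r + 1 := Nat.lt_floor_add_one _
  have hr3 : 2 * (2 * 140 + 2) ≤ r := by
    refine Nat.le_floor ?_
    rw [le_div_iff₀ (by positivity)]
    push_cast
    nlinarith
  have hr4 : 1 / (48 * q) ≤ r := by
    have e : 1 / (24 * q) = 2 * (1 / (48 * q)) := by field_simp; norm_num
    have e' : 1 ≤ 1 / (48 * q) := by
      rw [le_div_iff₀ (by positivity)]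
      linarith
    linarith
  have hr5 : (r : ℝ) * q ≤ 1 / 24 := by
    rw [le_div_iff₀ (by positivity)] at hr1
    linarith
  have hr6 : 24 * r ≤ n := by
    have e : 1 / (24 * q) ≤ n / 24 := by
      rw [div_le_div_iff₀ (by positivity) (by norm_num)]
      linarith
    have : (24 : ℝ) * r ≤ n := by linarith
    exact_mod_cast this
  have hn1 : k * (3 * (140 * k)) = 420 * k ^ 2 := by ring
  have hl : (1 : ℝ) ≤ k ^ 25 := one_le_pow₀ (by linarith)
  refine (expect_confused_le G₀ (m := 140) (N := k) (r := r) (N' := N') (t₀ := k) (Δ := k)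
    (c := c) (l := k ^ 25) (by linarith) hq hc0.le
    (hc q r hq0 (by linarith) hr3 hr4 hr5) hl (by rw [hn1]; omega) (by rw [hn1]; omega)).trans ?_
  have hE : Real.exp (n * q) / 2 ^ k ≤ (Real.exp (1 / 4) / 2) ^ k := by
    rw [div_pow, ← Real.exp_nat_mul]
    exact div_le_div_of_nonneg_right (Real.exp_le_exp.2 (by linarith)) (by positivity)
  have hF : (cbRatio N' ^ 140 + (140 : ℕ) * (2 ^ N' * (1 - c ^ 4 / 2) ^ k)) ≤
      (2 * D) ^ 70 / k ^ 70 + 140 * ρ ^ k := by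
    have := hN2 70
    rw [div_pow] at this
    push_cast
    linarith
  have hG : Real.exp (k ^ 25 * q * (k * (3 * (140 * k)) * (k + 1) : ℕ) *
      (k * (3 * (140 * k)) : ℕ)) ≤ 3 := by
    refine le_trans (Real.exp_le_exp.2 ?_) (Real.exp_one_lt_d9.le.trans (by norm_num))
    have e1 : q * k ^ 32 ≤ k / 4 := (mul_le_mul_of_nonneg_left hknR hq0.le).trans hqk
    have e2 : (k : ℝ) + 1 ≤ 2 * k := by linarith
    rw [hn1]
    push_cast
    have e3 : (k : ℝ) ^ 25 * q * (420 * k ^ 2 * (k + 1)) * (420 * k ^ 2) ≤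
        352800 * (q * k ^ 30) := by
      calc (k : ℝ) ^ 25 * q * (420 * k ^ 2 * (k + 1)) * (420 * k ^ 2)
          = 176400 * (q * k ^ 29) * (k + 1) := by ring
        _ ≤ 176400 * (q * k ^ 29) * (2 * k) := by gcongr
        _ = _ := by ring
    have e4 : q * k ^ 30 * k ≤ 1 / 4 := by
      refine le_of_mul_le_mul_right (le_trans (le_of_eq ?_) (e1.trans (le_of_eq ?_))) hk0 <;> ring
    have e5 : q * k ^ 30 * 88200 ≤ q * k ^ 30 * k := by gcongr
    linarith
  calc _ ≤ (2 * k : ℝ) ^ 32 * (Real.exp (1 / 4) / 2) ^ k + ((2 * k) ^ 32) ^ 2 *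
        (k * ((2 * D) ^ 70 / k ^ 70 + 140 * ρ ^ k) + (((1 + Real.exp (-1)) / 2) ^ k +
          k * (3 / (k ^ 25) ^ 3))) := by
        refine add_le_add (mul_le_mul hnkR hE (by positivity) (by positivity))
          (mul_le_mul (pow_le_pow_left₀ hn0.le hnkR 2)
            (add_le_add (mul_le_mul_of_nonneg_left hF hk0.le) (add_le_add le_rfl
              (mul_le_mul_of_nonneg_left (div_le_div_of_nonneg_right hG (by positivity)) hk0.le)))
            ?_ (by positivity))
        have h1 := cbRatio_nonneg N'
        have h2 : 0 ≤ 1 - c ^ 4 / 2 := by linarith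
        exact add_nonneg (mul_nonneg hk0.le (add_nonneg (pow_nonneg h1 _) (by positivity)))
          (add_nonneg (by positivity)
            (mul_nonneg hk0.le (div_nonneg (Real.exp_nonneg _) (by positivity))))
    _ ≤ _ := by
        have e1 : (k : ℝ) ^ 64 * (k * ((2 * D) ^ 70 / k ^ 70)) ≤ (2 * D) ^ 70 * (k : ℝ)⁻¹ := by
          have : (k : ℝ) ^ 64 * (k * ((2 * D) ^ 70 / k ^ 70)) = (2 * D) ^ 70 * ((k : ℝ) ^ 5)⁻¹ := by
            field_simp
          rw [this]
          gcongr
          exact le_self_pow₀ (by linarith) (by norm_num)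
        have e2 : (k : ℝ) ^ 64 * (k * (3 / (k ^ 25) ^ 3)) ≤ 3 * (k : ℝ)⁻¹ := by
          have : (k : ℝ) ^ 64 * (k * (3 / (k ^ 25) ^ 3)) = 3 * ((k : ℝ) ^ 10)⁻¹ := by
            field_simp
          rw [this]
          gcongr
          exact le_self_pow₀ (by linarith) (by norm_num)
        have e3 : ((2 * k : ℝ) ^ 32) ^ 2 = 2 ^ 64 * k ^ 64 := by rw [← pow_mul, mul_pow]
        rw [e3, mul_pow]
        have e4 : (2 : ℝ) ^ 64 * k ^ 64 * (k * ((2 * D) ^ 70 / k ^ 70 + 140 * ρ ^ k) +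
            (((1 + Real.exp (-1)) / 2) ^ k + k * (3 / (k ^ 25) ^ 3))) =
            2 ^ 64 * (k ^ 64 * (k * ((2 * D) ^ 70 / k ^ 70)) + 140 * (k ^ 65 * ρ ^ k) +
              k ^ 64 * ((1 + Real.exp (-1)) / 2) ^ k +
              k ^ 64 * (k * (3 / (k ^ 25) ^ 3))) := by ring
        rw [e4, mul_assoc]
        gcongr

end Asymptotics

section Dense

/-- The sum modulo two of independent biased bits is a biased bit. -/
lemma expect_xor {ι : Type*} [Fintype ι] [DecidableEq ι] {p a b : ℝ} (h : p = a + b - 2 * a * b)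
    (F : (ι → Bool) → ℝ) :
    expect p F = expect a fun f => expect b fun g => F fun i => xor (f i) (g i) := by
  have hsub : ∀ f : ι → Bool, (expect b fun g => F fun i => xor (f i) (g i)) =
      ∑ g, confW b (fun i => xor (f i) (g i)) * F g := by
    intro f
    unfold expect
    have hinv : Function.Involutive fun (g : ι → Bool) i => xor (f i) (g i) := fun g => by
      funext i; simp
    refine (Equiv.sum_comp hinv.toPerm _).symm.trans (sum_congr rfl fun g _ => ?_)
    simp
  have hconv : ∀ g : ι → Bool,
      expect a (fun f => confW b fun i => xor (f i) (g i)) = confW p g := by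
    intro g
    unfold confW
    rw [expect_prod a fun i c => bitW b (xor c (g i))]
    refine prod_congr rfl fun i _ => ?_
    cases g i <;> simp [bitW, h] <;> ring
  simp only [hsub]
  rw [expect_sum]
  refine sum_congr rfl fun g _ => ?_
  rw [← hconv g, mul_comm, ← expect_mul_left]
  simp only [mul_comm]

lemma pert_xor {n : ℕ} (G₀ : SimpleGraph (Fin n)) (f g : Sym2 (Fin n) → Bool) :
    pert G₀ (fun i => xor (f i) (g i)) = pert (pert G₀ f) g := by
  ext a b
  rw [pert_adj, pert_adj, pert_adj]
  by_cases hab : a = b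
  · simp [hab]
  · by_cases h : G₀.Adj a b <;> cases f s(a, b) <;> cases g s(a, b) <;> simp [hab, h]

/-- In a graph of minimum degree at least five, all vertices are safe. -/
lemma mem_V23safe_of_degree {V : Type*} [Fintype V] {H : SimpleGraph V}
    (h : ∀ a, 5 ≤ #{b | H.Adj a b}) (a : V) : a ∈ V23safe H := by
  have hcore : ∀ a, a ∈ kCore H 2 := fun a => by
    refine Set.mem_sUnion.2 ⟨Set.univ, fun a _ => ?_, Set.mem_univ a⟩
    rw [Nat.card_eq_fintype_card, Fintype.card_subtype]
    simpa using le_trans (by norm_num) (h a)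
  have h23 : ∀ a, a ∈ V23 H := fun a => by
    refine ⟨hcore a, ?_⟩
    rw [Nat.card_eq_fintype_card, Fintype.card_subtype]
    simpa [hcore] using le_trans (by norm_num) (h a)
  refine ⟨h23 a, fun T hT haT => ?_⟩
  rw [Nat.card_eq_fintype_card, Fintype.card_subtype]
  have hsub : ({b | H.Adj a b} : Finset V) \ T ⊆
      ({w | w ∈ V23 H ∧ (avoidG H (T : Set V)).Reachable a w} : Finset V) := by
    intro b hb
    rw [Finset.mem_sdiff, mem_filter] at hb
    refine mem_filter.2 ⟨mem_univ b, h23 b, SimpleGraph.Adj.reachable ?_⟩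
    rw [avoidG, SimpleGraph.fromRel_adj]
    exact ⟨hb.1.2.ne, Or.inl ⟨hb.1.2, haT, hb.2⟩⟩
  have := le_card_sdiff T ({b | H.Adj a b} : Finset V)
  have := card_le_card hsub
  have := h a
  omega

variable {n : ℕ} (G₀ : SimpleGraph (Fin n))

/-- Degrees in a fairly dense random graph are rarely small. -/
lemma expect_exists_degree_le_five {q : ℝ} (h0 : 0 ≤ q) (h1 : q ≤ 1) :
    expect q (fun f : Sym2 (Fin n) → Bool =>
      if ∃ a, #{b | f s(a, b) = true} ≤ 5 then (1 : ℝ) else 0) ≤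
      n * (32 * Real.exp (-(n * q / 2))) := by
  refine (expect_mono h0 h1 fun f =>
    ite_exists_le_sum fun a : Fin n => #{b | f s(a, b) = true} ≤ 5).trans ?_
  rw [expect_sum]
  refine (sum_le_sum fun a _ => (?_ : _ ≤ 32 * Real.exp (-(n * q / 2)))).trans (by simp)
  set D : Finset (Sym2 (Fin n)) := univ.image fun b => s(a, b) with hD
  have hinj : Function.Injective fun b : Fin n => s(a, b) := fun b b' h => Sym2.congr_right.1 h
  have hDc : #D = n := by rw [hD, card_image_of_injective _ hinj, card_univ, Fintype.card_fin]
  calc _ ≤ expect q (fun f : Sym2 (Fin n) → Bool =>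
        32 * ∏ i ∈ D, if f i then (1 / 2 : ℝ) else 1) := by
        refine expect_mono h0 h1 fun f => ?_
        have e : ∏ i ∈ D, (if f i then (1 / 2 : ℝ) else 1) =
            (1 / 2) ^ #{b | f s(a, b) = true} := by
          rw [hD, prod_image fun x _ y _ h => hinj h, prod_ite, prod_const, prod_const_one, mul_one]
        rw [e]
        split_ifs with h
        · calc (1 : ℝ) = 32 * (1 / 2) ^ 5 := by norm_num
            _ ≤ _ := by
              gcongr ?_ * ?_
              exact pow_le_pow_of_le_one (by norm_num) (by norm_num) h
        · positivity
    _ = 32 * (1 - q / 2) ^ n := by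
        rw [expect_mul_left, expect_prod_mem, hDc]
        ring
    _ ≤ 32 * Real.exp (-(n * q / 2)) := by
        refine mul_le_mul_of_nonneg_left ?_ (by positivity)
        have : -(n * q / 2) = n * (-(q / 2)) := by ring
        rw [this, Real.exp_nat_mul]
        refine pow_le_pow_left₀ (by linarith) ?_ n
        linarith [Real.add_one_le_exp (-(q / 2))]

/-- In the dense regime, colour refinement distinguishes all vertices. -/
theorem expect_stable_pair_dense {ε : ℝ} (hε : 0 < ε) : ∃ k₀ : ℕ, ∀ k ≥ k₀, ∀ n : ℕ,
    k ^ 32 ≤ n → n ≤ (2 * k) ^ 32 → ∀ (G₀ : SimpleGraph (Fin n)) (p : ℝ), p ≤ 1 / 2 →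
    k / 4 ≤ p * n → expect p (fun f => if ∃ u v, u ≠ v ∧ crStableTrivial (pert G₀ f) u v
      then (1 : ℝ) else 0) ≤ ε := by
  obtain ⟨k₁, hk₁⟩ := expect_confused_sparse (half_pos hε)
  have hx : |Real.exp (-(1 / 8))| < 1 := by
    rw [abs_of_pos (Real.exp_pos _), Real.exp_lt_one_iff]
    norm_num
  have hlim := (tendsto_pow_const_mul_const_pow_of_abs_lt_one 32 hx).const_mul (2 ^ 32 * 32)
  rw [mul_zero] at hlim
  obtain ⟨k₂, hk₂⟩ := eventually_atTop.1 (hlim.eventually_le_const (half_pos hε))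
  refine ⟨max 4 (max k₁ k₂), fun k hk n hkn hnk G₀ p hp hpk => ?_⟩
  have hk4 : 4 ≤ k := (le_max_left _ _).trans hk
  have hk1 : k₁ ≤ k := (le_max_left _ _).trans ((le_max_right _ _).trans hk)
  have hk2 : k₂ ≤ k := (le_max_right _ _).trans ((le_max_right _ _).trans hk)
  have hk4R : (4 : ℝ) ≤ k := by exact_mod_cast hk4
  have hkn' : (k : ℝ) ≤ n := by exact_mod_cast (Nat.le_self_pow (by norm_num) k).trans hkn
  have hn0 : (0 : ℝ) < n := by linarith
  have hnkR : (n : ℝ) ≤ (2 * k) ^ 32 := by exact_mod_cast hnk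
  set b : ℝ := k / 4 / n with hb
  have hbn : b * n = k / 4 := by rw [hb]; field_simp
  have hb0 : 0 ≤ b := by positivity
  have hbp : b ≤ p := by rwa [hb, div_le_iff₀ hn0]
  have hb4 : b ≤ 1 / 4 := by
    rw [hb, div_le_iff₀ hn0]
    linarith
  set a : ℝ := (p - b) / (1 - 2 * b) with ha
  have ha0 : 0 ≤ a := div_nonneg (by linarith) (by linarith)
  have ha1 : a ≤ 1 := by
    rw [ha, div_le_one (by linarith)]
    linarith
  have hab : p = a + b - 2 * a * b := by
    have : a * (1 - 2 * b) = p - b := div_mul_cancel₀ _ (by linarith)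
    linarith
  rw [expect_xor hab]
  refine (expect_mono (G := fun _ => ε) ha0 ha1 fun f => ?_).trans (expect_const a ε).le
  have hpt : ∀ g : Sym2 (Fin n) → Bool,
      (if ∃ u v, u ≠ v ∧ crStableTrivial (pert G₀ fun i => xor (f i) (g i)) u v
        then (1 : ℝ) else 0) ≤
      (if Confused (pert G₀ f) g then (1 : ℝ) else 0) +
        if ∃ a, #{b | g s(a, b) = true} ≤ 5 then (1 : ℝ) else 0 := fun g => by
    refine ite_le_add_ite ?_
    rintro ⟨u, v, huv, hst⟩
    rw [pert_xor] at hst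
    by_cases hdeg : ∃ a, #{b | g s(a, b) = true} ≤ 5
    · exact Or.inr hdeg
    · refine Or.inl ⟨u, v, huv, Or.inl (mem_V23safe_of_degree (fun a => ?_) u), hst⟩
      push Not at hdeg
      have hsub : ({b | g s(a, b) = true} : Finset (Fin n)).erase a ⊆
          ({b | (graphOfFlip g).Adj a b} : Finset (Fin n)) := by
        intro b hb
        rw [mem_erase, mem_filter] at hb
        exact mem_filter.2 ⟨mem_univ b, (graphOfFlip_adj g a b).2 ⟨hb.1.symm, hb.2.2⟩⟩
      have h1 := card_le_card hsub
      have h2 := pred_card_le_card_erase (s := ({b | g s(a, b) = true} : Finset (Fin n))) (a := a)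
      have h3 := hdeg a
      omega
  refine (expect_mono hb0 (by linarith) hpt).trans ?_
  rw [expect_add, ← add_halves ε]
  refine add_le_add (hk₁ k hk1 n hkn hnk (pert G₀ f) b (by linarith) hbn.le) ?_
  refine (expect_exists_degree_le_five hb0 (by linarith)).trans (le_trans ?_ (hk₂ k hk2))
  have e : -(n * b / 2) = k * (-(1 / 8)) := by
    rw [mul_comm (n : ℝ), hbn]
    ring
  rw [e, Real.exp_nat_mul]
  calc (n : ℝ) * (32 * Real.exp (-(1 / 8)) ^ k)
      ≤ (2 * k) ^ 32 * (32 * Real.exp (-(1 / 8)) ^ k) :=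
        mul_le_mul_of_nonneg_right hnkR (by positivity)
    _ = _ := by rw [mul_pow]; ring

end Dense

section Main

lemma erdosRenyiMeasure_apply {n : ℕ} {p : ℝ} (h0 : 0 ≤ p) (h1 : p ≤ 1)
    (S : Set (Sym2 (Fin n) → Bool)) : erdosRenyiMeasure n p S =
      ENNReal.ofReal (expect p fun f => if f ∈ S then (1 : ℝ) else 0) := by
  have hS : ∀ f, 0 ≤ if f ∈ S then (1 : ℝ) else 0 := fun f => by split_ifs <;> norm_num
  unfold expect
  rw [erdosRenyiMeasure, bernoulliProduct, Measure.finsetSum_apply,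
    ENNReal.ofReal_sum_of_nonneg fun f _ => mul_nonneg (confW_nonneg h0 h1 f) (hS f)]
  refine sum_congr rfl fun f _ => ?_
  rw [Measure.smul_apply, Measure.dirac_apply, smul_eq_mul,
    ENNReal.ofReal_mul (confW_nonneg h0 h1 f), confW,
    ENNReal.ofReal_prod_of_nonneg fun i _ => bitW_nonneg h0 h1 (f i)]
  congr 1
  · refine prod_congr (by congr!) fun i _ => ?_
    cases f i <;> simp [bitW]
  · by_cases h : f ∈ S <;> simp [h]

lemma exists_pow_le_and_lt (n : ℕ) :
    ∃ k : ℕ, k ^ 32 ≤ n ∧ n < (k + 1) ^ 32 := by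
  have h : ∃ k : ℕ, n < (k + 1) ^ 32 :=
    ⟨n, (Nat.lt_succ_self n).trans_le (Nat.le_self_pow (by norm_num) _)⟩
  refine ⟨Nat.find h, ?_, Nat.find_spec h⟩
  rcases Nat.eq_zero_or_pos (Nat.find h) with h0 | h0
  · rw [h0]
    exact Nat.zero_le n
  · have := Nat.find_min h (Nat.sub_one_lt_of_lt h0)
    rwa [Nat.sub_one_add_one h0.ne', not_lt] at this

/-- Colour refinement distinguishes all required pairs with high probability. -/
theorem eventually_expect_not_distinguished_le {ε : ℝ} (hε : 0 < ε) : ∃ n₀ : ℕ, ∀ n ≥ n₀,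
    ∀ (G₀ : SimpleGraph (Fin n)) (p : ℝ), p ≤ 1 / 2 → 1 ≤ p * n →
      expect p (fun f => if Confused G₀ f then (1 : ℝ) else 0) ≤ ε := by
  obtain ⟨k₁, hk₁⟩ := expect_confused_sparse hε
  obtain ⟨k₂, hk₂⟩ := expect_stable_pair_dense hε
  refine ⟨(max k₁ k₂ + 2) ^ 32, fun n hn G₀ p hp hpn => ?_⟩
  obtain ⟨k, hkn, hnk⟩ := exists_pow_le_and_lt n
  have hk : max k₁ k₂ + 2 < k + 1 := lt_of_pow_lt_pow_left₀ 32 (by omega) (hn.trans_lt hnk)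
  have hnk' : n ≤ (2 * k) ^ 32 := hnk.le.trans (Nat.pow_le_pow_left (by omega) 32)
  rcases le_total (p * n) (k / 4) with h | h
  · exact hk₁ k (by omega) n hkn hnk' G₀ p hpn h
  · have h0 : 0 ≤ p := by
      by_contra h'
      have : p * n ≤ 0 := mul_nonpos_of_nonpos_of_nonneg (by linarith) (Nat.cast_nonneg n)
      linarith
    refine (expect_mono h0 (by linarith) fun f => ?_).trans
      (hk₂ k (by omega) n hkn hnk' G₀ p hp h)
    have : Confused G₀ f → ∃ u v, u ≠ v ∧ crStableTrivial (pert G₀ f) u v :=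
      fun ⟨u, v, huv, _, hst⟩ => ⟨u, v, huv, hst⟩
    split_ifs with h1 h2 h2
    · exact le_rfl
    · exact absurd (this h1) h2
    · exact zero_le_one
    · exact le_rfl

end Main
end ColRef

/-- Proposition 5.2 / Proposition 4.3 of the paper, "Proposition 2core".
For `p = p_n ∈ [0,1/2]` with (eventually) `p ≥ (1+(log n)^{-40})/n`, and any sequence `G₀`,
whp `G = G₀ △ G_rand` has the property that `u,v` get distinct colours in `R*σ` for all
distinct `u,v` such that (A1) `u ∈ V_{2,3}^{safe}(G_rand)`, or (A2) `u,v ∈ V_{2,3}(G_rand)`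
and `G₀` is the empty graph. -/
theorem stmt6 (p : ℕ → ℝ) (hp0 : ∀ n, 0 ≤ p n) (hp1 : ∀ n, p n ≤ 1 / 2)
    (hlb : ∀ᶠ n : ℕ in atTop, (1 + ((Real.log n) ^ 40)⁻¹) / n ≤ p n)
    (G₀ : (n : ℕ) → SimpleGraph (Fin n)) :
    Tendsto (fun n : ℕ =>
      erdosRenyiMeasure n (p n)
        {f | ∀ u v : Fin n, u ≠ v →
          (u ∈ V23safe (graphOfFlip f) ∨
            (u ∈ V23 (graphOfFlip f) ∧ v ∈ V23 (graphOfFlip f) ∧ G₀ n = ⊥)) →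
          ¬ crStableTrivial (symmDiffG (G₀ n) (graphOfFlip f)) u v})
      atTop (nhds 1) := by
  refine tendsto_order.2 ⟨fun a ha => ?_, fun a ha => Eventually.of_forall fun n => ?_⟩
  · obtain ⟨δ, hδ, haδ⟩ : ∃ δ : ℝ, 0 < δ ∧ a < ENNReal.ofReal (1 - δ) := by
      lift a to NNReal using ne_top_of_lt ha
      have ha' : (a : ℝ) < 1 := by exact_mod_cast ha
      refine ⟨(1 - a) / 2, by linarith, ?_⟩
      rw [ENNReal.lt_ofReal_iff_toReal_lt ENNReal.coe_ne_top, ENNReal.coe_toReal]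
      linarith
    obtain ⟨n₀, hn₀⟩ := ColRef.eventually_expect_not_distinguished_le hδ
    filter_upwards [hlb, eventually_ge_atTop (max n₀ 1)] with n hlb hn
    have hn1 : (0 : ℝ) < n := by exact_mod_cast (le_max_right n₀ 1).trans hn
    have hpn : 1 ≤ p n * n := by
      rw [div_le_iff₀ hn1] at hlb
      have : (0 : ℝ) ≤ (Real.log n ^ 40)⁻¹ := by positivity
      linarith
    refine haδ.trans_le ?_
    rw [ColRef.erdosRenyiMeasure_apply (hp0 n) (by linarith [hp1 n])]
    refine ENNReal.ofReal_le_ofReal ?_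
    have hC := hn₀ n ((le_max_left _ _).trans hn) (G₀ n) (p n) (hp1 n) hpn
    rw [sub_le_iff_le_add]
    refine le_trans ?_ (add_le_add le_rfl hC)
    rw [← ColRef.expect_add]
    refine (ColRef.expect_const (ι := Sym2 (Fin n)) (p n) 1).ge.trans ?_
    refine ColRef.expect_mono (hp0 n) (by linarith [hp1 n]) fun f => ?_
    by_cases hf : ColRef.Confused (G₀ n) f
    · rw [if_pos hf]
      split_ifs <;> norm_num
    · rw [if_pos, if_neg hf, add_zero]
      exact fun u v huv h hst => hf ⟨u, v, huv, Or.imp_right (fun h => ⟨h.1, h.2.1⟩) h, hst⟩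
  · refine lt_of_le_of_lt ?_ ha
    rw [ColRef.erdosRenyiMeasure_apply (hp0 n) (by linarith [hp1 n])]
    refine ENNReal.ofReal_le_one.2 ?_
    refine (ColRef.expect_mono (G := fun _ => 1) (hp0 n) (by linarith [hp1 n]) fun f => ?_).trans
      (ColRef.expect_const _ _).le
    split_ifs <;> norm_num
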